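/- Let N ≥ 3 be an integer, let a, b > −2, and let p ≥ q > 0 with pq > 1. Assume that N/(p+1) + N/(q+1) > N−2 and that 2(p+1)/(pq−1) > N−3. Then there exists a constant C > 0, depending only on N, p, q, a, b, such that for every ρ ≥ 0 and every positive solution (u, v) of the Hardy–Hénon system on the exterior domain Ω = {x ∈ ℝ^N : |x| > ρ}, one has u(x) ≤ C |x|^{−α − (a+bp)/(pq−1)} and v(x) ≤ C |x|^{−β − (b+aq)/(pq−1)} for all x with |x| > 2ρ. -/

import Mathlib

open MeasureTheory Metric Set Filter

/-- The Euclidean Laplacian of `u : ℝ^N → ℝ`, as the sum of the second derivatives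
along the standard coordinate directions. -/
noncomputable def lap {N : ℕ} (u : EuclideanSpace ℝ (Fin N) → ℝ)
    (x : EuclideanSpace ℝ (Fin N)) : ℝ :=
  ∑ i : Fin N, iteratedFDeriv ℝ 2 u x ![EuclideanSpace.single i 1, EuclideanSpace.single i 1]

/-- `(u, v)` is a positive solution of the Hardy–Hénon system
`-Δu = |x|^a v^p`, `-Δv = |x|^b u^q` on the set `Ω`:
`u, v` are continuous on `Ω`, `C²` on `Ω \ {0}`, positive on `Ω`, and
the equations hold on `Ω \ {0}`. -/
def IsHHSol {N : ℕ} (a b p q : ℝ) (Ω : Set (EuclideanSpace ℝ (Fin N)))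
    (u v : EuclideanSpace ℝ (Fin N) → ℝ) : Prop :=
  ContinuousOn u Ω ∧ ContinuousOn v Ω ∧
  ContDiffOn ℝ 2 u (Ω \ {0}) ∧ ContDiffOn ℝ 2 v (Ω \ {0}) ∧
  (∀ x ∈ Ω, 0 < u x) ∧ (∀ x ∈ Ω, 0 < v x) ∧
  (∀ x ∈ Ω \ {0}, -lap u x = ‖x‖ ^ a * v x ^ p) ∧
  (∀ x ∈ Ω \ {0}, -lap v x = ‖x‖ ^ b * u x ^ q)

namespace HardyHenon

variable {N : ℕ}

/-- Euclidean space of dimension `N`. -/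
abbrev Euc (N : ℕ) := EuclideanSpace ℝ (Fin N)

/-- The `i`-th partial derivative. -/
noncomputable def pd (i : Fin N) (f : Euc N → ℝ) (x : Euc N) : ℝ :=
  fderiv ℝ f x (EuclideanSpace.single i 1)

lemma contDiff_pd {n m : ℕ∞} {f : Euc N → ℝ} (hf : ContDiff ℝ n f) (h : m + 1 ≤ n) (i : Fin N) :
    ContDiff ℝ m (pd i f) := by
  have h1 : ContDiff ℝ m (fderiv ℝ f) := hf.fderiv_right (by exact_mod_cast h)
  exact h1.clm_apply contDiff_const

lemma contDiff_pd_one {f : Euc N → ℝ} (hf : ContDiff ℝ 2 f) (i : Fin N) :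
    ContDiff ℝ 1 (pd i f) :=
  contDiff_pd (n := 2) (m := 1) hf (by norm_num) i

lemma continuous_pd {f : Euc N → ℝ} (hf : ContDiff ℝ 1 f) (i : Fin N) : Continuous (pd i f) :=
  (contDiff_pd (n := 1) (m := 0) hf (by norm_num) i).continuous

lemma continuous_pd_pd {f : Euc N → ℝ} (hf : ContDiff ℝ 2 f) (i j : Fin N) :
    Continuous (pd i (pd j f)) :=
  continuous_pd (contDiff_pd_one hf j) i

lemma pd_congr {f g : Euc N → ℝ} {x : Euc N} (h : f =ᶠ[nhds x] g) (i : Fin N) :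
    pd i f x = pd i g x := by
  rw [pd, pd, h.fderiv_eq]

lemma pd_mul {f g : Euc N → ℝ} {x : Euc N} (hf : DifferentiableAt ℝ f x)
    (hg : DifferentiableAt ℝ g x) (i : Fin N) :
    pd i (fun y => f y * g y) x = f x * pd i g x + pd i f x * g x := by
  simp [pd, fderiv_fun_mul hf hg]; ring

lemma pd_add {f g : Euc N → ℝ} {x : Euc N} (hf : DifferentiableAt ℝ f x)
    (hg : DifferentiableAt ℝ g x) (i : Fin N) :
    pd i (fun y => f y + g y) x = pd i f x + pd i g x := by
  simp [pd, fderiv_fun_add hf hg]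

lemma pd_sub {f g : Euc N → ℝ} {x : Euc N} (hf : DifferentiableAt ℝ f x)
    (hg : DifferentiableAt ℝ g x) (i : Fin N) :
    pd i (fun y => f y - g y) x = pd i f x - pd i g x := by
  simp [pd, fderiv_fun_sub hf hg]

lemma pd_sum {ι : Type*} {s : Finset ι} {f : ι → Euc N → ℝ} {x : Euc N}
    (hf : ∀ j ∈ s, DifferentiableAt ℝ (f j) x) (i : Fin N) :
    pd i (fun y => ∑ j ∈ s, f j y) x = ∑ j ∈ s, pd i (f j) x := by
  simp [pd, fderiv_fun_sum hf]

lemma pd_const_mul {f : Euc N → ℝ} {x : Euc N} (c : ℝ) (hf : DifferentiableAt ℝ f x)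
    (i : Fin N) : pd i (fun y => c * f y) x = c * pd i f x := by
  simp [pd, fderiv_const_mul hf]

lemma pd_comp {f : Euc N → ℝ} {G : ℝ → ℝ} {G' : ℝ} {x : Euc N} (hf : DifferentiableAt ℝ f x)
    (hG : HasDerivAt G G' (f x)) (i : Fin N) :
    pd i (fun y => G (f y)) x = G' * pd i f x := by
  have := (hG.comp_hasFDerivAt x hf.hasFDerivAt).fderiv
  simp only [pd]
  change (fderiv ℝ (G ∘ f) x) _ = _
  rw [this]; simp

lemma pd_coord (i j : Fin N) (x : Euc N) :
    pd i (fun y => y j) x = if j = i then 1 else 0 := by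
  have : (fun y : Euc N => y j) = EuclideanSpace.proj (𝕜 := ℝ) j := by ext; simp
  rw [pd, this, ContinuousLinearMap.fderiv]
  simp

lemma pd_affine {f : Euc N → ℝ} {z : Euc N} {t : ℝ} {x : Euc N}
    (hf : DifferentiableAt ℝ f (z + t • x)) (i : Fin N) :
    pd i (fun y => f (z + t • y)) x = t * pd i f (z + t • x) := by
  have h2 : HasFDerivAt (fun y : Euc N => z + t • y)
      (t • ContinuousLinearMap.id ℝ (Euc N)) x :=
    ((hasFDerivAt_id x).const_smul t).const_add z
  have := (hf.hasFDerivAt.comp x h2).fderiv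
  simp only [pd]
  change (fderiv ℝ (f ∘ fun y => z + t • y) x) _ = _
  rw [this]; simp

lemma pd_const_affine {f : Euc N → ℝ} (hf : Differentiable ℝ f) (z : Euc N) (t : ℝ)
    (i : Fin N) :
    pd i (fun y => f (z + t • y)) = fun y => t * pd i f (z + t • y) :=
  funext fun _ => pd_affine (hf _) i

lemma lap_eq_sum_pd {f : Euc N → ℝ} {x : Euc N} (hf : ContDiffAt ℝ 2 f x) :
    lap f x = ∑ i, pd i (pd i f) x := by
  have h1 : DifferentiableAt ℝ (fderiv ℝ f) x :=
    (hf.fderiv_right (m := 1) (by norm_num)).differentiableAt (by norm_num)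
  simp only [lap, pd]
  refine Finset.sum_congr rfl fun i _ => ?_
  rw [iteratedFDeriv_two_apply]
  have : HasFDerivAt (fun y => fderiv ℝ f y (EuclideanSpace.single i 1))
      ((fderiv ℝ (fderiv ℝ f) x).flip (EuclideanSpace.single i 1)) x := by
    simpa using h1.hasFDerivAt.clm_apply (hasFDerivAt_const (EuclideanSpace.single i (1:ℝ)) x)
  change _ = fderiv ℝ (fun y => fderiv ℝ f y (EuclideanSpace.single i 1)) x _
  rw [this.fderiv]
  simp

lemma pd_comm {f : Euc N → ℝ} {x : Euc N} (hf : ContDiffAt ℝ 2 f x) (i j : Fin N) :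
    pd i (pd j f) x = pd j (pd i f) x := by
  have h1 : DifferentiableAt ℝ (fderiv ℝ f) x :=
    (hf.fderiv_right (m := 1) (by norm_num)).differentiableAt (by norm_num)
  have h : ∀ i j : Fin N, pd i (pd j f) x =
      fderiv ℝ (fderiv ℝ f) x (EuclideanSpace.single i 1) (EuclideanSpace.single j 1) := by
    intro i j
    have : HasFDerivAt (fun y => fderiv ℝ f y (EuclideanSpace.single j 1))
        ((fderiv ℝ (fderiv ℝ f) x).flip (EuclideanSpace.single j 1)) x := by
      simpa using h1.hasFDerivAt.clm_apply (hasFDerivAt_const (EuclideanSpace.single j (1:ℝ)) x)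
    simp only [pd]
    change fderiv ℝ (fun y => fderiv ℝ f y (EuclideanSpace.single j 1)) x _ = _
    rw [this.fderiv]
    simp
  rw [h, h]
  exact (hf.isSymmSndFDerivAt (by simp)).eq _ _

lemma lap_congr {f g : Euc N → ℝ} {x : Euc N} (h : f =ᶠ[nhds x] g) : lap f x = lap g x := by
  simp only [lap]
  rw [(h.iteratedFDeriv ℝ 2).eq_of_nhds]

lemma continuous_lap {f : Euc N → ℝ} (hf : ContDiff ℝ 2 f) : Continuous (lap f) := by
  have : lap f = fun x => ∑ i, pd i (pd i f) x := funext fun x => lap_eq_sum_pd hf.contDiffAt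
  rw [this]
  exact continuous_finsetSum _ fun i _ => continuous_pd_pd hf i i

lemma lap_mul {f g : Euc N → ℝ} (hf : ContDiff ℝ 2 f) (hg : ContDiff ℝ 2 g) (x : Euc N) :
    lap (fun y => f y * g y) x =
      f x * lap g x + 2 * ∑ i, pd i f x * pd i g x + lap f x * g x := by
  have df : Differentiable ℝ f := hf.differentiable (by norm_num)
  have dg : Differentiable ℝ g := hg.differentiable (by norm_num)
  rw [lap_eq_sum_pd (hf.mul hg).contDiffAt, lap_eq_sum_pd hf.contDiffAt,
    lap_eq_sum_pd hg.contDiffAt]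
  simp only [Finset.mul_sum, Finset.sum_mul, ← Finset.sum_add_distrib]
  refine Finset.sum_congr rfl fun i _ => ?_
  have h1 : pd i (fun y => f y * g y) = fun y => f y * pd i g y + pd i f y * g y :=
    funext fun y => pd_mul (df y) (dg y) i
  have d1 : Differentiable ℝ (pd i f) := (contDiff_pd_one hf i).differentiable (by norm_num)
  have d2 : Differentiable ℝ (pd i g) := (contDiff_pd_one hg i).differentiable (by norm_num)
  rw [h1, pd_add ((df x).fun_mul (d2 x)) ((d1 x).fun_mul (dg x)), pd_mul (df x) (d2 x),
    pd_mul (d1 x) (dg x)]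
  ring

lemma lap_affine {f : Euc N → ℝ} {z : Euc N} {t : ℝ} {x : Euc N}
    (hf : ContDiffAt ℝ 2 f (z + t • x)) :
    lap (fun y => f (z + t • y)) x = t ^ 2 * lap f (z + t • x) := by
  have hc : ContDiff ℝ 2 (fun y : Euc N => z + t • y) := by fun_prop
  have hcc : ContDiffAt ℝ 2 (fun y => f (z + t • y)) x := hf.comp x hc.contDiffAt
  rw [lap_eq_sum_pd hcc, lap_eq_sum_pd hf, Finset.mul_sum]
  refine Finset.sum_congr rfl fun i _ => ?_
  have hev : ∀ᶠ y in nhds x, DifferentiableAt ℝ f (z + t • y) := by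
    have h1 : ∀ᶠ w in nhds (z + t • x), ContDiffAt ℝ 2 f w := hf.eventually (by simp)
    have h2 := (hc.continuous.tendsto x).eventually h1
    exact h2.mono fun y hy => hy.differentiableAt (by norm_num)
  have h1 : pd i (fun y => f (z + t • y)) =ᶠ[nhds x] fun y => t * pd i f (z + t • y) :=
    hev.mono fun y hy => pd_affine hy i
  have hd : DifferentiableAt ℝ (pd i f) (z + t • x) := by
    have h3 : ContDiffAt ℝ 1 (fderiv ℝ f) (z + t • x) := hf.fderiv_right (by norm_num)
    exact (h3.clm_apply contDiffAt_const).differentiableAt (by norm_num)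
  rw [pd_congr h1, pd_const_mul, pd_affine hd]
  · ring
  · exact hd.comp x (f := fun y => z + t • y) (by fun_prop)

lemma lap_const_mul {f : Euc N → ℝ} {x : Euc N} (c : ℝ) (hf : ContDiffAt ℝ 2 f x) :
    lap (fun y => c * f y) x = c * lap f x := by
  simp only [lap]
  have : iteratedFDeriv ℝ 2 (fun y => c * f y) x = c • iteratedFDeriv ℝ 2 f x :=
    iteratedFDeriv_const_smul_apply (a := c) hf
  rw [this, Finset.mul_sum]
  simp

lemma hasCompactSupport_pd {f : Euc N → ℝ} (hf : HasCompactSupport f) (i : Fin N) :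
    HasCompactSupport (pd i f) :=
  hf.fderiv_apply ℝ _

/-- Integration by parts in a coordinate direction. -/
lemma integral_mul_pd {f g : Euc N → ℝ} (hf : ContDiff ℝ 1 f) (hg : ContDiff ℝ 1 g)
    (hgs : HasCompactSupport g) (i : Fin N) :
    ∫ x, f x * pd i g x = - ∫ x, pd i f x * g x := by
  refine integral_mul_fderiv_eq_neg_fderiv_mul_of_integrable ?_ ?_ ?_ ?_ ?_
  · exact ((continuous_pd hf i).mul hg.continuous).integrable_of_hasCompactSupport hgs.mul_left
  · exact (hf.continuous.mul (continuous_pd hg i)).integrable_of_hasCompactSupport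
      (hasCompactSupport_pd hgs i).mul_left
  · exact (hf.continuous.mul hg.continuous).integrable_of_hasCompactSupport hgs.mul_left
  · exact fun x _ => hf.differentiable (by norm_num) x
  · exact fun x _ => hg.differentiable (by norm_num) x

lemma hasCompactSupport_lap {f : Euc N → ℝ} (hf : ContDiff ℝ 2 f) (h : HasCompactSupport f) :
    HasCompactSupport (lap f) := by
  have : lap f = fun x => ∑ i, pd i (pd i f) x := funext fun x => lap_eq_sum_pd hf.contDiffAt
  rw [this]
  refine HasCompactSupport.intro h.isCompact fun x hx => ?_
  refine Finset.sum_eq_zero fun i _ => ?_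
  have h0 : f =ᶠ[nhds x] fun _ => 0 := notMem_tsupport_iff_eventuallyEq.1 hx
  have h1 : pd i f =ᶠ[nhds x] fun _ => 0 := by
    filter_upwards [h0.eventuallyEq_nhds] with y hy
    rw [pd_congr hy]; simp [pd]
  rw [pd_congr h1]; simp [pd]

/-- Green's second identity for a compactly supported test function. -/
lemma integral_mul_lap {f g : Euc N → ℝ} (hf : ContDiff ℝ 2 f) (hg : ContDiff ℝ 2 g)
    (hgs : HasCompactSupport g) :
    ∫ x, f x * lap g x = ∫ x, lap f x * g x := by
  have e1 : ∀ x, f x * lap g x = ∑ i, f x * pd i (pd i g) x := fun x => by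
    rw [lap_eq_sum_pd hg.contDiffAt, Finset.mul_sum]
  have e2 : ∀ x, lap f x * g x = ∑ i, pd i (pd i f) x * g x := fun x => by
    rw [lap_eq_sum_pd hf.contDiffAt, Finset.sum_mul]
  have hf1 : ContDiff ℝ 1 f := hf.of_le (by norm_num)
  have hg1 : ContDiff ℝ 1 g := hg.of_le (by norm_num)
  simp only [e1, e2]
  rw [integral_finsetSum, integral_finsetSum]
  · refine Finset.sum_congr rfl fun i _ => ?_
    rw [integral_mul_pd hf1 (contDiff_pd_one hg i) (hasCompactSupport_pd hgs i),
      integral_mul_pd (contDiff_pd_one hf i) hg1 hgs, neg_neg]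
  · exact fun i _ => ((continuous_pd_pd hf i i).mul hg.continuous).integrable_of_hasCompactSupport
      hgs.mul_left
  · exact fun i _ => (hf.continuous.mul (continuous_pd_pd hg i i)).integrable_of_hasCompactSupport
      (hasCompactSupport_pd (hasCompactSupport_pd hgs i) i).mul_left

lemma pd_norm_sq (x z : Euc N) (i : Fin N) :
    pd i (fun y => ‖y - z‖ ^ 2) x = 2 * (x i - z i) := by
  have h : HasFDerivAt (fun y : Euc N => ‖y - z‖ ^ 2)
      ((2 : ℕ) • (innerSL ℝ (x - z)).comp (ContinuousLinearMap.id ℝ (Euc N))) x :=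
    ((hasFDerivAt_id x).sub_const z).norm_sq
  rw [pd, h.fderiv]
  simp [EuclideanSpace.inner_single_right]

lemma contDiff_norm_sub_sq (z : Euc N) {n : WithTop ℕ∞} :
    ContDiff ℝ n (fun y : Euc N => ‖y - z‖ ^ 2) :=
  (contDiff_norm_sq ℝ).comp (contDiff_id.sub contDiff_const)

lemma pd_radial {G : ℝ → ℝ} {G' : ℝ} {x z : Euc N}
    (hG : HasDerivAt G G' (‖x - z‖ ^ 2)) (i : Fin N) :
    pd i (fun y => G (‖y - z‖ ^ 2)) x = 2 * (x i - z i) * G' := by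
  rw [pd_comp ((contDiff_norm_sub_sq z (n := 1)).differentiable (by norm_num) x) hG, pd_norm_sq]
  ring

lemma pd_pd_radial {G G' : ℝ → ℝ} {G'' : ℝ} {x z : Euc N}
    (hG : ∀ s, 0 ≤ s → HasDerivAt G (G' s) s) (hG' : HasDerivAt G' G'' (‖x - z‖ ^ 2))
    (i j : Fin N) :
    pd j (pd i (fun y => G (‖y - z‖ ^ 2))) x =
      2 * (if i = j then 1 else 0) * G' (‖x - z‖ ^ 2) +
        4 * (x i - z i) * (x j - z j) * G'' := by
  have h1 : pd i (fun y => G (‖y - z‖ ^ 2)) = fun y => 2 * (y i - z i) * G' (‖y - z‖ ^ 2) :=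
    funext fun y => pd_radial (hG _ (by positivity)) i
  have hd : DifferentiableAt ℝ (fun y : Euc N => ‖y - z‖ ^ 2) x :=
    (contDiff_norm_sub_sq z (n := 1)).differentiable (by norm_num) x
  have hc : DifferentiableAt ℝ (fun y : Euc N => y i - z i) x := by fun_prop
  have hd' : DifferentiableAt ℝ (fun y : Euc N => G' (‖y - z‖ ^ 2)) x :=
    hG'.differentiableAt.comp x hd
  rw [h1, pd_mul (by fun_prop) hd', pd_radial hG',
    pd_const_mul 2 hc, pd_sub (by fun_prop) (by fun_prop), pd_coord]
  have : pd j (fun _ : Euc N => z i) x = 0 := by simp [pd]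
  rw [this]
  ring

lemma sum_sub_sq (x z : Euc N) : ∑ i, (x i - z i) ^ 2 = ‖x - z‖ ^ 2 := by
  rw [EuclideanSpace.norm_sq_eq]; simp

/-- The Laplacian of a radial function. -/
lemma lap_radial {G G' : ℝ → ℝ} {G'' : ℝ} {x z : Euc N} (hGc : ContDiff ℝ 2 fun y : Euc N => G (‖y - z‖ ^ 2))
    (hG : ∀ s, 0 ≤ s → HasDerivAt G (G' s) s) (hG' : HasDerivAt G' G'' (‖x - z‖ ^ 2)) :
    lap (fun y => G (‖y - z‖ ^ 2)) x =
      4 * ‖x - z‖ ^ 2 * G'' + 2 * N * G' (‖x - z‖ ^ 2) := by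
  rw [lap_eq_sum_pd hGc.contDiffAt]
  simp only [pd_pd_radial hG hG']
  rw [Finset.sum_add_distrib]
  simp only [if_true, Finset.sum_const, Finset.card_univ, Fintype.card_fin]
  have : ∑ i, 4 * (x i - z i) * (x i - z i) * G'' = 4 * ‖x - z‖ ^ 2 * G'' := by
    rw [← sum_sub_sq x z, Finset.mul_sum, Finset.sum_mul]
    exact Finset.sum_congr rfl fun i _ => by ring
  rw [this]; simp; ring

/-- Half the homogeneity degree of the fundamental solution. -/
noncomputable def nu (N : ℕ) : ℝ := ((N : ℝ) - 2) / 2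

/-- Powers of the regularised squared distance. -/
noncomputable def rker (e δ : ℝ) (z y : Euc N) : ℝ := (‖y - z‖ ^ 2 + δ ^ 2) ^ e

/-- The regularised approximate identity `-Δ (|·|² + δ²)^{-ν}`. -/
noncomputable def aker (δ : ℝ) (z y : Euc N) : ℝ :=
  2 * N * nu N * δ ^ 2 * rker (-nu N - 2) δ z y

lemma nu_pos (hN : 3 ≤ N) : 0 < nu N := by
  have : (3 : ℝ) ≤ N := by exact_mod_cast hN
  rw [nu]; linarith

lemma rker_pos {δ : ℝ} (hδ : δ ≠ 0) (e : ℝ) (z y : Euc N) : 0 < rker e δ z y := by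
  have : 0 < δ ^ 2 := by positivity
  exact Real.rpow_pos_of_pos (by positivity) _

lemma contDiff_rker {δ : ℝ} (hδ : δ ≠ 0) (e : ℝ) (z : Euc N) {n : WithTop ℕ∞} :
    ContDiff ℝ n (rker e δ z) := by
  have h0 : 0 < δ ^ 2 := by positivity
  refine ContDiff.rpow_const_of_ne ((contDiff_norm_sub_sq z).add contDiff_const) fun y => ?_
  positivity

lemma hasDerivAt_shift_rpow {δ s : ℝ} (hδ : δ ≠ 0) (hs : 0 ≤ s) (c e : ℝ) :
    HasDerivAt (fun s => c * (s + δ ^ 2) ^ e) (c * e * (s + δ ^ 2) ^ (e - 1)) s := by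
  have h0 : 0 < δ ^ 2 := by positivity
  have := (((hasDerivAt_id s).add_const (δ ^ 2)).rpow_const (p := e)
    (Or.inl (by simp only [id]; positivity))).const_mul c
  exact this.congr_deriv (by simp only [id]; ring)

lemma pd_rker {δ : ℝ} (hδ : δ ≠ 0) (e : ℝ) (z : Euc N) (i : Fin N) (y : Euc N) :
    pd i (rker e δ z) y = 2 * e * (y i - z i) * rker (e - 1) δ z y := by
  have h := hasDerivAt_shift_rpow (s := ‖y - z‖ ^ 2) hδ (by positivity) 1 e
  simp only [one_mul] at h
  have := pd_radial h i
  change pd i (rker e δ z) y = _ at this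
  rw [this, rker]; ring

lemma pd_pd_rker {δ : ℝ} (hδ : δ ≠ 0) (e : ℝ) (z : Euc N) (i j : Fin N) (y : Euc N) :
    pd j (pd i (rker e δ z)) y =
      2 * (if i = j then 1 else 0) * e * rker (e - 1) δ z y +
        4 * (y i - z i) * (y j - z j) * (e * (e - 1)) * rker (e - 2) δ z y := by
  have h : ∀ s : ℝ, 0 ≤ s → HasDerivAt (fun s => (s + δ ^ 2) ^ e)
      (e * (s + δ ^ 2) ^ (e - 1)) s := fun s hs => by
    simpa using hasDerivAt_shift_rpow (s := s) hδ hs 1 e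
  have h2 := hasDerivAt_shift_rpow (s := ‖y - z‖ ^ 2) hδ (by positivity) e (e - 1)
  have := pd_pd_radial h h2 i j
  change pd j (pd i (rker e δ z)) y = _ at this
  rw [this, rker, rker, show e - 1 - 1 = e - 2 by ring]; ring

lemma rker_sub_one {δ : ℝ} (hδ : δ ≠ 0) (e : ℝ) (z y : Euc N) :
    rker (e + 1) δ z y = (‖y - z‖ ^ 2 + δ ^ 2) * rker e δ z y := by
  have h0 : 0 < δ ^ 2 := by positivity
  rw [rker, rker, Real.rpow_add_one (by positivity)]; ring

lemma lap_rker {δ : ℝ} (hδ : δ ≠ 0) (z : Euc N) (y : Euc N) :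
    lap (rker (-nu N) δ z) y = - aker δ z y := by
  have h : ∀ s : ℝ, 0 ≤ s → HasDerivAt (fun s => (s + δ ^ 2) ^ (-nu N))
      (-nu N * (s + δ ^ 2) ^ (-nu N - 1)) s := fun s hs => by
    simpa using hasDerivAt_shift_rpow (s := s) hδ hs 1 (-nu N)
  have h2 := hasDerivAt_shift_rpow (s := ‖y - z‖ ^ 2) hδ (by positivity) (-nu N) (-nu N - 1)
  have := lap_radial (contDiff_rker hδ (-nu N) z) h h2
  change lap (rker (-nu N) δ z) y = _ at this
  have e1 := rker_sub_one hδ (-nu N - 2) z y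
  rw [show -nu N - 2 + 1 = -nu N - 1 by ring] at e1
  rw [this, aker]
  rw [show -nu N - 1 - 1 = -nu N - 2 by ring]
  change 4 * ‖y - z‖ ^ 2 * (-nu N * (-nu N - 1) * rker (-nu N - 2) δ z y) +
    2 * N * (-nu N * rker (-nu N - 1) δ z y) = _
  rw [e1]
  have : (N : ℝ) = 2 * nu N + 2 := by rw [nu]; ring
  rw [this]; ring

lemma contDiff_aker {δ : ℝ} (hδ : δ ≠ 0) (z : Euc N) {n : WithTop ℕ∞} :
    ContDiff ℝ n (aker δ z) :=
  contDiff_const.mul (contDiff_rker hδ _ z)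

lemma aker_pos (hN : 3 ≤ N) {δ : ℝ} (hδ : δ ≠ 0) (z y : Euc N) : 0 < aker δ z y := by
  have h0 : 0 < δ ^ 2 := by positivity
  have := nu_pos hN
  have : (0 : ℝ) < N := by positivity
  have := rker_pos hδ (-nu N - 2) z y
  rw [aker]; positivity

lemma lap_pd_rker {δ : ℝ} (hδ : δ ≠ 0) (z : Euc N) (i : Fin N) (y : Euc N) :
    lap (pd i (rker (-nu N) δ z)) y = - pd i (aker δ z) y := by
  have hc : ContDiff ℝ 3 (rker (-nu N) δ z) := contDiff_rker hδ _ z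
  have hc2 : ContDiff ℝ 2 (rker (-nu N) δ z) := contDiff_rker hδ _ z
  have h1 : ContDiff ℝ 2 (pd i (rker (-nu N) δ z)) :=
    contDiff_pd (n := 3) (m := 2) hc (by norm_num) i
  rw [lap_eq_sum_pd h1.contDiffAt]
  have h2 : ∀ j, pd j (pd i (rker (-nu N) δ z)) = pd i (pd j (rker (-nu N) δ z)) :=
    fun j => funext fun w => pd_comm hc2.contDiffAt j i
  have h4 : ∀ j, ContDiff ℝ 2 (pd j (rker (-nu N) δ z)) := fun j =>
    contDiff_pd (n := 3) (m := 2) hc (by norm_num) j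
  have h3 : ∀ j, pd j (pd j (pd i (rker (-nu N) δ z))) y =
      pd i (pd j (pd j (rker (-nu N) δ z))) y := fun j => by
    rw [h2, pd_comm (h4 j).contDiffAt]
  rw [Finset.sum_congr rfl fun j _ => h3 j, ← pd_sum]
  · have : (fun w => ∑ j, pd j (pd j (rker (-nu N) δ z)) w) = fun w => (-1) * aker δ z w := by
      funext w
      rw [← lap_eq_sum_pd hc2.contDiffAt, lap_rker hδ]; ring
    rw [this, pd_const_mul]
    · ring
    · exact (contDiff_aker hδ z (n := 1)).differentiable (by norm_num) y
  · exact fun j _ => (contDiff_pd_one (h4 j) j).differentiable (by norm_num) y |> fun h => by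
      have := (contDiff_pd_one (h4 j) j)
      exact (contDiff_pd (n := 2) (m := 1) (h4 j) (by norm_num) j).differentiable (by norm_num) y

/-- The mass of the approximate identity. -/
noncomputable def amass (N : ℕ) : ℝ := ∫ y : Euc N, aker 1 0 y

lemma integrable_aker_one : Integrable (aker 1 (0 : Euc N)) := by
  have h := integrable_rpow_neg_one_add_norm_sq (E := Euc N) (μ := volume) (r := 2 * nu N + 4)
    (by rw [finrank_euclideanSpace_fin, nu]; linarith)
  have h2 : aker 1 (0 : Euc N) = fun x => 2 * N * nu N * (1 + ‖x‖ ^ 2) ^ (-(2 * nu N + 4) / 2) := by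
    funext x
    rw [aker, rker, add_comm]; simp only [sub_zero, one_pow]
    rw [show (-nu N - 2) = -(2 * nu N + 4) / 2 by ring]; ring
  rw [h2]
  exact h.const_mul _

lemma amass_pos (hN : 3 ≤ N) : 0 < amass N := by
  rw [amass, integral_pos_iff_support_of_nonneg (fun y => (aker_pos hN one_ne_zero 0 y).le)
    integrable_aker_one]
  have : Function.support (aker 1 (0 : Euc N)) = univ := by
    ext y; simp [(aker_pos hN one_ne_zero 0 y).ne']
  rw [this]
  have : Nonempty (Fin N) := ⟨⟨0, by omega⟩⟩
  exact isOpen_univ.measure_pos _ univ_nonempty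

lemma aker_scale {c : ℝ} (hc : 0 < c) (z y : Euc N) :
    aker (1 / c) z y = c ^ N * aker 1 0 (c • (z - y)) := by
  rw [aker, aker, rker, rker]
  have h1 : ‖c • (z - y) - 0‖ ^ 2 + 1 ^ 2 = c ^ 2 * (‖y - z‖ ^ 2 + (1 / c) ^ 2) := by
    rw [sub_zero, norm_smul, Real.norm_of_nonneg hc.le, norm_sub_rev]; field_simp
  have h0 : 0 ≤ ‖y - z‖ ^ 2 + (1 / c) ^ 2 := by positivity
  have h2 : (c : ℝ) ^ N * (c ^ 2) ^ (-nu N - 2) = (1 / c) ^ 2 := by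
    rw [← Real.rpow_natCast c N, ← Real.rpow_natCast c 2, ← Real.rpow_mul hc.le,
      ← Real.rpow_add hc, one_div, inv_pow, ← Real.rpow_natCast c 2, ← Real.rpow_neg hc.le]
    congr 1
    rw [nu]; push_cast; ring
  rw [h1, Real.mul_rpow (by positivity) h0, ← h2]
  ring

lemma tendsto_aker (hN : 3 ≤ N) {g : Euc N → ℝ} (hg : Continuous g) (hgs : HasCompactSupport g)
    (z : Euc N) :
    Tendsto (fun c : ℝ => ∫ y, g y * aker (1 / c) z y) atTop (nhds (amass N * g z)) := by
  have hm := amass_pos hN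
  have key := tendsto_integral_comp_smul_smul_of_integrable' (μ := (volume : Measure (Euc N)))
    (φ := fun x => aker 1 0 x / amass N) (g := g) (x₀ := z)
    (fun x => div_nonneg (aker_pos hN one_ne_zero 0 x).le hm.le)
    (by rw [integral_div]; exact div_self hm.ne') ?_
    (hg.integrable_of_hasCompactSupport hgs) hg.continuousAt
  · have := key.const_mul (amass N)
    refine this.congr' ?_
    filter_upwards [eventually_gt_atTop 0] with c hc
    rw [← integral_const_mul]
    refine integral_congr_ae (Eventually.of_forall fun y => ?_)
    simp only [smul_eq_mul, finrank_euclideanSpace_fin]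
    rw [aker_scale hc]
    field_simp
  · rw [finrank_euclideanSpace_fin]
    have hlim : Tendsto (fun x : Euc N => 2 * N * nu N / amass N * ‖x‖ ^ (-2 : ℝ))
        (Bornology.cobounded _) (nhds 0) := by
      have := ((tendsto_rpow_neg_atTop (y := 2) (by norm_num)).comp
        (tendsto_norm_cobounded_atTop (E := Euc N))).const_mul (2 * N * nu N / amass N)
      simpa using this
    refine squeeze_zero' (Eventually.of_forall fun x => ?_) ?_ hlim
    · exact mul_nonneg (by positivity) (div_nonneg (aker_pos hN one_ne_zero 0 x).le hm.le)
    · have : ∀ᶠ x : Euc N in Bornology.cobounded _, 0 < ‖x‖ :=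
        (tendsto_norm_cobounded_atTop (E := Euc N)).eventually_gt_atTop 0
      filter_upwards [this] with x hx
      have hnu := nu_pos hN
      have h1 : rker (-nu N - 2) 1 0 x ≤ (‖x‖ ^ 2) ^ (-nu N - 2) := by
        rw [rker, sub_zero]
        exact Real.rpow_le_rpow_of_nonpos (by positivity) (by nlinarith) (by linarith)
      have h2 : ‖x‖ ^ N * (‖x‖ ^ 2) ^ (-nu N - 2) = ‖x‖ ^ (-2 : ℝ) := by
        rw [← Real.rpow_natCast ‖x‖ N, ← Real.rpow_natCast ‖x‖ 2, ← Real.rpow_mul hx.le,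
          ← Real.rpow_add hx]
        congr 1
        rw [nu]; push_cast; ring
      rw [← h2, aker]
      calc ‖x‖ ^ N * (2 * N * nu N * 1 ^ 2 * rker (-nu N - 2) 1 0 x / amass N)
          = 2 * N * nu N / amass N * (‖x‖ ^ N * rker (-nu N - 2) 1 0 x) := by ring
        _ ≤ _ := by gcongr

lemma hasDerivAt_comp_max {g g' : ℝ → ℝ} (h0 : g' 0 = 0)
    (h : ∀ t, 0 ≤ t → HasDerivAt g (g' t) t) (t : ℝ) :
    HasDerivAt (fun t => g (max t 0)) (g' (max t 0)) t := by
  rcases lt_trichotomy t 0 with ht | rfl | ht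
  · rw [max_eq_right ht.le, h0]
    refine (hasDerivAt_const t (g 0)).congr_of_eventuallyEq ?_
    filter_upwards [Iio_mem_nhds ht] with s hs
    rw [max_eq_right (le_of_lt hs)]
  · have h1 := h 0 le_rfl
    rw [h0, hasDerivAt_iff_isLittleO] at h1
    rw [max_self, h0, hasDerivAt_iff_isLittleO]
    have h2 : Tendsto (fun t : ℝ => max t 0) (nhds 0) (nhds 0) := by
      have : Continuous (fun t : ℝ => max t 0) := by fun_prop
      simpa using this.tendsto 0
    have h3 := h1.comp_tendsto h2
    simp only [Function.comp_def, smul_zero, sub_zero] at h3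
    simp only [smul_zero, sub_zero, max_self]
    refine h3.trans_isBigO (Asymptotics.IsBigO.of_bound 1 (Eventually.of_forall fun s => ?_))
    rw [one_mul, Real.norm_eq_abs, Real.norm_eq_abs, abs_of_nonneg (le_max_right _ _)]
    exact max_le (le_abs_self s) (abs_nonneg s)
  · rw [max_eq_left ht.le]
    refine (h t ht.le).congr_of_eventuallyEq ?_
    filter_upwards [Ioi_mem_nhds ht] with s hs
    rw [max_eq_left (le_of_lt hs)]

/-- A convex `C²` truncation vanishing on the negative axis. -/
noncomputable def chi (t : ℝ) : ℝ := max t 0 ^ 3 / (1 + max t 0) ^ 2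

/-- The derivative of `chi`. -/
noncomputable def chi1 (t : ℝ) : ℝ := (3 * max t 0 ^ 2 + max t 0 ^ 3) / (1 + max t 0) ^ 3

/-- The second derivative of `chi`. -/
noncomputable def chi2 (t : ℝ) : ℝ := 6 * max t 0 / (1 + max t 0) ^ 4

lemma hasDerivAt_chi (t : ℝ) : HasDerivAt chi (chi1 t) t := by
  refine hasDerivAt_comp_max (g := fun t => t ^ 3 / (1 + t) ^ 2)
    (g' := fun t => (3 * t ^ 2 + t ^ 3) / (1 + t) ^ 3) (by simp) (fun t ht => ?_) t
  have h1 : HasDerivAt (fun t : ℝ => (1 + t) ^ 2) (2 * (1 + t)) t := by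
    simpa using ((hasDerivAt_id t).const_add 1).fun_pow 2
  have h2 : HasDerivAt (fun t : ℝ => t ^ 3) (3 * t ^ 2) t := by simpa using hasDerivAt_pow 3 t
  have h3 : (1 + t) ≠ 0 := by positivity
  refine (h2.fun_div h1 (by positivity)).congr_deriv ?_
  field_simp; ring

lemma hasDerivAt_chi1 (t : ℝ) : HasDerivAt chi1 (chi2 t) t := by
  refine hasDerivAt_comp_max (g := fun t => (3 * t ^ 2 + t ^ 3) / (1 + t) ^ 3)
    (g' := fun t => 6 * t / (1 + t) ^ 4) (by simp) (fun t ht => ?_) t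
  have h1 : HasDerivAt (fun t : ℝ => (1 + t) ^ 3) (3 * (1 + t) ^ 2) t := by
    simpa using ((hasDerivAt_id t).const_add 1).fun_pow 3
  have h2 : HasDerivAt (fun t : ℝ => 3 * t ^ 2 + t ^ 3) (6 * t + 3 * t ^ 2) t := by
    have h2 : HasDerivAt (fun t : ℝ => t ^ 3) (3 * t ^ 2) t := by simpa using hasDerivAt_pow 3 t
    have h3 : HasDerivAt (fun t : ℝ => t ^ 2) (2 * t) t := by simpa using hasDerivAt_pow 2 t
    exact ((h3.const_mul 3).add h2).congr_deriv (by ring)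
  have h3 : (1 + t) ≠ 0 := by positivity
  refine (h2.fun_div h1 (by positivity)).congr_deriv ?_
  field_simp; ring

lemma one_add_max_ne (t : ℝ) : (1 + max t 0) ≠ 0 := by
  have := le_max_right t 0
  positivity

lemma continuous_chi2 : Continuous chi2 := by
  unfold chi2
  exact Continuous.div (by fun_prop) (by fun_prop) fun t => pow_ne_zero _ (one_add_max_ne t)

lemma continuous_chi1 : Continuous chi1 :=
  continuous_iff_continuousAt.2 fun t => (hasDerivAt_chi1 t).continuousAt

lemma contDiff_chi : ContDiff ℝ 2 chi := by
  have h1 : deriv chi = chi1 := funext fun t => (hasDerivAt_chi t).deriv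
  have h2 : deriv chi1 = chi2 := funext fun t => (hasDerivAt_chi1 t).deriv
  have : ContDiff ℝ 1 chi1 := contDiff_one_iff_deriv.2
    ⟨fun t => (hasDerivAt_chi1 t).differentiableAt, h2 ▸ continuous_chi2⟩
  refine (contDiff_succ_iff_deriv (n := 1)).2 ⟨fun t => (hasDerivAt_chi t).differentiableAt, ?_, ?_⟩
  · intro h; exact absurd h (by simp)
  · rw [h1]; exact this

lemma chi1_nonneg (t : ℝ) : 0 ≤ chi1 t := by
  have := le_max_right t 0
  unfold chi1; positivity

lemma chi1_le_one (t : ℝ) : chi1 t ≤ 1 := by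
  have := le_max_right t 0
  unfold chi1
  rw [div_le_one (by positivity)]
  nlinarith

lemma chi2_nonneg (t : ℝ) : 0 ≤ chi2 t := by
  have := le_max_right t 0
  unfold chi2; positivity

lemma chi_nonneg (t : ℝ) : 0 ≤ chi t := by
  have := le_max_right t 0
  unfold chi; positivity

lemma chi_of_nonpos {t : ℝ} (h : t ≤ 0) : chi t = 0 := by simp [chi, max_eq_right h]
lemma chi1_of_nonpos {t : ℝ} (h : t ≤ 0) : chi1 t = 0 := by simp [chi1, max_eq_right h]

lemma monotone_chi : Monotone chi :=
  monotone_of_hasDerivAt_nonneg hasDerivAt_chi chi1_nonneg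

lemma chi_pos {t : ℝ} (h : 0 < t) : 0 < chi t := by
  rw [chi, max_eq_left h.le]; positivity

/-- The test function for superharmonic lower bounds. -/
noncomputable def psi (s δ : ℝ) (z y : Euc N) : ℝ := chi (rker (-nu N) δ z y - s)

lemma contDiff_psi {s δ : ℝ} (hδ : δ ≠ 0) (z : Euc N) : ContDiff ℝ 2 (psi s δ z) :=
  contDiff_chi.comp ((contDiff_rker hδ _ z).sub contDiff_const)

lemma lap_psi {s δ : ℝ} (hδ : δ ≠ 0) (z y : Euc N) :
    -lap (psi s δ z) y = chi1 (rker (-nu N) δ z y - s) * aker δ z y -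
      chi2 (rker (-nu N) δ z y - s) *
        (4 * ‖y - z‖ ^ 2 * (nu N * rker (-nu N - 1) δ z y) ^ 2) := by
  set e := -nu N with he
  have hg : ∀ t : ℝ, 0 ≤ t → HasDerivAt (fun t => (t + δ ^ 2) ^ e)
      (e * (t + δ ^ 2) ^ (e - 1)) t := fun t ht => by
    simpa using hasDerivAt_shift_rpow (s := t) hδ ht 1 e
  have hg2 : ∀ t : ℝ, 0 ≤ t → HasDerivAt (fun t => e * (t + δ ^ 2) ^ (e - 1))
      (e * (e - 1) * (t + δ ^ 2) ^ (e - 1 - 1)) t := fun t ht =>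
    hasDerivAt_shift_rpow hδ ht e (e - 1)
  have h1 : ∀ t : ℝ, 0 ≤ t → HasDerivAt (fun t => chi ((t + δ ^ 2) ^ e - s))
      (chi1 ((t + δ ^ 2) ^ e - s) * (e * (t + δ ^ 2) ^ (e - 1))) t := fun t ht =>
    (hasDerivAt_chi _).comp t ((hg t ht).sub_const s)
  have h2 := ((hasDerivAt_chi1 _).comp _ ((hg (‖y - z‖ ^ 2) (by positivity)).sub_const s)).mul
    (hg2 (‖y - z‖ ^ 2) (by positivity))
  have key := lap_radial (contDiff_psi (s := s) hδ z) h1 h2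
  have k2 := lap_radial (contDiff_rker hδ e z) hg (hg2 (‖y - z‖ ^ 2) (by positivity))
  have k3 := lap_rker hδ z y
  rw [← he] at k3
  change lap (rker e δ z) y = _ at k2
  change lap (psi s δ z) y = _ at key
  rw [key]
  rw [k2] at k3
  simp only [Function.comp_apply, rker]
  rw [← neg_eq_iff_eq_neg] at k3
  rw [← k3, show nu N = -e by rw [he]; ring]
  ring

/-- A smooth cutoff equal to one on `closedBall 0 r` and vanishing outside `ball 0 (r + 1)`. -/
noncomputable def bump (r : ℝ) (y : Euc N) : ℝ :=
  Real.smoothTransition ((r + 1) ^ 2 - ‖y‖ ^ 2)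

lemma contDiff_bump (r : ℝ) {n : ℕ∞} : ContDiff ℝ n (bump (N := N) r) :=
  Real.smoothTransition.contDiff.comp (contDiff_const.sub (contDiff_norm_sq ℝ))

lemma bump_nonneg (r : ℝ) (y : Euc N) : 0 ≤ bump r y := Real.smoothTransition.nonneg _
lemma bump_le_one (r : ℝ) (y : Euc N) : bump r y ≤ 1 := Real.smoothTransition.le_one _

lemma bump_eq_one {r : ℝ} {y : Euc N} (h : ‖y‖ ≤ r) : bump r y = 1 := by
  have := norm_nonneg y
  exact Real.smoothTransition.one_of_one_le (by nlinarith)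

lemma bump_eq_zero {r : ℝ} (hr : 0 ≤ r) {y : Euc N} (h : r + 1 ≤ ‖y‖) : bump r y = 0 :=
  Real.smoothTransition.zero_of_nonpos (by nlinarith)

lemma hasCompactSupport_of_ball {f : Euc N → ℝ} (r : ℝ) (h : ∀ y, r ≤ ‖y‖ → f y = 0) :
    HasCompactSupport f :=
  HasCompactSupport.intro (isCompact_closedBall 0 r) fun y hy => h y (by
    rw [mem_closedBall_zero_iff, not_le] at hy; exact hy.le)

lemma hasCompactSupport_bump {r : ℝ} (hr : 0 ≤ r) : HasCompactSupport (bump (N := N) r) :=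
  hasCompactSupport_of_ball (r + 1) fun _ hy => bump_eq_zero hr hy

lemma continuous_rker {δ : ℝ} (hδ : δ ≠ 0) (e : ℝ) (z : Euc N) : Continuous (rker e δ z) :=
  (contDiff_rker hδ e z (n := 0)).continuous

/-- The basic inequality behind the lower bounds for superharmonic functions. -/
lemma superharmonic_ineq (hN : 3 ≤ N) {U : Euc N → ℝ} (hU : ContDiff ℝ 2 U) (hU0 : ∀ x, 0 ≤ U x)
    {s δ R : ℝ} (hδ : δ ≠ 0) (hR : 0 ≤ R) {z : Euc N}
    (hs : ∀ y : Euc N, R ≤ ‖y‖ → rker (-nu N) δ z y ≤ s) :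
    (∫ y, -lap U y * psi s δ z y) + ∫ y, U y * (chi2 (rker (-nu N) δ z y - s) *
        (4 * ‖y - z‖ ^ 2 * (nu N * rker (-nu N - 1) δ z y) ^ 2)) ≤
      ∫ y, U y * bump R y * aker δ z y := by
  have hpsi0 : ∀ y, R ≤ ‖y‖ → psi s δ z y = 0 := fun y hy =>
    chi_of_nonpos (sub_nonpos.2 (hs y hy))
  have hps : HasCompactSupport (psi s δ z) := hasCompactSupport_of_ball R hpsi0
  have hpc := contDiff_psi (s := s) hδ z
  have hrc := continuous_rker hδ (-nu N) z
  have hrc1 := continuous_rker hδ (-nu N - 1) z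
  have hac : Continuous (aker δ z) := (contDiff_aker hδ z (n := 0)).continuous
  have hUc := hU.continuous
  have hn : Continuous (fun y : Euc N => ‖y - z‖) := by fun_prop
  have green := integral_mul_lap hU hpc hps
  have e1 : ∫ y, -lap U y * psi s δ z y = ∫ y, U y * (chi1 (rker (-nu N) δ z y - s) * aker δ z y -
      chi2 (rker (-nu N) δ z y - s) *
        (4 * ‖y - z‖ ^ 2 * (nu N * rker (-nu N - 1) δ z y) ^ 2)) := by
    simp only [← lap_psi hδ, neg_mul, mul_neg, integral_neg]
    rw [green]
  have hch2 : Continuous fun y => U y * (chi2 (rker (-nu N) δ z y - s) *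
        (4 * ‖y - z‖ ^ 2 * (nu N * rker (-nu N - 1) δ z y) ^ 2)) := by
    have := continuous_chi2.comp (hrc.sub (continuous_const (y := s)))
    simp only [Function.comp_def] at this
    fun_prop
  have hch1 : Continuous fun y => U y * (chi1 (rker (-nu N) δ z y - s) * aker δ z y) := by
    have := continuous_chi1.comp (hrc.sub (continuous_const (y := s)))
    simp only [Function.comp_def] at this
    fun_prop
  have i2 : Integrable fun y => U y * (chi2 (rker (-nu N) δ z y - s) *
        (4 * ‖y - z‖ ^ 2 * (nu N * rker (-nu N - 1) δ z y) ^ 2)) := by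
    refine hch2.integrable_of_hasCompactSupport (hasCompactSupport_of_ball R fun y hy => ?_)
    have : chi2 (rker (-nu N) δ z y - s) = 0 := by
      simp [chi2, max_eq_right (sub_nonpos.2 (hs y hy))]
    rw [this]; ring
  have i1 : Integrable fun y => U y * (chi1 (rker (-nu N) δ z y - s) * aker δ z y) := by
    refine hch1.integrable_of_hasCompactSupport (hasCompactSupport_of_ball R fun y hy => ?_)
    rw [chi1_of_nonpos (sub_nonpos.2 (hs y hy))]; ring
  have i3 : Integrable fun y => U y * bump R y * aker δ z y := by
    have hb : Continuous (bump (N := N) R) := (contDiff_bump (N := N) R (n := 0)).continuous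
    refine Continuous.integrable_of_hasCompactSupport (by fun_prop) ?_
    exact hasCompactSupport_of_ball (R + 1) fun y hy => by rw [bump_eq_zero hR hy]; ring
  simp only [mul_sub] at e1
  rw [e1, integral_sub i1 i2, sub_add_cancel]
  refine integral_mono i1 i3 fun y => ?_
  have ha := aker_pos hN hδ z y
  have h1 : chi1 (rker (-nu N) δ z y - s) ≤ bump R y := by
    rcases le_total R ‖y‖ with h | h
    · rw [chi1_of_nonpos (sub_nonpos.2 (hs y h))]; exact bump_nonneg _ _
    · rw [bump_eq_one h]; exact chi1_le_one _
  simp only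
  rw [mul_assoc]
  have := hU0 y
  gcongr

/-- The closed annulus between the spheres of radius five and six. -/
def ann (N : ℕ) : Set (Euc N) := closedBall 0 6 \ ball 0 5

lemma measurableSet_ann : MeasurableSet (ann N) :=
  measurableSet_closedBall.diff measurableSet_ball

lemma integrableOn_ball {f : Euc N → ℝ} (hf : Continuous f) (r : ℝ) :
    IntegrableOn f (closedBall 0 r) :=
  hf.continuousOn.integrableOn_compact (isCompact_closedBall 0 r)

lemma integrableOn_ann {f : Euc N → ℝ} (hf : Continuous f) : IntegrableOn f (ann N) :=
  (integrableOn_ball hf 6).mono_set sdiff_subset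

lemma rker_ge {δ e b : ℝ} (he : e ≤ 0) (hδ : δ ≠ 0) {z y : Euc N}
    (h : ‖y - z‖ ^ 2 + δ ^ 2 ≤ b) : b ^ e ≤ rker e δ z y :=
  Real.rpow_le_rpow_of_nonpos (by positivity) h he

lemma tendsto_aker_cutoff (hN : 3 ≤ N) {U : Euc N → ℝ} (hU : Continuous U) {R : ℝ} (hR : 0 ≤ R)
    {z : Euc N} (hz : ‖z‖ ≤ R) :
    Tendsto (fun c : ℝ => ∫ y, U y * bump R y * aker (1 / c) z y) atTop
      (nhds (amass N * U z)) := by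
  have hb : Continuous (bump (N := N) R) := (contDiff_bump (N := N) R (n := 0)).continuous
  have := tendsto_aker hN (hU.mul hb) (hasCompactSupport_bump hR).mul_left z
  simpa [bump_eq_one hz] using this

/-- Quantitative lower bounds for superharmonic functions on a ball. -/
lemma superharmonic_lower (hN : 3 ≤ N) : ∃ c > 0, ∀ U : Euc N → ℝ, ContDiff ℝ 2 U →
    (∀ x, 0 ≤ U x) → (∀ x ∈ ball (0 : Euc N) 20, lap U x ≤ 0) →
    (∀ x, ‖x‖ ≤ 6 → c * ∫ y in closedBall 0 6, -lap U y ≤ U x) ∧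
    (∀ x, ‖x‖ ≤ 4 → c * ∫ y in ann N, U y ≤ U x) := by
  have hnu := nu_pos hN
  have hm := amass_pos hN
  set s : ℝ := 169 ^ (-nu N) with hs
  set t1 : ℝ := 145 ^ (-nu N) - s with ht1
  have ht1p : 0 < t1 :=
    sub_pos.2 (Real.rpow_lt_rpow_of_neg (by norm_num) (by norm_num) (by linarith))
  set k1 := chi t1 / amass N with hk1
  set k2 := (6 * t1 / 2 ^ 4 * (4 * 1 ^ 2 * (nu N * 145 ^ (-nu N - 1)) ^ 2)) / amass N with hk2
  have hk1p : 0 < k1 := div_pos (chi_pos ht1p) hm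
  have hk2p : 0 < k2 := by positivity
  refine ⟨min k1 k2, lt_min hk1p hk2p, fun U hU hU0 hUl => ?_⟩
  have hsupp : ∀ δ : ℝ, δ ≠ 0 → ∀ z : Euc N, ‖z‖ ≤ 6 → ∀ y : Euc N, 19 ≤ ‖y‖ →
      rker (-nu N) δ z y ≤ s := by
    intro δ hδ z hz y hy
    have h1 : 13 ≤ ‖y - z‖ := by have := norm_sub_norm_le y z; linarith
    exact Real.rpow_le_rpow_of_nonpos (by norm_num) (by nlinarith [sq_nonneg δ]) (by linarith)
  have hf0 : ∀ δ : ℝ, δ ≠ 0 → ∀ z : Euc N, ‖z‖ ≤ 6 → ∀ y, 0 ≤ -lap U y * psi s δ z y := by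
    intro δ hδ z hz y
    rcases lt_or_ge ‖y‖ 19 with h | h
    · exact mul_nonneg (neg_nonneg.2 (hUl y (by rw [mem_ball_zero_iff]; linarith)))
        (chi_nonneg _)
    · rw [psi, chi_of_nonpos (sub_nonpos.2 (hsupp δ hδ z hz y h)), mul_zero]
  have hg0 : ∀ δ : ℝ, δ ≠ 0 → ∀ z y : Euc N, 0 ≤ U y * (chi2 (rker (-nu N) δ z y - s) *
        (4 * ‖y - z‖ ^ 2 * (nu N * rker (-nu N - 1) δ z y) ^ 2)) := by
    intro δ hδ z y
    have := chi2_nonneg (rker (-nu N) δ z y - s)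
    have := hU0 y
    positivity
  have hlc := continuous_lap hU
  have hfi : ∀ δ : ℝ, δ ≠ 0 → ∀ z : Euc N, ‖z‖ ≤ 6 →
      Integrable fun y => -lap U y * psi s δ z y := by
    intro δ hδ z hz
    have := (contDiff_psi (s := s) hδ z).continuous
    refine Continuous.integrable_of_hasCompactSupport (by fun_prop)
      (hasCompactSupport_of_ball 19 fun y hy => ?_)
    rw [psi, chi_of_nonpos (sub_nonpos.2 (hsupp δ hδ z hz y hy)), mul_zero]
  have hgi : ∀ δ : ℝ, δ ≠ 0 → ∀ z : Euc N, ‖z‖ ≤ 6 →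
      Integrable fun y => U y * (chi2 (rker (-nu N) δ z y - s) *
        (4 * ‖y - z‖ ^ 2 * (nu N * rker (-nu N - 1) δ z y) ^ 2)) := by
    intro δ hδ z hz
    have h1 := continuous_chi2.comp ((continuous_rker hδ (-nu N) z).sub (continuous_const (y := s)))
    simp only [Function.comp_def] at h1
    have h2 := continuous_rker hδ (-nu N - 1) z
    have h3 := hU.continuous
    refine Continuous.integrable_of_hasCompactSupport (by fun_prop)
      (hasCompactSupport_of_ball 19 fun y hy => ?_)
    have : chi2 (rker (-nu N) δ z y - s) = 0 := by
      simp [chi2, max_eq_right (sub_nonpos.2 (hsupp δ hδ z hz y hy))]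
    rw [this]; ring
  have hδb : ∀ c : ℝ, 1 ≤ c → (1 / c) ^ 2 ≤ 1 := fun c hc => by
    rw [one_div, inv_pow]; exact inv_le_one_of_one_le₀ (one_le_pow₀ hc)
  constructor
  · intro x hx
    have h1 : chi t1 * ∫ y in closedBall 0 6, -lap U y ≤ amass N * U x := by
      refine ge_of_tendsto (tendsto_aker_cutoff hN hU.continuous (R := 19) (by norm_num)
        (z := x) (by linarith)) ?_
      filter_upwards [eventually_ge_atTop 1] with c hc
      have hδ : 1 / c ≠ 0 := by positivity
      refine le_trans ?_ (superharmonic_ineq hN hU hU0 hδ (by norm_num) (hsupp _ hδ x hx))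
      refine le_trans ?_ (le_add_of_nonneg_right (integral_nonneg (hg0 _ hδ x)))
      refine le_trans ?_ (setIntegral_le_integral (s := closedBall 0 6) (hfi _ hδ x hx)
        (Eventually.of_forall (hf0 _ hδ x hx)))
      rw [← integral_const_mul]
      refine setIntegral_mono_on ((integrableOn_ball hlc.neg 6).const_mul _)
        (hfi _ hδ x hx).integrableOn measurableSet_closedBall fun y hy => ?_
      rw [mem_closedBall_zero_iff] at hy
      rw [mul_comm]
      refine mul_le_mul_of_nonneg_left (monotone_chi (sub_le_sub_right
        (rker_ge (by linarith) hδ ?_) s))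
        (neg_nonneg.2 (hUl y (by rw [mem_ball_zero_iff]; linarith)))
      have h3 : ‖y - x‖ ≤ 12 := by have := norm_sub_le y x; linarith
      nlinarith [hδb c hc, norm_nonneg (y - x)]
    have h2 : k1 * ∫ y in closedBall 0 6, -lap U y ≤ U x := by
      rw [hk1, div_mul_eq_mul_div, div_le_iff₀ hm, mul_comm (U x)]; exact h1
    refine le_trans (mul_le_mul_of_nonneg_right (min_le_left _ _) ?_) h2
    exact setIntegral_nonneg measurableSet_closedBall fun y hy => by
      rw [mem_closedBall_zero_iff] at hy
      exact neg_nonneg.2 (hUl y (by rw [mem_ball_zero_iff]; linarith))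
  · intro x hx
    have hx6 : ‖x‖ ≤ 6 := by linarith
    have h1 : (6 * t1 / 2 ^ 4 * (4 * 1 ^ 2 * (nu N * 145 ^ (-nu N - 1)) ^ 2)) *
        ∫ y in ann N, U y ≤ amass N * U x := by
      refine ge_of_tendsto (tendsto_aker_cutoff hN hU.continuous (R := 19) (by norm_num)
        (z := x) (by linarith)) ?_
      filter_upwards [eventually_ge_atTop 1] with c hc
      have hδ : 1 / c ≠ 0 := by positivity
      refine le_trans ?_ (superharmonic_ineq hN hU hU0 hδ (by norm_num) (hsupp _ hδ x hx6))
      refine le_trans ?_ (le_add_of_nonneg_left (integral_nonneg (hf0 _ hδ x hx6)))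
      refine le_trans ?_ (setIntegral_le_integral (s := ann N) (hgi _ hδ x hx6)
        (Eventually.of_forall (hg0 _ hδ x)))
      rw [← integral_const_mul]
      refine setIntegral_mono_on ((integrableOn_ann hU.continuous).const_mul _)
        (hgi _ hδ x hx6).integrableOn measurableSet_ann fun y hy => ?_
      obtain ⟨hy1, hy2⟩ := hy
      rw [mem_closedBall_zero_iff] at hy1
      rw [mem_ball_zero_iff, not_lt] at hy2
      rw [mul_comm]
      have h3 : ‖y - x‖ ≤ 12 := by have := norm_sub_le y x; linarith
      have h4 : 1 ≤ ‖y - x‖ := by have := norm_sub_norm_le y x; linarith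
      have h5 : ‖y - x‖ ^ 2 + (1 / c) ^ 2 ≤ 145 := by
        nlinarith [hδb c hc, norm_nonneg (y - x)]
      have h6 := rker_ge (e := -nu N) (by linarith) hδ h5
      have h7 := rker_ge (e := -nu N - 1) (by linarith) hδ h5
      have h8 : rker (-nu N) (1 / c) x y ≤ 1 := by
        refine Real.rpow_le_one_of_one_le_of_nonpos ?_ (by linarith)
        nlinarith [sq_nonneg (1 / c)]
      have h9 : (0 : ℝ) < s := by positivity
      have h10 : 6 * t1 / 2 ^ 4 ≤ chi2 (rker (-nu N) (1 / c) x y - s) := by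
        rw [chi2, max_eq_left (by linarith)]
        have : t1 ≤ rker (-nu N) (1 / c) x y - s := by linarith
        have h11 : 0 ≤ rker (-nu N) (1 / c) x y - s := by linarith
        gcongr
        linarith
      have := hU0 y
      gcongr
      exact chi2_nonneg _
    have h2 : k2 * ∫ y in ann N, U y ≤ U x := by
      rw [hk2, div_mul_eq_mul_div, div_le_iff₀ hm, mul_comm (U x)]; exact h1
    refine le_trans (mul_le_mul_of_nonneg_right (min_le_right _ _) ?_) h2
    exact setIntegral_nonneg measurableSet_ann fun y hy => hU0 y

/-- A nonnegative `C²` pair solving, in the ball of radius `R`, the Lane-Emden system with slowly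
varying coefficients `c` and `d`. -/
structure Sys (p q m M ε R : ℝ) (U V c d : Euc N → ℝ) : Prop where
  contU : ContDiff ℝ 2 U
  contV : ContDiff ℝ 2 V
  contc : ContDiff ℝ 1 c
  contd : ContDiff ℝ 1 d
  U_nonneg : ∀ x, 0 ≤ U x
  V_nonneg : ∀ x, 0 ≤ V x
  U_pos : ∀ x ∈ ball (0 : Euc N) R, 0 < U x
  V_pos : ∀ x ∈ ball (0 : Euc N) R, 0 < V x
  eqU : ∀ x ∈ ball (0 : Euc N) R, -lap U x = c x * V x ^ p
  eqV : ∀ x ∈ ball (0 : Euc N) R, -lap V x = d x * U x ^ q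
  c_ge : ∀ x ∈ ball (0 : Euc N) R, m ≤ c x
  d_ge : ∀ x ∈ ball (0 : Euc N) R, m ≤ d x
  c_le : ∀ x ∈ ball (0 : Euc N) R, c x ≤ M
  d_le : ∀ x ∈ ball (0 : Euc N) R, d x ≤ M
  c_drift : ∀ x ∈ ball (0 : Euc N) R, |∑ i, x i * pd i c x| ≤ ε
  d_drift : ∀ x ∈ ball (0 : Euc N) R, |∑ i, x i * pd i d x| ≤ ε

namespace Sys

variable {p q m M ε R : ℝ} {U V c d : Euc N → ℝ}

lemma symm (h : Sys p q m M ε R U V c d) : Sys q p m M ε R V U d c :=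
  ⟨h.contV, h.contU, h.contd, h.contc, h.V_nonneg, h.U_nonneg, h.V_pos, h.U_pos, h.eqV, h.eqU,
    h.d_ge, h.c_ge, h.d_le, h.c_le, h.d_drift, h.c_drift⟩

lemma mono (h : Sys p q m M ε R U V c d) {R' : ℝ} (hR : R' ≤ R) : Sys p q m M ε R' U V c d := by
  have hs : ball (0 : Euc N) R' ⊆ ball 0 R := ball_subset_ball hR
  exact ⟨h.contU, h.contV, h.contc, h.contd, h.U_nonneg, h.V_nonneg, fun x hx => h.U_pos x (hs hx),
    fun x hx => h.V_pos x (hs hx), fun x hx => h.eqU x (hs hx), fun x hx => h.eqV x (hs hx),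
    fun x hx => h.c_ge x (hs hx), fun x hx => h.d_ge x (hs hx), fun x hx => h.c_le x (hs hx),
    fun x hx => h.d_le x (hs hx), fun x hx => h.c_drift x (hs hx),
    fun x hx => h.d_drift x (hs hx)⟩

lemma rescale (h : Sys p q m M ε R U V c d) {r α β : ℝ} (hr : 0 < r) (h1 : α + 2 = β * p)
    (h2 : β + 2 = α * q) :
    Sys p q m M ε (R / r) (fun y => r ^ α * U (r • y)) (fun y => r ^ β * V (r • y))
      (fun y => c (r • y)) (fun y => d (r • y)) := by
  have hb : ∀ x ∈ ball (0 : Euc N) (R / r), r • x ∈ ball (0 : Euc N) R := by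
    intro x hx
    rw [mem_ball_zero_iff] at hx ⊢
    rw [norm_smul, Real.norm_of_nonneg hr.le]
    rwa [lt_div_iff₀' hr] at hx
  have hs : ContDiff ℝ 2 (fun y : Euc N => r • y) := by fun_prop
  have hs1 : ContDiff ℝ 1 (fun y : Euc N => r • y) := by fun_prop
  have hlap : ∀ W : Euc N → ℝ, ContDiff ℝ 2 W → ∀ (k : ℝ) (x : Euc N),
      lap (fun y => k * W (r • y)) x = k * (r ^ 2 * lap W (r • x)) := by
    intro W hW k x
    rw [lap_const_mul (f := fun y => W (r • y)) k (hW.comp hs).contDiffAt]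
    have := lap_affine (f := W) (z := 0) (t := r) (x := x) hW.contDiffAt
    simp only [zero_add] at this
    rw [this]
  have hpd : ∀ W : Euc N → ℝ, ContDiff ℝ 1 W → ∀ (i : Fin N) (x : Euc N),
      x i * pd i (fun y => W (r • y)) x = (r • x) i * pd i W (r • x) := by
    intro W hW i x
    have := pd_const_affine (hW.differentiable (by norm_num)) 0 r i
    simp only [zero_add] at this
    rw [this]
    simp; ring
  refine ⟨contDiff_const.mul (h.contU.comp hs), contDiff_const.mul (h.contV.comp hs),
    h.contc.comp hs1, h.contd.comp hs1, fun x => ?_, fun x => ?_, fun x hx => ?_, fun x hx => ?_,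
    fun x hx => ?_, fun x hx => ?_, fun x hx => h.c_ge _ (hb x hx), fun x hx => h.d_ge _ (hb x hx),
    fun x hx => h.c_le _ (hb x hx), fun x hx => h.d_le _ (hb x hx), fun x hx => ?_,
    fun x hx => ?_⟩
  · have := h.U_nonneg (r • x); positivity
  · have := h.V_nonneg (r • x); positivity
  · have := h.U_pos _ (hb x hx); positivity
  · have := h.V_pos _ (hb x hx); positivity
  · rw [hlap U h.contU]
    have e := h.eqU _ (hb x hx)
    rw [Real.mul_rpow (by positivity) (h.V_nonneg _), ← Real.rpow_mul hr.le, ← h1,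
      Real.rpow_add hr, Real.rpow_two]
    linear_combination r ^ α * r ^ 2 * e
  · rw [hlap V h.contV]
    have e := h.eqV _ (hb x hx)
    rw [Real.mul_rpow (by positivity) (h.U_nonneg _), ← Real.rpow_mul hr.le, ← h2,
      Real.rpow_add hr, Real.rpow_two]
    linear_combination r ^ β * r ^ 2 * e
  · rw [Finset.sum_congr rfl fun i _ => hpd c h.contc i x]
    exact h.c_drift _ (hb x hx)
  · rw [Finset.sum_congr rfl fun i _ => hpd d h.contd i x]
    exact h.d_drift _ (hb x hx)

lemma lapU_nonpos (h : Sys p q m M ε R U V c d) (hm : 0 ≤ m) {x : Euc N}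
    (hx : x ∈ ball (0 : Euc N) R) : lap U x ≤ 0 := by
  have h1 := h.eqU x hx
  have h2 := h.c_ge x hx
  have := Real.rpow_nonneg (h.V_nonneg x) p
  nlinarith [mul_nonneg (hm.trans h2) this]

lemma lapV_nonpos (h : Sys p q m M ε R U V c d) (hm : 0 ≤ m) {x : Euc N}
    (hx : x ∈ ball (0 : Euc N) R) : lap V x ≤ 0 := h.symm.lapU_nonpos hm hx

end Sys

lemma le_of_mul_rpow_le {F K s : ℝ} (hF : 0 ≤ F) (hK : 0 < K) (hs : 1 < s) (h : K * F ^ s ≤ F) :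
    F ≤ K⁻¹ ^ (1 / (s - 1)) := by
  rcases hF.eq_or_lt with rfl | hF
  · positivity
  have h1 : F ^ s = F ^ (s - 1) * F := by
    rw [← Real.rpow_add_one hF.ne']; ring_nf
  have h2 : F ^ (s - 1) ≤ K⁻¹ := by
    rw [h1, ← mul_assoc] at h
    have h3 : K * F ^ (s - 1) ≤ 1 := le_of_mul_le_mul_right (by linarith) hF
    rw [inv_eq_one_div, le_div_iff₀ hK]; linarith
  calc F = (F ^ (s - 1)) ^ (1 / (s - 1)) := by
        rw [← Real.rpow_mul hF.le, mul_one_div_cancel (by linarith), Real.rpow_one]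
    _ ≤ _ := Real.rpow_le_rpow (by positivity) h2 (by
        have : 0 < s - 1 := by linarith
        positivity)

lemma integral_lap_ball_ge {p q m M ε R : ℝ} {U V c d : Euc N → ℝ}
    (h : Sys p q m M ε R U V c d) {r a : ℝ} (hr : r ≤ 6) (hR : 6 < R) (hm : 0 ≤ m)
    (hp : 0 < p) (ha : 0 ≤ a) (hV : ∀ x, ‖x‖ ≤ r → a ≤ V x) :
    (volume (closedBall (0 : Euc N) r)).toReal * (m * a ^ p) ≤
      ∫ y in closedBall 0 6, -lap U y := by
  have hsub : closedBall (0 : Euc N) r ⊆ closedBall 0 6 := closedBall_subset_closedBall hr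
  have hi := integrableOn_ball (continuous_lap h.contU).neg 6
  have h1 : ∫ y in closedBall (0 : Euc N) r, (m * a ^ p) ≤
      ∫ y in closedBall (0 : Euc N) r, -lap U y := by
    refine setIntegral_mono_on (integrableOn_ball continuous_const r)
      (hi.mono_set hsub) measurableSet_closedBall fun y hy => ?_
    have hyR : y ∈ ball (0 : Euc N) R := closedBall_subset_ball (by linarith) hy
    rw [h.eqU y hyR]
    rw [mem_closedBall_zero_iff] at hy
    exact mul_le_mul (h.c_ge y hyR) (Real.rpow_le_rpow ha (hV y hy) hp.le) (by positivity)
      (hm.trans (h.c_ge y hyR))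
  rw [setIntegral_const, smul_eq_mul] at h1
  refine h1.trans (setIntegral_mono_set hi ?_ hsub.eventuallyLE)
  filter_upwards [ae_restrict_mem measurableSet_closedBall] with y hy
  exact neg_nonneg.2 (h.lapU_nonpos hm (closedBall_subset_ball hR hy))

/-- Universal bounds for the source terms and for the boundary mass. -/
lemma mass_bound_aux (hN : 3 ≤ N) {p q m : ℝ} (hp : 0 < p) (hq : 0 < q) (hpq : 1 < p * q)
    (hm : 0 < m) : ∃ C > 0, ∀ (M ε : ℝ) (U V c d : Euc N → ℝ), Sys p q m M ε 20 U V c d →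
      ∫ y in closedBall 0 6, -lap U y ≤ C := by
  obtain ⟨k, hk, hlow⟩ := superharmonic_lower hN
  set v := (volume (closedBall (0 : Euc N) 6)).toReal with hv
  have : Nonempty (Fin N) := ⟨⟨0, by omega⟩⟩
  have hvp : 0 < v := ENNReal.toReal_pos (measure_closedBall_pos _ _ (by norm_num)).ne'
    measure_closedBall_lt_top.ne
  set K := v * (m * (k * (v * (m * k ^ q))) ^ p) with hK
  have hKp : 0 < K := by positivity
  refine ⟨K⁻¹ ^ (1 / (p * q - 1)), by positivity, fun M ε U V c d h => ?_⟩
  set F := ∫ y in closedBall 0 6, -lap U y with hF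
  set H := ∫ y in closedBall 0 6, -lap V y with hH
  have hF0 : 0 ≤ F := setIntegral_nonneg measurableSet_closedBall fun y hy =>
    neg_nonneg.2 (h.lapU_nonpos hm.le (closedBall_subset_ball (by norm_num) hy))
  have hH0 : 0 ≤ H := setIntegral_nonneg measurableSet_closedBall fun y hy =>
    neg_nonneg.2 (h.lapV_nonpos hm.le (closedBall_subset_ball (by norm_num) hy))
  have hUl := (hlow U h.contU h.U_nonneg fun x hx => h.lapU_nonpos hm.le hx).1
  have hVl := (hlow V h.contV h.V_nonneg fun x hx => h.lapV_nonpos hm.le hx).1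
  have h1 := integral_lap_ball_ge h le_rfl (by norm_num) hm.le hp (by positivity) hVl
  have h2 := integral_lap_ball_ge h.symm le_rfl (by norm_num) hm.le hq (by positivity) hUl
  refine le_of_mul_rpow_le hF0 hKp hpq (le_trans ?_ h1)
  rw [← hH, ← hv]
  rw [← hF, ← hv] at h2
  have h3 : (k * (v * (m * k ^ q))) ^ p * F ^ (p * q) = (k * (v * (m * (k * F) ^ q))) ^ p := by
    rw [mul_comm p q, Real.rpow_mul hF0, ← Real.mul_rpow (by positivity) (by positivity),
      Real.mul_rpow hk.le hF0]
    ring_nf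
  rw [hK, mul_assoc, mul_assoc, h3]
  gcongr

lemma mass_bound (hN : 3 ≤ N) {p q m : ℝ} (hp : 0 < p) (hq : 0 < q) (hpq : 1 < p * q)
    (hm : 0 < m) : ∃ C > 0, ∀ (M ε : ℝ) (U V c d : Euc N → ℝ), Sys p q m M ε 20 U V c d →
      (∫ y in closedBall 0 6, -lap U y ≤ C) ∧ (∫ y in closedBall 0 6, -lap V y ≤ C) ∧
      (∫ y in ann N, U y ≤ C) ∧ ∫ y in ann N, V y ≤ C := by
  obtain ⟨k, hk, hlow⟩ := superharmonic_lower hN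
  obtain ⟨C1, hC1, hb1⟩ := mass_bound_aux hN hp hq hpq hm
  obtain ⟨C2, hC2, hb2⟩ := mass_bound_aux hN hq hp (by rwa [mul_comm]) hm
  set v := (volume (closedBall (0 : Euc N) 4)).toReal with hv
  have : Nonempty (Fin N) := ⟨⟨0, by omega⟩⟩
  have hvp : 0 < v := ENNReal.toReal_pos (measure_closedBall_pos _ _ (by norm_num)).ne'
    measure_closedBall_lt_top.ne
  have aux : ∀ {C s J : ℝ}, 0 < C → 0 < s → 0 ≤ J → v * (m * (k * J) ^ s) ≤ C →
      J ≤ (C / (v * m)) ^ (1 / s) / k := by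
    intro C s J hC hs hJ h
    rw [le_div_iff₀ hk]
    have h1 : (k * J) ^ s ≤ C / (v * m) := by
      rw [le_div_iff₀ (by positivity)]; linarith
    calc J * k = ((k * J) ^ s) ^ (1 / s) := by
          rw [← Real.rpow_mul (by positivity), mul_one_div_cancel hs.ne', Real.rpow_one, mul_comm]
      _ ≤ _ := Real.rpow_le_rpow (by positivity) h1 (by positivity)
  refine ⟨max (max C1 C2) (max ((C2 / (v * m)) ^ (1 / q) / k) ((C1 / (v * m)) ^ (1 / p) / k)),
    lt_max_of_lt_left (lt_max_of_lt_left hC1), fun M ε U V c d h => ?_⟩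
  have hF := hb1 M ε U V c d h
  have hH := hb2 M ε V U d c h.symm
  have hUl := (hlow U h.contU h.U_nonneg fun x hx => h.lapU_nonpos hm.le hx).2
  have hVl := (hlow V h.contV h.V_nonneg fun x hx => h.lapV_nonpos hm.le hx).2
  have hJU : 0 ≤ ∫ y in ann N, U y := setIntegral_nonneg measurableSet_ann fun y _ => h.U_nonneg y
  have hJV : 0 ≤ ∫ y in ann N, V y := setIntegral_nonneg measurableSet_ann fun y _ => h.V_nonneg y
  have h1 := (integral_lap_ball_ge h (by norm_num) (by norm_num) hm.le hp (by positivity)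
    hVl).trans hF
  have h2 := (integral_lap_ball_ge h.symm (by norm_num) (by norm_num) hm.le hq (by positivity)
    hUl).trans hH
  refine ⟨hF.trans ?_, hH.trans ?_, (aux hC2 hq hJU h2).trans ?_, (aux hC1 hp hJV h1).trans ?_⟩
  · exact le_max_of_le_left (le_max_left _ _)
  · exact le_max_of_le_left (le_max_right _ _)
  · exact le_max_of_le_right (le_max_left _ _)
  · exact le_max_of_le_right (le_max_right _ _)

/-- The Riesz kernel `|y - z|^(-l)`, equal to infinity on the diagonal when `0 < l`. -/
noncomputable def kk (l : ℝ) (z y : Euc N) : ENNReal := edist y z ^ (-l)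

lemma kk_of_ne (l : ℝ) {z y : Euc N} (h : y ≠ z) : kk l z y = ENNReal.ofReal (‖y - z‖ ^ (-l)) := by
  have : 0 < ‖y - z‖ := norm_pos_iff.2 (sub_ne_zero.2 h)
  rw [kk, edist_dist, dist_eq_norm, ENNReal.ofReal_rpow_of_pos this]

lemma measurable_kk (l : ℝ) (z : Euc N) : Measurable (kk l z) := by
  unfold kk; fun_prop

lemma pd_bump_eq_zero {r : ℝ} (hr : 0 ≤ r) (i : Fin N) {y : Euc N}
    (h : ‖y‖ < r ∨ r + 1 < ‖y‖) : pd i (bump r) y = 0 := by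
  rcases h with h | h
  · rw [pd_congr (g := fun _ => 1), pd]
    · simp
    · have : ∀ᶠ w in nhds y, ‖w‖ < r := continuous_norm.continuousAt.eventually_lt_const h
      filter_upwards [this] with w hw using bump_eq_one hw.le
  · rw [pd_congr (g := fun _ => 0), pd]
    · simp
    · have : ∀ᶠ w in nhds y, r + 1 < ‖w‖ := continuous_norm.continuousAt.eventually_const_lt h
      filter_upwards [this] with w hw using bump_eq_zero hr hw.le

lemma lap_bump_eq_zero {r : ℝ} (hr : 0 ≤ r) {y : Euc N}
    (h : ‖y‖ < r ∨ r + 1 < ‖y‖) : lap (bump r) y = 0 := by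
  rw [lap_eq_sum_pd (contDiff_bump r (n := 2)).contDiffAt]
  refine Finset.sum_eq_zero fun i _ => ?_
  rw [pd_congr (g := fun _ => 0), pd]
  · simp
  · rcases h with h | h
    · have : ∀ᶠ w in nhds y, ‖w‖ < r := continuous_norm.continuousAt.eventually_lt_const h
      filter_upwards [this] with w hw using pd_bump_eq_zero hr i (Or.inl hw)
    · have : ∀ᶠ w in nhds y, r + 1 < ‖w‖ := continuous_norm.continuousAt.eventually_const_lt h
      filter_upwards [this] with w hw using pd_bump_eq_zero hr i (Or.inr hw)

lemma exists_bump_bound (r : ℝ) (hr : 0 ≤ r) : ∃ C > 0,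
    (∀ y : Euc N, |lap (bump r) y| ≤ C) ∧ ∀ (i : Fin N) (y : Euc N), |pd i (bump r) y| ≤ C := by
  have hb2 : ContDiff ℝ 2 (bump (N := N) r) := contDiff_bump r (n := 2)
  have hb1 : ContDiff ℝ 1 (bump (N := N) r) := contDiff_bump r (n := 1)
  obtain ⟨C1, h1⟩ := (hasCompactSupport_lap hb2 (hasCompactSupport_bump hr)).exists_bound_of_continuous
    (continuous_lap hb2)
  have h2 : ∀ i : Fin N, ∃ C, ∀ y, ‖pd i (bump (N := N) r) y‖ ≤ C := fun i =>
    (hasCompactSupport_pd (hasCompactSupport_bump hr) i).exists_bound_of_continuous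
      (continuous_pd hb1 i)
  choose C2 h2 using h2
  refine ⟨|C1| + ∑ i, |C2 i| + 1, by positivity, fun y => ?_, fun i y => ?_⟩
  · have : 0 ≤ ∑ i, |C2 i| := Finset.sum_nonneg fun i _ => abs_nonneg _
    have := h1 y
    rw [Real.norm_eq_abs] at this
    linarith [le_abs_self C1]
  · have : |C2 i| ≤ ∑ i, |C2 i| := Finset.single_le_sum (f := fun i => |C2 i|)
      (fun i _ => abs_nonneg _) (Finset.mem_univ i)
    have := h2 i y
    rw [Real.norm_eq_abs] at this
    linarith [le_abs_self (C2 i), abs_nonneg C1]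

/-- Testing the equation against a cut-off kernel. -/
lemma cutoff_bound : ∃ C > 0, ∀ U : Euc N → ℝ, ContDiff ℝ 2 U → (∀ x, 0 ≤ U x) →
    (∀ x ∈ closedBall (0 : Euc N) 6, lap U x ≤ 0) → ∀ z : Euc N, ‖z‖ ≤ 2 →
    ∀ (T : Euc N → ℝ) (B l : ℝ), ContDiff ℝ 2 T → 0 < B → 0 < l →
    (∀ y, y ≠ z → |T y| ≤ B * ‖y - z‖ ^ (-l)) →
    (∀ y, 1 ≤ ‖y - z‖ → |T y| ≤ B ∧ ∀ j, |pd j T y| ≤ B) →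
    ‖∫ y, U y * bump 5 y * lap T y‖ₑ ≤ ENNReal.ofReal (C * B) *
      ((∫⁻ y in closedBall 0 6, ENNReal.ofReal (-lap U y) * kk l z y) +
        ENNReal.ofReal (∫ y in ann N, U y)) := by
  obtain ⟨K, hK, hK1, hK2⟩ := exists_bump_bound (N := N) 5 (by norm_num)
  refine ⟨1 + (2 * (N * K) + K), by positivity, fun U hU hU0 hl z hz T B l hT hBp hlp hT1 hT2 => ?_⟩
  have hB := hBp.le
  have hb2 : ContDiff ℝ 2 (bump (N := N) 5) := contDiff_bump 5 (n := 2)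
  have hb1 : ContDiff ℝ 1 (bump (N := N) 5) := contDiff_bump 5 (n := 1)
  have hT1' : ContDiff ℝ 1 T := hT.of_le (by norm_num)
  have hsupp := hasCompactSupport_bump (N := N) (r := 5) (by norm_num)
  set W : Euc N → ℝ := fun y => 2 * ∑ i, pd i (bump 5) y * pd i T y + lap (bump 5) y * T y with hW
  have hcb := hb2.continuous
  have hcU := hU.continuous
  have hcT := hT.continuous
  have hclT := continuous_lap hT
  have hclU := continuous_lap hU
  have hclb := continuous_lap hb2
  have hWc : Continuous W := by
    have : ∀ i, Continuous (pd i (bump (N := N) 5)) := fun i => continuous_pd hb1 i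
    have : ∀ i, Continuous (pd i T) := fun i => continuous_pd hT1' i
    fun_prop
  have hW0 : ∀ y, y ∉ ann N → W y = 0 := by
    intro y hy
    have : ‖y‖ < 5 ∨ 5 + 1 < ‖y‖ := by
      by_contra! h
      refine hy ⟨?_, ?_⟩
      · rw [mem_closedBall_zero_iff]; linarith
      · rw [mem_ball_zero_iff]; linarith
    simp [hW, pd_bump_eq_zero (N := N) (by norm_num : (0 : ℝ) ≤ 5) _ this,
      lap_bump_eq_zero (N := N) (by norm_num : (0 : ℝ) ≤ 5) this]
  have hWb : ∀ y ∈ ann N, |W y| ≤ (2 * (N * K) + K) * B := by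
    intro y hy
    have h5 : 5 ≤ ‖y‖ := by
      have := hy.2; rw [mem_ball_zero_iff, not_lt] at this; exact this
    have h1 : 1 ≤ ‖y - z‖ := by have := norm_sub_norm_le y z; linarith
    obtain ⟨t1, t2⟩ := hT2 y h1
    have s1 : |∑ i, pd i (bump 5) y * pd i T y| ≤ N * (K * B) := by
      refine (Finset.abs_sum_le_sum_abs _ _).trans ?_
      refine (Finset.sum_le_card_nsmul _ _ (K * B) fun i _ => ?_).trans ?_
      · rw [abs_mul]; exact mul_le_mul (hK2 i y) (t2 i) (abs_nonneg _) hK.le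
      · simp
    have s2 : |lap (bump 5) y * T y| ≤ K * B := by
      rw [abs_mul]; exact mul_le_mul (hK1 y) t1 (abs_nonneg _) hK.le
    calc |W y| ≤ |2 * ∑ i, pd i (bump 5) y * pd i T y| + |lap (bump 5) y * T y| := abs_add_le _ _
      _ ≤ 2 * (N * (K * B)) + K * B := by rw [abs_mul, abs_two]; gcongr
      _ = _ := by ring
  have green := integral_mul_lap hU (hb2.mul hT) (hsupp.mul_right (f' := T))
  have hi1 : Integrable fun y => U y * bump 5 y * lap T y :=
    Continuous.integrable_of_hasCompactSupport (by fun_prop) (hasCompactSupport_of_ball 6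
      fun y hy => by rw [bump_eq_zero (by norm_num) (by linarith)]; ring)
  have hi2 : Integrable fun y => U y * W y :=
    Continuous.integrable_of_hasCompactSupport (by fun_prop) (hasCompactSupport_of_ball 7
      fun y hy => by
        rw [hW0 y fun h => ?_, mul_zero]
        have := h.1
        rw [mem_closedBall_zero_iff] at this; linarith)
  have e1 : ∫ y, U y * bump 5 y * lap T y =
      (∫ y, lap U y * (bump 5 y * T y)) - ∫ y, U y * W y := by
    rw [← green, eq_sub_iff_add_eq, ← integral_add hi1 hi2]
    refine integral_congr_ae (Eventually.of_forall fun y => ?_)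
    simp only
    rw [lap_mul hb2 hT, hW]; ring
  have b1 : ‖∫ y, lap U y * (bump 5 y * T y)‖ₑ ≤ ENNReal.ofReal B *
      ∫⁻ y in closedBall 0 6, ENNReal.ofReal (-lap U y) * kk l z y := by
    refine (enorm_integral_le_lintegral_enorm _).trans ?_
    rw [← lintegral_const_mul' _ _ ENNReal.ofReal_ne_top, ← lintegral_indicator
      measurableSet_closedBall]
    refine lintegral_mono fun y => ?_
    by_cases hy : y ∈ closedBall (0 : Euc N) 6
    · rw [indicator_of_mem hy, enorm_mul, enorm_mul, Real.enorm_eq_ofReal_abs,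
        Real.enorm_eq_ofReal_abs, Real.enorm_eq_ofReal_abs, abs_of_nonpos (hl y hy),
        abs_of_nonneg (bump_nonneg _ _)]
      have hT3 : ENNReal.ofReal |T y| ≤ ENNReal.ofReal B * kk l z y := by
        by_cases hyz : y = z
        · rw [hyz, kk, edist_self, ENNReal.zero_rpow_of_neg (neg_lt_zero.2 hlp),
            ENNReal.mul_top (ENNReal.ofReal_pos.2 hBp).ne']
          exact le_top
        · rw [kk_of_ne l hyz, ← ENNReal.ofReal_mul hB]
          exact ENNReal.ofReal_le_ofReal (hT1 y hyz)
      calc ENNReal.ofReal (-lap U y) * (ENNReal.ofReal (bump 5 y) * ENNReal.ofReal |T y|)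
          ≤ ENNReal.ofReal (-lap U y) * (1 * (ENNReal.ofReal B * kk l z y)) := by
            gcongr
            rw [← ENNReal.ofReal_one]
            exact ENNReal.ofReal_le_ofReal (bump_le_one _ _)
        _ = _ := by ring
    · rw [mem_closedBall_zero_iff, not_le] at hy
      rw [bump_eq_zero (by norm_num) (by linarith)]; simp
  have b2 : ‖∫ y, U y * W y‖ₑ ≤ ENNReal.ofReal ((2 * (N * K) + K) * B) *
      ENNReal.ofReal (∫ y in ann N, U y) := by
    rw [← ENNReal.ofReal_mul (by positivity), Real.enorm_eq_ofReal_abs]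
    refine ENNReal.ofReal_le_ofReal ?_
    rw [← integral_const_mul, ← integral_indicator measurableSet_ann, ← Real.norm_eq_abs]
    refine norm_integral_le_of_norm_le
      (IntegrableOn.integrable_indicator ((integrableOn_ann hcU).const_mul _) measurableSet_ann)
      (Eventually.of_forall fun y => ?_)
    by_cases hy : y ∈ ann N
    · rw [indicator_of_mem hy, Real.norm_eq_abs, abs_mul, abs_of_nonneg (hU0 y), mul_comm]
      exact mul_le_mul_of_nonneg_right (hWb y hy) (hU0 y)
    · rw [hW0 y hy, indicator_of_notMem hy]; simp
  rw [e1]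
  refine (enorm_sub_le).trans ((add_le_add b1 b2).trans ?_)
  have h3 : 0 ≤ 2 * (N * K) + K := by positivity
  rw [mul_add]
  exact add_le_add
    (mul_le_mul_left (ENNReal.ofReal_le_ofReal (le_mul_of_one_le_left hB (by linarith))) _)
    (mul_le_mul_left (ENNReal.ofReal_le_ofReal (mul_le_mul_of_nonneg_right (by linarith) hB)) _)

lemma rker_le_rpow {δ e : ℝ} (he : e ≤ 0) {z y : Euc N} (h : y ≠ z) :
    rker e δ z y ≤ ‖y - z‖ ^ (2 * e) := by
  have h0 : 0 < ‖y - z‖ := norm_pos_iff.2 (sub_ne_zero.2 h)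
  rw [Real.rpow_mul h0.le, Real.rpow_two]
  exact Real.rpow_le_rpow_of_nonpos (by positivity) (by nlinarith [sq_nonneg δ]) he

lemma rker_le_one {δ e : ℝ} (he : e ≤ 0) {z y : Euc N} (h : 1 ≤ ‖y - z‖) :
    rker e δ z y ≤ 1 :=
  Real.rpow_le_one_of_one_le_of_nonpos (by nlinarith [sq_nonneg δ]) he

lemma abs_sub_apply_le (z y : Euc N) (i : Fin N) : |y i - z i| ≤ ‖y - z‖ := by
  have := PiLp.norm_apply_le (y - z) i
  simpa using this

/-- Pointwise bound of a superharmonic function by its Newtonian potential. -/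
lemma value_le (hN : 3 ≤ N) : ∃ C > 0, ∀ U : Euc N → ℝ, ContDiff ℝ 2 U → (∀ x, 0 ≤ U x) →
    (∀ x ∈ closedBall (0 : Euc N) 6, lap U x ≤ 0) → ∀ z : Euc N, ‖z‖ ≤ 2 →
    ‖U z‖ₑ ≤ ENNReal.ofReal C *
      ((∫⁻ y in closedBall 0 6, ENNReal.ofReal (-lap U y) * kk (N - 2) z y) +
        ENNReal.ofReal (∫ y in ann N, U y)) := by
  obtain ⟨K, hK, hb⟩ := cutoff_bound (N := N)
  have hm := amass_pos hN
  have hnu := nu_pos hN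
  have h2nu : 2 * nu N = N - 2 := by rw [nu]; ring
  refine ⟨(amass N)⁻¹ * (K * (1 + 2 * nu N)), by positivity, fun U hU hU0 hl z hz => ?_⟩
  have hlim := (tendsto_aker_cutoff hN hU.continuous (R := 5) (by norm_num)
    (z := z) (by linarith)).enorm
  rw [ENNReal.ofReal_mul (by positivity), mul_assoc]
  have key : ‖amass N * U z‖ₑ ≤ ENNReal.ofReal (K * (1 + 2 * nu N)) *
      ((∫⁻ y in closedBall 0 6, ENNReal.ofReal (-lap U y) * kk (N - 2) z y) +
        ENNReal.ofReal (∫ y in ann N, U y)) := by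
    refine le_of_tendsto hlim ?_
    filter_upwards [eventually_ge_atTop 1] with c hc
    have hδ : 1 / c ≠ 0 := by positivity
    have := hb U hU hU0 hl z hz (rker (-nu N) (1 / c) z) (1 + 2 * nu N) (N - 2)
      (contDiff_rker hδ _ z) (by positivity) (by linarith) (fun y hy => ?_) (fun y hy => ⟨?_, ?_⟩)
    · simp only [lap_rker hδ, mul_neg, integral_neg, enorm_neg] at this
      exact this
    · rw [abs_of_pos (rker_pos hδ _ _ _)]
      refine (rker_le_rpow (by linarith) hy).trans ?_
      rw [show 2 * -nu N = -((N : ℝ) - 2) by linarith]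
      exact le_mul_of_one_le_left (by positivity) (by linarith)
    · rw [abs_of_pos (rker_pos hδ _ _ _)]
      exact (rker_le_one (by linarith) hy).trans (by linarith)
    · intro j
      have h0 : y ≠ z := by rintro rfl; simp at hy; linarith
      rw [pd_rker hδ, abs_mul, abs_mul, abs_of_pos (rker_pos hδ _ _ _), abs_mul, abs_two, abs_neg,
        abs_of_pos hnu]
      have h1 := rker_le_rpow (δ := 1 / c) (e := -nu N - 1) (by linarith) h0
      have h2 := abs_sub_apply_le z y j
      have h3 := rker_pos hδ (-nu N - 1) z y
      have h4 : ‖y - z‖ * ‖y - z‖ ^ (2 * (-nu N - 1)) ≤ 1 := by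
        rw [← Real.rpow_one_add' (by positivity) (by linarith)]
        exact Real.rpow_le_one_of_one_le_of_nonpos hy (by linarith)
      calc 2 * nu N * |y j - z j| * rker (-nu N - 1) (1 / c) z y
          ≤ 2 * nu N * (‖y - z‖ * ‖y - z‖ ^ (2 * (-nu N - 1))) := by
            rw [mul_assoc]; gcongr
        _ ≤ 2 * nu N * 1 := by gcongr
        _ ≤ _ := by linarith
  have h1 : ‖U z‖ₑ = ENNReal.ofReal (amass N)⁻¹ * ‖amass N * U z‖ₑ := by
    rw [← Real.enorm_of_nonneg (by positivity), ← enorm_mul, inv_mul_cancel_left₀ hm.ne']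
  rw [h1]
  gcongr

/-- Pointwise gradient bound for a superharmonic function. -/
lemma pd_le (hN : 3 ≤ N) : ∃ C > 0, ∀ U : Euc N → ℝ, ContDiff ℝ 2 U → (∀ x, 0 ≤ U x) →
    (∀ x ∈ closedBall (0 : Euc N) 6, lap U x ≤ 0) → ∀ z : Euc N, ‖z‖ ≤ 2 → ∀ i,
    ‖pd i U z‖ₑ ≤ ENNReal.ofReal C *
      ((∫⁻ y in closedBall 0 6, ENNReal.ofReal (-lap U y) * kk (N - 1) z y) +
        ENNReal.ofReal (∫ y in ann N, U y)) := by
  obtain ⟨K, hK, hb⟩ := cutoff_bound (N := N)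
  have hm := amass_pos hN
  have hnu := nu_pos hN
  have h2nu : 2 * nu N = N - 2 := by rw [nu]; ring
  set B := 2 * nu N + 4 * (nu N * (nu N + 1)) with hB
  refine ⟨(amass N)⁻¹ * (K * B), by positivity, fun U hU hU0 hl z hz i => ?_⟩
  have hb1 : ContDiff ℝ 1 (bump (N := N) 5) := contDiff_bump 5 (n := 1)
  have hU1 : ContDiff ℝ 1 U := hU.of_le (by norm_num)
  have hg : ContDiff ℝ 1 (fun y => U y * bump 5 y) := hU1.mul hb1
  have hgs : HasCompactSupport (fun y => U y * bump 5 y) :=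
    (hasCompactSupport_bump (N := N) (r := 5) (by norm_num)).mul_left
  have hpz : pd i (fun y => U y * bump 5 y) z = pd i U z := by
    refine pd_congr ?_ i
    have : ∀ᶠ w in nhds z, ‖w‖ < 5 :=
      continuous_norm.continuousAt.eventually_lt_const (by linarith)
    filter_upwards [this] with w hw
    rw [bump_eq_one hw.le, mul_one]
  have hlim := (tendsto_aker hN (continuous_pd hg i) (hasCompactSupport_pd hgs i) z).enorm
  rw [hpz] at hlim
  rw [ENNReal.ofReal_mul (by positivity), mul_assoc]
  have key : ‖amass N * pd i U z‖ₑ ≤ ENNReal.ofReal (K * B) *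
      ((∫⁻ y in closedBall 0 6, ENNReal.ofReal (-lap U y) * kk (N - 1) z y) +
        ENNReal.ofReal (∫ y in ann N, U y)) := by
    refine le_of_tendsto hlim ?_
    filter_upwards [eventually_ge_atTop 1] with c hc
    have hδ : 1 / c ≠ 0 := by positivity
    have hTc : ContDiff ℝ 2 (pd i (rker (-nu N) (1 / c) z)) :=
      contDiff_pd (n := 3) (m := 2) (contDiff_rker hδ _ z) (by norm_num) i
    have := hb U hU hU0 hl z hz (pd i (rker (-nu N) (1 / c) z)) B (N - 1)
      hTc (by positivity) (by linarith) (fun y hy => ?_) (fun y hy => ⟨?_, ?_⟩)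
    · have ibp := integral_mul_pd (f := aker (1 / c) z) (contDiff_aker hδ z) hg hgs i
      simp only [lap_pd_rker hδ, mul_neg, integral_neg] at this
      have e : ∫ y, pd i (fun y => U y * bump 5 y) y * aker (1 / c) z y =
          -∫ y, U y * bump 5 y * pd i (aker (1 / c) z) y := by
        simp only [mul_comm (pd i (fun y => U y * bump 5 y) _), ibp]
        simp only [mul_comm]
      rw [e]; exact this
    · have h0 : 0 < ‖y - z‖ := norm_pos_iff.2 (sub_ne_zero.2 hy)
      rw [pd_rker hδ, abs_mul, abs_mul, abs_of_pos (rker_pos hδ _ _ _), abs_mul, abs_two, abs_neg,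
        abs_of_pos hnu]
      have h1 := rker_le_rpow (δ := 1 / c) (e := -nu N - 1) (by linarith) hy
      have h2 := abs_sub_apply_le z y i
      have h3 := rker_pos hδ (-nu N - 1) z y
      have h4 : ‖y - z‖ * ‖y - z‖ ^ (2 * (-nu N - 1)) = ‖y - z‖ ^ (-((N : ℝ) - 1)) := by
        rw [← Real.rpow_one_add' (by positivity) (by linarith)]
        congr 1; linarith
      calc 2 * nu N * |y i - z i| * rker (-nu N - 1) (1 / c) z y
          ≤ 2 * nu N * (‖y - z‖ * ‖y - z‖ ^ (2 * (-nu N - 1))) := by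
            rw [mul_assoc]; gcongr
        _ ≤ _ := by
          rw [h4]
          have : 0 ≤ 4 * (nu N * (nu N + 1)) := by positivity
          gcongr
          linarith
    · have h0 : y ≠ z := by rintro rfl; simp at hy; linarith
      rw [pd_rker hδ, abs_mul, abs_mul, abs_of_pos (rker_pos hδ _ _ _), abs_mul, abs_two, abs_neg,
        abs_of_pos hnu]
      have h1 := rker_le_rpow (δ := 1 / c) (e := -nu N - 1) (by linarith) h0
      have h2 := abs_sub_apply_le z y i
      have h3 := rker_pos hδ (-nu N - 1) z y
      have h4 : ‖y - z‖ * ‖y - z‖ ^ (2 * (-nu N - 1)) ≤ 1 := by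
        rw [← Real.rpow_one_add' (by positivity) (by linarith)]
        exact Real.rpow_le_one_of_one_le_of_nonpos hy (by linarith)
      have h5 : 0 ≤ 4 * (nu N * (nu N + 1)) := by positivity
      calc 2 * nu N * |y i - z i| * rker (-nu N - 1) (1 / c) z y
          ≤ 2 * nu N * (‖y - z‖ * ‖y - z‖ ^ (2 * (-nu N - 1))) := by
            rw [mul_assoc]; gcongr
        _ ≤ 2 * nu N * 1 := by gcongr
        _ ≤ _ := by linarith
    · intro j
      have h0 : y ≠ z := by rintro rfl; simp at hy; linarith
      rw [pd_pd_rker hδ]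
      have h1 := rker_le_one (δ := 1 / c) (e := -nu N - 1) (by linarith) hy
      have h1' := rker_le_rpow (δ := 1 / c) (e := -nu N - 2) (by linarith) h0
      have h2 := abs_sub_apply_le z y i
      have h2' := abs_sub_apply_le z y j
      have h3 := rker_pos hδ (-nu N - 1) z y
      have h3' := rker_pos hδ (-nu N - 2) z y
      have h4 : ‖y - z‖ * ‖y - z‖ * ‖y - z‖ ^ (2 * (-nu N - 2)) ≤ 1 := by
        rw [mul_assoc, ← Real.rpow_one_add' (by positivity) (by linarith),
          ← Real.rpow_one_add' (by positivity) (by linarith)]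
        exact Real.rpow_le_one_of_one_le_of_nonpos hy (by linarith)
      refine (abs_add_le _ _).trans (add_le_add ?_ ?_)
      · rw [abs_mul, abs_mul, abs_mul, abs_two, abs_neg, abs_of_pos h3, abs_of_pos hnu]
        have : |(if i = j then (1 : ℝ) else 0)| ≤ 1 := by split_ifs <;> simp
        calc 2 * |(if i = j then (1 : ℝ) else 0)| * nu N * rker (-nu N - 1) (1 / c) z y
            ≤ 2 * 1 * nu N * 1 := by gcongr
          _ = _ := by ring
      · rw [abs_mul, abs_mul, abs_mul, abs_mul, abs_of_pos h3',
          show -nu N * (-nu N - 1) = nu N * (nu N + 1) by ring,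
          abs_of_pos (by positivity : 0 < nu N * (nu N + 1)), abs_of_pos (by norm_num : (0 : ℝ) < 4)]
        calc 4 * |y i - z i| * |y j - z j| * (nu N * (nu N + 1)) * rker (-nu N - 2) (1 / c) z y
            ≤ 4 * ‖y - z‖ * ‖y - z‖ * (nu N * (nu N + 1)) * ‖y - z‖ ^ (2 * (-nu N - 2)) := by
              gcongr
          _ = 4 * (nu N * (nu N + 1)) * (‖y - z‖ * ‖y - z‖ * ‖y - z‖ ^ (2 * (-nu N - 2))) := by
              ring
          _ ≤ 4 * (nu N * (nu N + 1)) * 1 := by gcongr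
          _ = _ := by ring
  have h1 : ‖pd i U z‖ₑ = ENNReal.ofReal (amass N)⁻¹ * ‖amass N * pd i U z‖ₑ := by
    rw [← Real.enorm_of_nonneg (by positivity), ← enorm_mul, inv_mul_cancel_left₀ hm.ne']
  rw [h1]
  gcongr

/-- Radial powers are integrable near the origin. -/
lemma lintegral_enorm_rpow_lt_top {E : Type*} [NormedAddCommGroup E] [NormedSpace ℝ E]
    [FiniteDimensional ℝ E] [MeasurableSpace E] [BorelSpace E] [Nontrivial E] (μ : Measure E)
    [μ.IsAddHaarMeasure] {l : ℝ} (hl : l < Module.finrank ℝ E) (r : ℝ) :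
    ∫⁻ y in ball (0 : E) r, ‖y‖ₑ ^ (-l) ∂μ < ⊤ := by
  have h1 : IntegrableOn (fun x : E => ‖x‖ ^ (-l)) (ball (0 : E) r) μ := by
    rcases le_or_gt r 0 with hr | hr
    · rw [ball_eq_empty.2 hr]; exact integrableOn_empty
    rw [integrableOn_fun_norm_addHaar μ (f := fun t : ℝ => t ^ (-l))]
    have h2 : IntegrableOn (fun y : ℝ => y ^ ((Module.finrank ℝ E - 1 : ℝ) - l)) (Ioo 0 r) :=
      (intervalIntegral.integrableOn_Ioo_rpow_iff hr).2 (by linarith)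
    refine h2.congr_fun (fun y hy => ?_) measurableSet_Ioo
    have h3 : 1 ≤ Module.finrank ℝ E := Module.finrank_pos
    simp only [smul_eq_mul]
    rw [sub_eq_add_neg, Real.rpow_add hy.1, ← Real.rpow_natCast, Nat.cast_sub h3, Nat.cast_one]
  refine lt_of_le_of_lt (lintegral_mono_ae ?_) h1.2
  have h4 : ∀ᵐ y ∂(μ.restrict (ball (0 : E) r)), y ≠ 0 := by
    refine ae_restrict_of_ae ?_
    simp [ae_iff]
  filter_upwards [h4] with y hy
  have : 0 < ‖y‖ := norm_pos_iff.2 hy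
  rw [Real.enorm_of_nonneg (by positivity), ← ofReal_norm, ENNReal.ofReal_rpow_of_pos this]

lemma nontrivial_euc (hN : 3 ≤ N) : Nontrivial (Euc N) := by
  have : Nonempty (Fin N) := ⟨⟨0, by omega⟩⟩
  infer_instance

lemma kk_comm (l : ℝ) (z y : Euc N) : kk l z y = kk l y z := by rw [kk, kk, edist_comm]

lemma measurable_kk_comp {X : Type*} [MeasurableSpace X] {f g : X → Euc N} (hf : Measurable f)
    (hg : Measurable g) (l : ℝ) : Measurable fun t => kk l (f t) (g t) := by
  unfold kk; fun_prop

/-- Uniform bound for the Riesz potential of a ball. -/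
lemma kk_bound (hN : 3 ≤ N) {l : ℝ} (hl : l < N) : ∃ C : ENNReal, C ≠ ⊤ ∧
    ∀ x ∈ closedBall (0 : Euc N) 10, ∫⁻ y in closedBall 0 10, kk l x y ≤ C := by
  have := nontrivial_euc hN
  refine ⟨_, (lintegral_enorm_rpow_lt_top (volume : Measure (Euc N)) (l := l)
    (by simpa using hl) 21).ne, fun x hx => ?_⟩
  rw [mem_closedBall_zero_iff] at hx
  have e : ∫⁻ y in ball (0 : Euc N) 21, ‖y‖ₑ ^ (-l) =
      ∫⁻ y, (ball (0 : Euc N) 21).indicator (fun y => ‖y‖ₑ ^ (-l)) (y - x) := by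
    rw [lintegral_sub_right_eq_self (fun y => (ball (0 : Euc N) 21).indicator
      (fun y => ‖y‖ₑ ^ (-l)) y) x, lintegral_indicator measurableSet_ball]
  rw [e, ← lintegral_indicator measurableSet_closedBall]
  refine lintegral_mono fun y => ?_
  refine indicator_apply_le' (fun hy => ?_) fun _ => zero_le
  rw [mem_closedBall_zero_iff] at hy
  rw [indicator_of_mem, kk, edist_eq_enorm_sub]
  rw [mem_ball_zero_iff]
  linarith [norm_sub_le y x]

/-- The weight `| |y| - r |^(e-1)`. -/
noncomputable def ww (e r : ℝ) (y : Euc N) : ENNReal := edist ‖y‖ r ^ (e - 1)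

lemma measurable_ww_uncurry (e : ℝ) : Measurable fun x : ℝ × Euc N => ww e x.1 x.2 := by
  unfold ww; fun_prop

lemma measurable_ww (e r : ℝ) : Measurable (ww (N := N) e r) := by
  unfold ww; fun_prop

lemma ww_bound {e : ℝ} (he : 0 < e) : ∃ C : ENNReal, C ≠ ⊤ ∧
    ∀ y ∈ closedBall (0 : Euc N) 6, ∫⁻ r in Icc (1 : ℝ) 2, ww e r y ≤ C := by
  refine ⟨_, (lintegral_enorm_rpow_lt_top (volume : Measure ℝ) (l := 1 - e)
    (by simpa using he) 9).ne, fun y hy => ?_⟩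
  rw [mem_closedBall_zero_iff] at hy
  have e : ∫⁻ r in ball (0 : ℝ) 9, ‖r‖ₑ ^ (-(1 - e)) =
      ∫⁻ r, (ball (0 : ℝ) 9).indicator (fun y => ‖y‖ₑ ^ (-(1 - e))) (r - ‖y‖) := by
    rw [lintegral_sub_right_eq_self (fun y => (ball (0 : ℝ) 9).indicator
      (fun y => ‖y‖ₑ ^ (-(1 - e))) y) ‖y‖, lintegral_indicator measurableSet_ball]
  rw [e, ← lintegral_indicator measurableSet_Icc]
  refine lintegral_mono fun r => ?_
  refine indicator_apply_le' (fun hr => ?_) fun _ => zero_le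
  rw [indicator_of_mem, ww, edist_comm, edist_eq_enorm_sub, neg_sub]
  rw [mem_ball_zero_iff, Real.norm_eq_abs, abs_lt]
  have := norm_nonneg y
  constructor <;> linarith [hr.1, hr.2]

/-- The surface measure on the unit sphere. -/
noncomputable def sig (N : ℕ) : Measure (sphere (0 : Euc N) 1) := (volume : Measure (Euc N)).toSphere

instance : IsFiniteMeasure (sig N) := by unfold sig; infer_instance

lemma lintegral_polar (hN : 3 ≤ N) {F : Euc N → ENNReal} (hF : Measurable F) :
    ∫⁻ x, F x = ∫⁻ θ, (∫⁻ ρ in Ioi (0 : ℝ), ENNReal.ofReal (ρ ^ (N - 1)) *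
      F (ρ • (θ : Euc N))) ∂(sig N) := by
  have := nontrivial_euc hN
  have h := (Measure.measurePreserving_homeomorphUnitSphereProd
    (volume : Measure (Euc N))).lintegral_comp_emb (Homeomorph.measurableEmbedding _)
    (fun w => F (w.2.1 • w.1.1))
  have e1 : ∀ x : ({0}ᶜ : Set (Euc N)), F ((homeomorphUnitSphereProd (Euc N) x).2.1 •
      (homeomorphUnitSphereProd (Euc N) x).1.1) = F x := by
    intro x
    have : (x : Euc N) ≠ 0 := x.2
    simp [homeomorphUnitSphereProd, smul_smul, this]
  simp only [e1] at h
  rw [← restrict_compl_singleton (μ := (volume : Measure (Euc N))) 0,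
    ← lintegral_subtype_comap (measurableSet_singleton _).compl, h]
  have hm : Measurable fun w : sphere (0 : Euc N) 1 × Ioi (0 : ℝ) => F (w.2.1 • w.1.1) :=
    hF.comp (by fun_prop)
  rw [lintegral_prod _ hm.aemeasurable, sig]
  refine lintegral_congr fun θ => ?_
  rw [Measure.volumeIoiPow, lintegral_withDensity_eq_lintegral_mul₀ (by fun_prop)
    (by exact (hF.comp (by fun_prop)).aemeasurable)]
  simp only [Pi.mul_apply, finrank_euclideanSpace_fin]
  exact lintegral_subtype_comap measurableSet_Ioi
    fun ρ => ENNReal.ofReal (ρ ^ (N - 1)) * F (ρ • (θ : Euc N))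

lemma lintegral_polar_swap (hN : 3 ≤ N) {F : Euc N → ENNReal} (hF : Measurable F) :
    ∫⁻ x, F x = ∫⁻ ρ in Ioi (0 : ℝ), ENNReal.ofReal (ρ ^ (N - 1)) *
      ∫⁻ θ, F (ρ • (θ : Euc N)) ∂(sig N) := by
  rw [lintegral_polar hN hF, lintegral_lintegral_swap]
  · refine lintegral_congr fun ρ => ?_
    rw [lintegral_const_mul]
    exact hF.comp (by fun_prop)
  · have : Measurable fun w : sphere (0 : Euc N) 1 × ℝ =>
        ENNReal.ofReal (w.2 ^ (N - 1)) * F (w.2 • w.1.1) :=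
      Measurable.mul (by fun_prop) (hF.comp (by fun_prop))
    exact this.aemeasurable

lemma kk_le_radial {l : ℝ} (hl : 0 < l) {r : ℝ} (hr : r ∈ Icc (1 : ℝ) 2) {y : Euc N}
    (hy : y ∈ closedBall (0 : Euc N) 6) (θ : sphere (0 : Euc N) 1) :
    kk l (r • (θ : Euc N)) y ≤ ENNReal.ofReal (8 * 2 ^ (l + 1)) *
      ∫⁻ ρ in Icc (1 : ℝ) 4, kk (l + 1) (ρ • (θ : Euc N)) y := by
  have hθ : ‖(θ : Euc N)‖ = 1 := by simp
  rw [mem_closedBall_zero_iff] at hy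
  have hD : ‖y - r • (θ : Euc N)‖ ≤ 8 := by
    refine (norm_sub_le _ _).trans ?_
    rw [norm_smul, hθ, Real.norm_eq_abs, abs_of_pos (by linarith [hr.1])]
    linarith [hr.2]
  have key : ∀ D : ℝ, ‖y - r • (θ : Euc N)‖ < D → D < 9 → ENNReal.ofReal D ^ (-l) ≤
      ENNReal.ofReal (8 * 2 ^ (l + 1)) *
      ∫⁻ ρ in Icc (1 : ℝ) 4, kk (l + 1) (ρ • (θ : Euc N)) y := by
    intro D h1 h2
    have hD0 : 0 < D := (norm_nonneg _).trans_lt h1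
    have h3 : ∀ ρ ∈ Icc r (r + D / 8),
        ENNReal.ofReal (2 * D) ^ (-(l + 1)) ≤ kk (l + 1) (ρ • (θ : Euc N)) y := by
      intro ρ hρ
      unfold kk
      rw [ENNReal.rpow_neg, ENNReal.rpow_neg]
      refine ENNReal.inv_le_inv.2 (ENNReal.rpow_le_rpow ?_ (by linarith))
      rw [edist_dist, dist_eq_norm]
      refine ENNReal.ofReal_le_ofReal ?_
      have : y - ρ • (θ : Euc N) = (y - r • (θ : Euc N)) - (ρ - r) • (θ : Euc N) := by
        rw [sub_smul]; abel
      rw [this]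
      refine (norm_sub_le _ _).trans ?_
      rw [norm_smul, hθ, Real.norm_eq_abs, abs_of_nonneg (by linarith [hρ.1])]
      linarith [hρ.2]
    have h4 : ENNReal.ofReal (2 * D) ^ (-(l + 1)) * ENNReal.ofReal (D / 8) ≤
        ∫⁻ ρ in Icc (1 : ℝ) 4, kk (l + 1) (ρ • (θ : Euc N)) y := by
      calc _ = ∫⁻ ρ in Icc r (r + D / 8), ENNReal.ofReal (2 * D) ^ (-(l + 1)) := by
            rw [setLIntegral_const, Real.volume_Icc]; congr 2; ring
        _ ≤ ∫⁻ ρ in Icc r (r + D / 8), kk (l + 1) (ρ • (θ : Euc N)) y :=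
            setLIntegral_mono' measurableSet_Icc h3
        _ ≤ _ := lintegral_mono_set (Icc_subset_Icc hr.1 (by linarith [hr.2]))
    refine le_trans (le_of_eq ?_) (mul_le_mul_right h4 _)
    rw [ENNReal.ofReal_rpow_of_pos hD0, ENNReal.ofReal_rpow_of_pos (by positivity),
      ← ENNReal.ofReal_mul (by positivity), ← ENNReal.ofReal_mul (by positivity)]
    congr 1
    rw [Real.mul_rpow (by norm_num) hD0.le, Real.rpow_neg (by norm_num : (0 : ℝ) ≤ 2),
      show -(l + 1) = -l - 1 by ring, Real.rpow_sub_one hD0.ne']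
    have : (2 : ℝ) ^ (l + 1) ≠ 0 := by positivity
    field_simp
  have ht : Tendsto (fun D : ℝ => ENNReal.ofReal D ^ (-l))
      (nhdsWithin ‖y - r • (θ : Euc N)‖ (Ioi ‖y - r • (θ : Euc N)‖))
      (nhds (ENNReal.ofReal ‖y - r • (θ : Euc N)‖ ^ (-l))) :=
    ((ENNReal.continuous_rpow_const.comp ENNReal.continuous_ofReal).tendsto _).mono_left
      nhdsWithin_le_nhds
  rw [kk, edist_dist, dist_eq_norm]
  refine le_of_tendsto ht ?_
  filter_upwards [Ioo_mem_nhdsGT (show ‖y - r • (θ : Euc N)‖ < 9 by linarith)] with D hD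
  exact key D hD.1 hD.2

/-- Uniform bound for Riesz kernels on spheres. -/
lemma sphere_kk_bound (hN : 3 ≤ N) {l : ℝ} (hl0 : 0 < l) (hl : l < N - 1) :
    ∃ C : ENNReal, C ≠ ⊤ ∧ ∀ r ∈ Icc (1 : ℝ) 2, ∀ y ∈ closedBall (0 : Euc N) 6,
      ∫⁻ θ, kk l (r • (θ : Euc N)) y ∂(sig N) ≤ C := by
  obtain ⟨C, hC, h⟩ := kk_bound hN (l := l + 1) (by linarith)
  refine ⟨ENNReal.ofReal (8 * 2 ^ (l + 1)) * C, by finiteness, fun r hr y hy => ?_⟩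
  refine (lintegral_mono fun θ => kk_le_radial hl0 hr hy θ).trans ?_
  have hm : Measurable fun x : Euc N => kk (l + 1) x y :=
    measurable_kk_comp measurable_id measurable_const _
  rw [lintegral_const_mul' _ _ ENNReal.ofReal_ne_top]
  refine mul_le_mul_right ?_ _
  have hy' : y ∈ closedBall (0 : Euc N) 10 := closedBall_subset_closedBall (by norm_num) hy
  refine le_trans ?_ (h y hy')
  simp_rw [kk_comm (l + 1) y]
  rw [← lintegral_indicator measurableSet_closedBall,
    lintegral_polar hN (hm.indicator measurableSet_closedBall)]
  refine lintegral_mono fun θ => ?_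
  refine (setLIntegral_mono' measurableSet_Icc fun ρ hρ => ?_).trans
    (lintegral_mono_set (fun ρ hρ => ?_ : Icc (1 : ℝ) 4 ⊆ Ioi 0))
  · have : ρ • (θ : Euc N) ∈ closedBall (0 : Euc N) 10 := by
      rw [mem_closedBall_zero_iff, norm_smul, Real.norm_eq_abs, abs_of_pos (by linarith [hρ.1])]
      simp; linarith [hρ.2]
    rw [indicator_of_mem this]
    refine le_mul_of_one_le_left' ?_
    rw [ENNReal.one_le_ofReal]
    exact one_le_pow₀ hρ.1
  · exact lt_of_lt_of_le one_pos hρ.1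

lemma three_factor {R d f : ENNReal} (hd : d ≠ 0) (hdR : d ≤ R) (hR : R ≠ ⊤)
    {k s e l lam τ k' : ℝ} (hk : 0 < k) (hks : k ≤ s) (he : e ≤ 1)
    (hτ : τ * k' = l - lam * s⁻¹ - (1 - e) * k⁻¹) :
    f * R ^ (-l) ≤ (f ^ k * d ^ (e - 1) * R ^ (-lam)) ^ s⁻¹ *
      ((f ^ k * d ^ (e - 1)) ^ (k⁻¹ - s⁻¹) * (R ^ (-τ)) ^ k') := by
  have hs : 0 < s := hk.trans_le hks
  have hR0 : R ≠ 0 := fun h => hd (le_antisymm (h ▸ hdR) zero_le)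
  have h1 : 0 ≤ k⁻¹ - s⁻¹ := sub_nonneg.2 (inv_anti₀ hk hks)
  have h2 : (f ^ k * d ^ (e - 1)) ^ s⁻¹ * (f ^ k * d ^ (e - 1)) ^ (k⁻¹ - s⁻¹) =
      f * d ^ ((e - 1) * k⁻¹) := by
    rw [← ENNReal.rpow_add_of_nonneg _ _ (by positivity) h1, add_sub_cancel,
      ENNReal.mul_rpow_of_nonneg _ _ (by positivity), ← ENNReal.rpow_mul, ← ENNReal.rpow_mul,
      mul_inv_cancel₀ hk.ne', ENNReal.rpow_one]
  have h3 : (f ^ k * d ^ (e - 1) * R ^ (-lam)) ^ s⁻¹ *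
      ((f ^ k * d ^ (e - 1)) ^ (k⁻¹ - s⁻¹) * (R ^ (-τ)) ^ k') =
      f * (d ^ ((e - 1) * k⁻¹) * R ^ (-l + (1 - e) * k⁻¹)) := by
    rw [ENNReal.mul_rpow_of_nonneg _ (R ^ (-lam)) (by positivity), ← ENNReal.rpow_mul R,
      ← ENNReal.rpow_mul R, mul_mul_mul_comm, h2, ← ENNReal.rpow_add _ _ hR0 hR, mul_assoc]
    congr 3
    linear_combination -hτ
  rw [h3]
  refine mul_le_mul_right ?_ _
  have h4 : R ^ ((e - 1) * k⁻¹) ≤ d ^ ((e - 1) * k⁻¹) := by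
    have : (e - 1) * k⁻¹ = -((1 - e) * k⁻¹) := by ring
    rw [this, ENNReal.rpow_neg, ENNReal.rpow_neg]
    exact ENNReal.inv_le_inv.2 (ENNReal.rpow_le_rpow hdR
      (mul_nonneg (by linarith) (by positivity)))
  calc R ^ (-l) = R ^ ((e - 1) * k⁻¹) * R ^ (-l + (1 - e) * k⁻¹) := by
        rw [← ENNReal.rpow_add _ _ hR0 hR]; congr 1; ring
    _ ≤ _ := mul_le_mul_left h4 _

/-- A three factor version of Hölder's inequality. -/
lemma lintegral_three_le {X : Type*} [MeasurableSpace X] {μ : Measure X} {f g h : X → ENNReal}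
    (hf : Measurable f) (hg : Measurable g) (hh : Measurable h) {a b c : ℝ} (ha : 0 ≤ a)
    (hb : 0 ≤ b) (hc : 0 ≤ c) (habc : a + b + c = 1) :
    ∫⁻ x, f x ^ a * (g x ^ b * h x ^ c) ∂μ ≤
      (∫⁻ x, f x ∂μ) ^ a * ((∫⁻ x, g x ∂μ) ^ b * (∫⁻ x, h x ∂μ) ^ c) := by
  have := ENNReal.lintegral_prod_norm_pow_le (μ := μ) Finset.univ (f := ![f, g, h])
    (p := ![a, b, c]) (by intro i _; fin_cases i <;> simp <;> fun_prop)
    (by simp [Fin.sum_univ_three, habc]) (by intro i _; fin_cases i <;> simpa)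
  simpa [Fin.prod_univ_three, mul_assoc] using this

/-- Weighted mapping property of Riesz potentials restricted to spheres. -/
lemma sphere_potential (hN : 3 ≤ N) {k s j : ℝ} (hk : 1 < k) (hks : k ≤ s)
    (hj : (N - 1) * (k⁻¹ - s⁻¹) < j) :
    ∃ e : ℝ, 0 < e ∧ ∃ C : ENNReal, C ≠ ⊤ ∧ ∀ f : Euc N → ENNReal, Measurable f →
      ∀ r ∈ Icc (1 : ℝ) 2,
      ∫⁻ θ, (∫⁻ y in closedBall 0 6, f y * kk (N - j) (r • (θ : Euc N)) y) ^ s ∂(sig N) ≤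
        C * (∫⁻ y in closedBall 0 6, f y ^ k * ww e r y) ^ (s / k) := by
  have := nontrivial_euc hN
  have hN' : (3 : ℝ) ≤ N := by exact_mod_cast hN
  have hk0 : 0 < k := by linarith
  have hs : 0 < s := by linarith
  obtain ⟨e, he0, he1, he2⟩ : ∃ e : ℝ, 0 < e ∧ e < 1 ∧
      (N - 1) * (k⁻¹ - s⁻¹) + e * (k⁻¹ + s⁻¹) < j := by
    set δ := j - (N - 1) * (k⁻¹ - s⁻¹)
    have hδ : 0 < δ := by simp only [δ]; linarith
    have hD : 0 < k⁻¹ + s⁻¹ := by positivity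
    refine ⟨min (1 / 2) (δ / (2 * (k⁻¹ + s⁻¹))), by positivity, ?_, ?_⟩
    · exact (min_le_left _ _).trans_lt (by norm_num)
    · have h1 : min (1 / 2) (δ / (2 * (k⁻¹ + s⁻¹))) * (k⁻¹ + s⁻¹) ≤
          δ / (2 * (k⁻¹ + s⁻¹)) * (k⁻¹ + s⁻¹) := by gcongr; exact min_le_right _ _
      have h2 : δ / (2 * (k⁻¹ + s⁻¹)) * (k⁻¹ + s⁻¹) = δ / 2 := by field_simp
      have h3 : δ = j - (N - 1) * (k⁻¹ - s⁻¹) := rfl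
      linarith
  set lam : ℝ := N - 1 - e with hlam
  set c : ℝ := 1 - k⁻¹ with hc
  have hc0 : 0 < c := sub_pos.2 (inv_lt_one_of_one_lt₀ hk)
  set τ : ℝ := ((N - j) - lam * s⁻¹ - (1 - e) * k⁻¹) / c with hτ
  have hτc : τ * c = (N - j) - lam * s⁻¹ - (1 - e) * k⁻¹ := div_mul_cancel₀ _ hc0.ne'
  have hτN : τ < N := by
    rw [hτ, div_lt_iff₀ hc0, hc, hlam]
    nlinarith
  obtain ⟨C1, hC1, h1⟩ := sphere_kk_bound hN (l := lam) (by linarith) (by linarith)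
  obtain ⟨C2, hC2, h2⟩ := kk_bound hN hτN
  have h1k : 0 ≤ k⁻¹ - s⁻¹ := sub_nonneg.2 (inv_anti₀ hk0 hks)
  have hsk : 0 ≤ s / k - 1 := by rw [sub_nonneg, le_div_iff₀ hk0]; linarith
  refine ⟨e, he0, C1 * C2 ^ (c * s), by finiteness, fun f hf r hr => ?_⟩
  set A := ∫⁻ y in closedBall 0 6, f y ^ k * ww e r y with hA
  have hfk : Measurable fun y => f y ^ k * ww e r y :=
    (hf.pow_const _).mul (measurable_ww e r)
  have hker : ∀ l : ℝ, Measurable fun w : sphere (0 : Euc N) 1 × Euc N =>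
      kk l (r • (w.1 : Euc N)) w.2 := fun l => measurable_kk_comp (by fun_prop) (by fun_prop) l
  have hker' : ∀ l : ℝ, ∀ θ : sphere (0 : Euc N) 1, Measurable fun y : Euc N =>
      kk l (r • (θ : Euc N)) y := fun l θ => measurable_kk_comp (by fun_prop) (by fun_prop) l
  have hpt : ∀ θ : sphere (0 : Euc N) 1,
      (∫⁻ y in closedBall 0 6, f y * kk (N - j) (r • (θ : Euc N)) y) ^ s ≤
      A ^ (s / k - 1) * C2 ^ (c * s) *
        ∫⁻ y in closedBall 0 6, f y ^ k * ww e r y * kk lam (r • (θ : Euc N)) y := by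
    intro θ
    have hx : r • (θ : Euc N) ∈ closedBall (0 : Euc N) 10 := by
      rw [mem_closedBall_zero_iff, norm_smul, Real.norm_eq_abs, abs_of_pos (by linarith [hr.1])]
      simp; linarith [hr.2]
    have hae : ∀ᵐ y ∂(volume.restrict (closedBall (0 : Euc N) 6)), ‖y‖ ≠ r := by
      refine ae_restrict_of_ae ?_
      rw [ae_iff]
      have := Measure.addHaar_sphere (volume : Measure (Euc N)) 0 r
      simpa [sphere] using this
    have hle : ∫⁻ y in closedBall 0 6, f y * kk (N - j) (r • (θ : Euc N)) y ≤
        ∫⁻ y in closedBall 0 6, (f y ^ k * ww e r y * kk lam (r • (θ : Euc N)) y) ^ s⁻¹ *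
          ((f y ^ k * ww e r y) ^ (k⁻¹ - s⁻¹) * (kk τ (r • (θ : Euc N)) y) ^ c) := by
      refine lintegral_mono_ae ?_
      filter_upwards [hae] with y hy
      refine three_factor (by simpa using hy) ?_ (edist_ne_top _ _) hk0 hks he1.le hτc
      rw [edist_dist, edist_dist]
      refine ENNReal.ofReal_le_ofReal ?_
      rw [Real.dist_eq, dist_eq_norm]
      have : ‖r • (θ : Euc N)‖ = r := by
        rw [norm_smul, Real.norm_eq_abs, abs_of_pos (by linarith [hr.1])]; simp
      calc |‖y‖ - r| = |‖y‖ - ‖r • (θ : Euc N)‖| := by rw [this]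
        _ ≤ _ := abs_norm_sub_norm_le _ _
    have h3 := hle.trans (lintegral_three_le (hfk.mul (hker' lam θ)) hfk (hker' τ θ)
      (by positivity) h1k hc0.le (by rw [hc]; ring))
    refine (ENNReal.rpow_le_rpow h3 hs.le).trans ?_
    rw [ENNReal.mul_rpow_of_nonneg _ _ hs.le, ENNReal.mul_rpow_of_nonneg _ _ hs.le,
      ← ENNReal.rpow_mul, ← ENNReal.rpow_mul, ← ENNReal.rpow_mul, inv_mul_cancel₀ hs.ne',
      ENNReal.rpow_one, mul_comm]
    refine mul_le_mul_left (mul_le_mul' (le_of_eq ?_) (ENNReal.rpow_le_rpow ?_ (by positivity))) _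
    · rw [← hA]; congr 1; field_simp
    · exact (lintegral_mono_set (closedBall_subset_closedBall (by norm_num))).trans (h2 _ hx)
  refine (lintegral_mono hpt).trans ?_
  have hm2 : Measurable fun w : sphere (0 : Euc N) 1 × Euc N =>
      f w.2 ^ k * ww e r w.2 * kk lam (r • (w.1 : Euc N)) w.2 :=
    (hfk.comp measurable_snd).mul (hker lam)
  rw [lintegral_const_mul _ hm2.lintegral_prod_right', lintegral_lintegral_swap hm2.aemeasurable]
  have h5 : ∫⁻ y in closedBall 0 6, ∫⁻ θ, f y ^ k * ww e r y * kk lam (r • (θ : Euc N)) y ∂(sig N)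
      ≤ C1 * A := by
    rw [hA, ← lintegral_const_mul _ hfk]
    refine setLIntegral_mono' measurableSet_closedBall fun y hy => ?_
    rw [lintegral_const_mul _ (measurable_kk_comp (by fun_prop) (by fun_prop) lam), mul_comm]
    exact mul_le_mul_left (h1 r hr y hy) _
  refine (mul_le_mul_right h5 _).trans (le_of_eq ?_)
  have h6 : A ^ (s / k) = A ^ (s / k - 1) * A := by
    conv_rhs => rw [← ENNReal.rpow_one A]
    rw [← ENNReal.rpow_mul, one_mul, ← ENNReal.rpow_add_of_nonneg _ _ hsk zero_le_one,
      sub_add_cancel]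
  rw [h6]; ring

lemma exists_deriv_smoothTransition_bound : ∃ L > 0, (∀ t, |deriv Real.smoothTransition t| ≤ L) ∧
    ∀ t, t ∉ Icc (0 : ℝ) 1 → deriv Real.smoothTransition t = 0 := by
  have hz : ∀ t, t ∉ Icc (0 : ℝ) 1 → deriv Real.smoothTransition t = 0 := by
    intro t ht
    rw [mem_Icc, not_and_or, not_le, not_le] at ht
    rcases ht with ht | ht
    · have : Real.smoothTransition =ᶠ[nhds t] fun _ => 0 := by
        filter_upwards [Iio_mem_nhds ht] with s hs
        exact Real.smoothTransition.zero_of_nonpos (le_of_lt hs)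
      rw [this.deriv_eq, deriv_const]
    · have : Real.smoothTransition =ᶠ[nhds t] fun _ => 1 := by
        filter_upwards [Ioi_mem_nhds ht] with s hs
        exact Real.smoothTransition.one_of_one_le (le_of_lt hs)
      rw [this.deriv_eq, deriv_const]
  have hc : Continuous (deriv Real.smoothTransition) :=
    Real.smoothTransition.contDiff (n := 1).continuous_deriv le_rfl
  obtain ⟨L, hL⟩ := (isCompact_Icc (a := (0 : ℝ)) (b := 1)).exists_bound_of_continuousOn
    hc.continuousOn
  refine ⟨max L 1, by positivity, fun t => ?_, hz⟩
  by_cases ht : t ∈ Icc (0 : ℝ) 1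
  · exact (hL t ht).trans (le_max_left _ _)
  · rw [hz t ht, abs_zero]; positivity

lemma le_of_uniform {E : Euc N → ℝ} (hE : Continuous E) {r : ℝ} (hr : r ∈ Icc (1 : ℝ) 2) {e : ℝ}
    (he : 0 < e) : ∃ δ : ℝ, 0 < δ ∧ δ ≤ 1 ∧ ∀ ρ ∈ Icc r (r + δ / 2),
      ∀ θ : sphere (0 : Euc N) 1, E (ρ • (θ : Euc N)) ≤ E (r • (θ : Euc N)) + e := by
  have huc := (isCompact_closedBall (0 : Euc N) 3).uniformContinuousOn_of_continuous
    hE.continuousOn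
  rw [Metric.uniformContinuousOn_iff] at huc
  obtain ⟨η, hη, h⟩ := huc e he
  refine ⟨min η 1, by positivity, min_le_right _ _, fun ρ hρ θ => ?_⟩
  have hn : ‖(θ : Euc N)‖ = 1 := by simp
  have h1 : min η 1 ≤ η := min_le_left _ _
  have h2 : min η 1 ≤ 1 := min_le_right _ _
  have h3 : 0 < min η 1 := by positivity
  have := h (ρ • (θ : Euc N)) ?_ (r • (θ : Euc N)) ?_ ?_
  · rw [Real.dist_eq] at this
    linarith [le_abs_self (E (ρ • (θ : Euc N)) - E (r • (θ : Euc N)))]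
  · rw [mem_closedBall_zero_iff, norm_smul, hn, Real.norm_eq_abs,
      abs_of_pos (by linarith [hρ.1, hr.1])]
    linarith [hρ.2, hr.2]
  · rw [mem_closedBall_zero_iff, norm_smul, hn, Real.norm_eq_abs,
      abs_of_pos (by linarith [hr.1])]
    linarith [hr.2]
  · rw [dist_eq_norm, ← sub_smul, norm_smul, hn, Real.norm_eq_abs,
      abs_of_nonneg (by linarith [hρ.1])]
    linarith [hρ.2]

/-- The divergence theorem on balls in the form of an inequality. -/
lemma flux_le (hN : 3 ≤ N) : ∃ C : ENNReal, C ≠ ⊤ ∧ ∀ (Z : Fin N → Euc N → ℝ) (G E : Euc N → ℝ),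
    (∀ i, ContDiff ℝ 1 (Z i)) → Continuous G → (∀ x, 0 ≤ G x) → Continuous E →
    (∀ x ∈ closedBall (0 : Euc N) 3, |∑ i, x i * Z i x| ≤ E x) →
    (∀ x ∈ closedBall (0 : Euc N) 3, G x ≤ ∑ i, pd i (Z i) x) → ∀ r ∈ Icc (1 : ℝ) 2,
    ∫⁻ x in closedBall 0 1, ENNReal.ofReal (G x) ≤
      C * ∫⁻ θ, ENNReal.ofReal (E (r • (θ : Euc N))) ∂(sig N) := by
  obtain ⟨L, hL, hLb, hL0⟩ := exists_deriv_smoothTransition_bound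
  refine ⟨ENNReal.ofReal (3 ^ (N - 1) * L), ENNReal.ofReal_ne_top,
    fun Z G E hZ hG hG0 hE hZE hGZ r hr => ?_⟩
  set M := ∫⁻ θ, ENNReal.ofReal (E (r • (θ : Euc N))) ∂(sig N)
  have key : ∀ e : ℝ, 0 < e → ∫⁻ x in closedBall 0 1, ENNReal.ofReal (G x) ≤
      ENNReal.ofReal (3 ^ (N - 1) * L) * (M + ENNReal.ofReal e * sig N univ) := by
    intro e he
    obtain ⟨δ, hδ, hδ1, hEδ⟩ := le_of_uniform hE hr he
    set η : Euc N → ℝ := fun x =>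
      Real.smoothTransition (1 - δ⁻¹ * (‖x - 0‖ ^ 2 - r ^ 2)) with hη
    have hηc : ContDiff ℝ 1 η := Real.smoothTransition.contDiff.comp
      (contDiff_const.sub (contDiff_const.mul ((contDiff_norm_sub_sq 0).sub contDiff_const)))
    have hη1 : ∀ x, ‖x‖ ≤ 1 → η x = 1 := by
      intro x hx
      refine Real.smoothTransition.one_of_one_le ?_
      have : 0 ≤ δ⁻¹ * (r ^ 2 - ‖x - 0‖ ^ 2) := by
        rw [sub_zero]
        refine mul_nonneg (by positivity) ?_
        nlinarith [norm_nonneg x, hr.1]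
      linarith
    have hη0 : ∀ x, r + δ / 2 ≤ ‖x‖ → η x = 0 := by
      intro x hx
      refine Real.smoothTransition.zero_of_nonpos ?_
      have h1 : δ ≤ ‖x - 0‖ ^ 2 - r ^ 2 := by
        rw [sub_zero]; nlinarith [hr.1]
      have : δ⁻¹ * δ ≤ δ⁻¹ * (‖x - 0‖ ^ 2 - r ^ 2) := by gcongr
      rw [inv_mul_cancel₀ hδ.ne'] at this
      linarith
    have hηs : HasCompactSupport η := hasCompactSupport_of_ball _ hη0
    have hηn : ∀ x, 0 ≤ η x := fun x => Real.smoothTransition.nonneg _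
    have hball : ∀ x : Euc N, ‖x‖ ≤ r + δ / 2 → x ∈ closedBall (0 : Euc N) 3 := by
      intro x hx
      rw [mem_closedBall_zero_iff]; linarith [hr.2]
    have hpd : ∀ i x, pd i η x = -(2 * δ⁻¹) *
        deriv Real.smoothTransition (1 - δ⁻¹ * (‖x - 0‖ ^ 2 - r ^ 2)) * x i := by
      intro i x
      have h1 : HasDerivAt (fun t => Real.smoothTransition (1 - δ⁻¹ * (t - r ^ 2)))
          (deriv Real.smoothTransition (1 - δ⁻¹ * (‖x - 0‖ ^ 2 - r ^ 2)) * (-δ⁻¹))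
          (‖x - 0‖ ^ 2) := by
        refine HasDerivAt.comp (h := fun t => 1 - δ⁻¹ * (t - r ^ 2)) _
          (Real.smoothTransition.contDiff (n := 1).differentiable
          (by norm_num) _).hasDerivAt ?_
        have := (((hasDerivAt_id (‖x - 0‖ ^ 2)).sub_const (r ^ 2)).const_mul δ⁻¹).const_sub 1
        simpa using this
      have h2 := pd_comp (f := fun y => ‖y - 0‖ ^ 2)
        ((contDiff_norm_sub_sq (n := 1) (0 : Euc N)).differentiable (by norm_num) x) h1 i
      rw [pd_norm_sq] at h2
      rw [hη, h2]
      simp; ring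
    have hcZ : ∀ i, Continuous (pd i (Z i)) := fun i => continuous_pd (hZ i) i
    have hI : ∫ x in closedBall 0 1, G x ≤ ∫ x, ∑ i, -(Z i x * pd i η x) := by
      calc ∫ x in closedBall 0 1, G x ≤ ∫ x, (∑ i, pd i (Z i) x) * η x := by
            rw [← integral_indicator measurableSet_closedBall]
            refine integral_mono ((integrableOn_ball hG 1).integrable_indicator
              measurableSet_closedBall) ?_ fun x => ?_
            · exact ((continuous_finsetSum _ fun i _ => hcZ i).mul
                hηc.continuous).integrable_of_hasCompactSupport hηs.mul_left
            · have h0 : 0 ≤ (∑ i, pd i (Z i) x) * η x := by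
                rcases le_or_gt ‖x‖ (r + δ / 2) with hx | hx
                · exact mul_nonneg ((hG0 x).trans (hGZ x (hball x hx))) (hηn x)
                · rw [hη0 x hx.le, mul_zero]
              refine indicator_apply_le' (fun hx => ?_) fun _ => h0
              rw [mem_closedBall_zero_iff] at hx
              rw [hη1 x hx, mul_one]
              exact hGZ x (hball x (by linarith [hr.1]))
        _ = ∑ i, ∫ x, pd i (Z i) x * η x := by
            simp_rw [Finset.sum_mul]
            exact integral_finsetSum _ fun i _ => ((hcZ i).mul
              hηc.continuous).integrable_of_hasCompactSupport hηs.mul_left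
        _ = ∑ i, ∫ x, -(Z i x * pd i η x) := by
            refine Finset.sum_congr rfl fun i _ => ?_
            rw [integral_neg, integral_mul_pd (hZ i) hηc hηs i, neg_neg]
        _ = _ := by
            refine (integral_finsetSum _ fun i _ => ?_).symm
            exact ((hZ i).continuous.mul (continuous_pd hηc i)).neg.integrable_of_hasCompactSupport
              (hasCompactSupport_pd hηs i).mul_left.neg
    set F : Euc N → ENNReal := (closedBall (0 : Euc N) (r + δ / 2) \ ball 0 r).indicator
      fun x => ENNReal.ofReal (2 * δ⁻¹ * L * E x) with hF
    have hFm : Measurable F := by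
      refine Measurable.indicator ?_ (measurableSet_closedBall.diff measurableSet_ball)
      exact (continuous_const.mul hE).measurable.ennreal_ofReal
    have hbd : ∀ x, ‖∑ i, -(Z i x * pd i η x)‖ₑ ≤ F x := by
      intro x
      have e1 : ∑ i, -(Z i x * pd i η x) = 2 * δ⁻¹ *
          deriv Real.smoothTransition (1 - δ⁻¹ * (‖x - 0‖ ^ 2 - r ^ 2)) * ∑ i, x i * Z i x := by
        rw [Finset.mul_sum]
        refine Finset.sum_congr rfl fun i _ => ?_
        rw [hpd]; ring
      rw [e1, hF]
      by_cases hx : x ∈ closedBall (0 : Euc N) (r + δ / 2) \ ball 0 r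
      · rw [indicator_of_mem hx, Real.enorm_eq_ofReal_abs, abs_mul, abs_mul,
          abs_of_pos (show 0 < 2 * δ⁻¹ by positivity)]
        refine ENNReal.ofReal_le_ofReal ?_
        rw [Set.mem_sdiff, mem_closedBall_zero_iff] at hx
        have := hLb (1 - δ⁻¹ * (‖x - 0‖ ^ 2 - r ^ 2))
        have := hZE x (hball x hx.1)
        gcongr
      · rw [indicator_of_notMem hx, hL0, mul_zero, zero_mul, enorm_zero]
        intro h
        apply hx
        rw [Set.mem_sdiff, mem_closedBall_zero_iff, mem_ball_zero_iff, not_lt]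
        have h1 : 0 ≤ δ⁻¹ * (‖x - 0‖ ^ 2 - r ^ 2) := by linarith [h.2]
        have h2 : δ⁻¹ * (‖x - 0‖ ^ 2 - r ^ 2) ≤ 1 := by linarith [h.1]
        rw [sub_zero] at h1 h2
        rw [inv_mul_le_iff₀ hδ] at h2
        have h3 : 0 ≤ ‖x‖ ^ 2 - r ^ 2 := nonneg_of_mul_nonneg_right h1 (by positivity)
        have := norm_nonneg x
        exact ⟨by nlinarith [hr.1], by nlinarith [hr.1]⟩
    calc ∫⁻ x in closedBall 0 1, ENNReal.ofReal (G x)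
        = ENNReal.ofReal (∫ x in closedBall 0 1, G x) :=
          (ofReal_integral_eq_lintegral_ofReal (integrableOn_ball hG 1)
            (ae_of_all _ fun x => hG0 x)).symm
      _ ≤ ENNReal.ofReal (∫ x, ∑ i, -(Z i x * pd i η x)) := ENNReal.ofReal_le_ofReal hI
      _ ≤ ‖∫ x, ∑ i, -(Z i x * pd i η x)‖ₑ := Real.ofReal_le_enorm _
      _ ≤ ∫⁻ x, ‖∑ i, -(Z i x * pd i η x)‖ₑ := enorm_integral_le_lintegral_enorm _
      _ ≤ ∫⁻ x, F x := lintegral_mono hbd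
      _ ≤ ∫⁻ ρ in Icc r (r + δ / 2), ENNReal.ofReal (3 ^ (N - 1)) *
          (ENNReal.ofReal (2 * δ⁻¹ * L) * (M + ENNReal.ofReal e * sig N univ)) := by
          rw [lintegral_polar_swap hN hFm, ← lintegral_indicator measurableSet_Icc,
            ← lintegral_indicator measurableSet_Ioi]
          refine lintegral_mono fun ρ => ?_
          refine indicator_apply_le' (fun hρ => ?_) fun _ => zero_le
          have hn : ∀ θ : sphere (0 : Euc N) 1, ‖ρ • (θ : Euc N)‖ = ρ := by
            intro θ
            rw [norm_smul, Real.norm_eq_abs, abs_of_pos hρ]; simp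
          by_cases hρ2 : ρ ∈ Icc r (r + δ / 2)
          · rw [indicator_of_mem hρ2]
            refine mul_le_mul' (ENNReal.ofReal_le_ofReal ?_) ?_
            · exact pow_le_pow_left₀ (le_of_lt hρ) (by linarith [hρ2.2, hr.2]) _
            · have h1 : ∀ θ : sphere (0 : Euc N) 1, F (ρ • (θ : Euc N)) ≤
                  ENNReal.ofReal (2 * δ⁻¹ * L) *
                  (ENNReal.ofReal (E (r • (θ : Euc N))) + ENNReal.ofReal e) := by
                intro θ
                refine (indicator_le_self _ _ _).trans ?_
                rw [ENNReal.ofReal_mul (by positivity)]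
                refine mul_le_mul_right ?_ _
                exact (ENNReal.ofReal_le_ofReal (hEδ ρ hρ2 θ)).trans ENNReal.ofReal_add_le
              refine (lintegral_mono h1).trans ?_
              rw [lintegral_const_mul' _ _ ENNReal.ofReal_ne_top,
                lintegral_add_right _ measurable_const, lintegral_const]
          · rw [indicator_of_notMem hρ2]
            have : ∀ θ : sphere (0 : Euc N) 1, F (ρ • (θ : Euc N)) = 0 := by
              intro θ
              refine indicator_of_notMem (fun h => hρ2 ?_) _
              rw [Set.mem_sdiff, mem_closedBall_zero_iff, mem_ball_zero_iff, hn, not_lt] at h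
              exact ⟨h.2, h.1⟩
            simp [this]
      _ = _ := by
          rw [setLIntegral_const, Real.volume_Icc, mul_comm, ← mul_assoc, ← mul_assoc,
            ← ENNReal.ofReal_mul (by linarith), ← ENNReal.ofReal_mul (by
              rw [add_sub_cancel_left]; positivity)]
          congr 2
          field_simp; ring
  have ht : Tendsto (fun e : ℝ => ENNReal.ofReal (3 ^ (N - 1) * L) *
      (M + ENNReal.ofReal e * sig N univ)) (nhdsWithin 0 (Ioi 0))
      (nhds (ENNReal.ofReal (3 ^ (N - 1) * L) * (M + ENNReal.ofReal 0 * sig N univ))) := by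
    refine ENNReal.Tendsto.const_mul ?_ (Or.inr ENNReal.ofReal_ne_top)
    refine tendsto_const_nhds.add (ENNReal.Tendsto.mul_const ?_ (Or.inr (measure_ne_top _ _)))
    exact (ENNReal.continuous_ofReal.tendsto 0).mono_left nhdsWithin_le_nhds
  have := ge_of_tendsto ht (eventually_nhdsWithin_of_forall key)
  simpa using this

/-- The `ℓ¹` norm of the gradient. -/
noncomputable def gn (U : Euc N → ℝ) (x : Euc N) : ℝ := ∑ i, |pd i U x|

lemma gn_nonneg (U : Euc N → ℝ) (x : Euc N) : 0 ≤ gn U x :=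
  Finset.sum_nonneg fun _ _ => abs_nonneg _

lemma continuous_gn {U : Euc N → ℝ} (hU : ContDiff ℝ 1 U) : Continuous (gn U) :=
  continuous_finsetSum _ fun i _ => (continuous_pd hU i).abs

/-- The potential energy density of a system. -/
noncomputable def pot (p q : ℝ) (U V : Euc N → ℝ) (x : Euc N) : ℝ :=
  U x ^ (q + 1) + V x ^ (p + 1)

/-- The radial derivative `x · ∇U`. -/
noncomputable def rd (U : Euc N → ℝ) (x : Euc N) : ℝ := ∑ j, x j * pd j U x

/-- The inner product of two gradients. -/
noncomputable def gip (U V : Euc N → ℝ) (x : Euc N) : ℝ := ∑ j, pd j U x * pd j V x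

lemma contDiff_coord (i : Fin N) {n : WithTop ℕ∞} : ContDiff ℝ n (fun y : Euc N => y i) :=
  (EuclideanSpace.proj (𝕜 := ℝ) i).contDiff

lemma contDiff_rd {U : Euc N → ℝ} (hU : ContDiff ℝ 2 U) : ContDiff ℝ 1 (rd U) :=
  ContDiff.sum fun j _ => (contDiff_coord j).mul (contDiff_pd_one hU j)

lemma contDiff_gip {U V : Euc N → ℝ} (hU : ContDiff ℝ 2 U) (hV : ContDiff ℝ 2 V) :
    ContDiff ℝ 1 (gip U V) :=
  ContDiff.sum fun j _ => (contDiff_pd_one hU j).mul (contDiff_pd_one hV j)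

lemma contDiff_rpow_add_one {U : Euc N → ℝ} (hU : ContDiff ℝ 1 U) {q : ℝ} (hq : 0 < q) :
    ContDiff ℝ 1 (fun x => U x ^ (q + 1)) :=
  hU.rpow_const_of_le (m := 1) (by simpa using hq.le)

lemma pd_rd {U : Euc N → ℝ} (hU : ContDiff ℝ 2 U) (i : Fin N) (x : Euc N) :
    pd i (rd U) x = pd i U x + ∑ j, x j * pd i (pd j U) x := by
  have h1 : ∀ j : Fin N, DifferentiableAt ℝ (fun y : Euc N => y j) x :=
    fun j => (contDiff_coord j (n := 1)).differentiable (by norm_num) x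
  have h2 : ∀ j : Fin N, DifferentiableAt ℝ (pd j U) x :=
    fun j => (contDiff_pd_one hU j).differentiable (by norm_num) x
  have := pd_sum (s := Finset.univ) (f := fun j y => y j * pd j U y) (x := x)
    (fun j _ => (h1 j).mul (h2 j)) i
  unfold rd
  rw [this]
  have h3 : ∀ j : Fin N, pd i (fun y => y j * pd j U y) x =
      x j * pd i (pd j U) x + (if j = i then 1 else 0) * pd j U x := by
    intro j
    rw [pd_mul (h1 j) (h2 j), pd_coord]
  simp only [h3, Finset.sum_add_distrib, ite_mul, one_mul, zero_mul, Finset.sum_ite_eq',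
    Finset.mem_univ, if_true]
  ring

lemma pd_gip {U V : Euc N → ℝ} (hU : ContDiff ℝ 2 U) (hV : ContDiff ℝ 2 V) (i : Fin N)
    (x : Euc N) : pd i (gip U V) x =
      ∑ j, (pd j U x * pd i (pd j V) x + pd i (pd j U) x * pd j V x) := by
  have h1 : ∀ j : Fin N, DifferentiableAt ℝ (pd j U) x :=
    fun j => (contDiff_pd_one hU j).differentiable (by norm_num) x
  have h2 : ∀ j : Fin N, DifferentiableAt ℝ (pd j V) x :=
    fun j => (contDiff_pd_one hV j).differentiable (by norm_num) x
  have := pd_sum (s := Finset.univ) (f := fun j y => pd j U y * pd j V y) (x := x)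
    (fun j _ => (h1 j).mul (h2 j)) i
  unfold gip
  rw [this]
  exact Finset.sum_congr rfl fun j _ => pd_mul (h1 j) (h2 j) i

lemma pd_mul_rpow {U d : Euc N → ℝ} (hU : ContDiff ℝ 2 U) (hd : ContDiff ℝ 1 d) {q : ℝ}
    (hq : 0 < q) (i : Fin N) (x : Euc N) :
    pd i (fun y => d y * U y ^ (q + 1)) x =
      d x * ((q + 1) * U x ^ q * pd i U x) + pd i d x * U x ^ (q + 1) := by
  have h1 : DifferentiableAt ℝ U x := hU.differentiable (by norm_num) x
  have h2 : HasDerivAt (fun t : ℝ => t ^ (q + 1)) ((q + 1) * U x ^ q) (U x) := by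
    have := Real.hasDerivAt_rpow_const (x := U x) (p := q + 1) (Or.inr (by linarith))
    rwa [add_sub_cancel_right] at this
  rw [pd_mul (hd.differentiable (by norm_num) x)
    ((contDiff_rpow_add_one (hU.of_le (by norm_num)) hq).differentiable (by norm_num) x),
    pd_comp h1 h2]

/-- The Pohozaev vector field. -/
noncomputable def poh (p q a1 a2 : ℝ) (U V c d : Euc N → ℝ) (i : Fin N) (x : Euc N) : ℝ :=
  x i * ((q + 1)⁻¹ * (d x * U x ^ (q + 1)) + (p + 1)⁻¹ * (c x * V x ^ (p + 1)) - gip U V x) +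
    (rd U x + a2 * U x) * pd i V x + (rd V x + a1 * V x) * pd i U x

lemma contDiff_poh {p q a1 a2 : ℝ} (hp : 0 < p) (hq : 0 < q) {U V c d : Euc N → ℝ}
    (hU : ContDiff ℝ 2 U) (hV : ContDiff ℝ 2 V) (hc : ContDiff ℝ 1 c) (hd : ContDiff ℝ 1 d)
    (i : Fin N) : ContDiff ℝ 1 (poh p q a1 a2 U V c d i) := by
  have hU1 : ContDiff ℝ 1 U := hU.of_le (by norm_num)
  have hV1 : ContDiff ℝ 1 V := hV.of_le (by norm_num)
  exact (((contDiff_coord i).mul (((contDiff_const.mul (hd.mul (contDiff_rpow_add_one hU1 hq))).add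
    (contDiff_const.mul (hc.mul (contDiff_rpow_add_one hV1 hp)))).sub (contDiff_gip hU hV))).add
    (((contDiff_rd hU).add (contDiff_const.mul hU1)).mul (contDiff_pd_one hV i))).add
    (((contDiff_rd hV).add (contDiff_const.mul hV1)).mul (contDiff_pd_one hU i))

lemma pd_poh {p q a1 a2 : ℝ} (hp : 0 < p) (hq : 0 < q) {U V c d : Euc N → ℝ}
    (hU : ContDiff ℝ 2 U) (hV : ContDiff ℝ 2 V) (hc : ContDiff ℝ 1 c) (hd : ContDiff ℝ 1 d)
    (i : Fin N) (x : Euc N) : pd i (poh p q a1 a2 U V c d i) x =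
    x i * ((q + 1)⁻¹ * (d x * ((q + 1) * U x ^ q * pd i U x) + pd i d x * U x ^ (q + 1)) +
      (p + 1)⁻¹ * (c x * ((p + 1) * V x ^ p * pd i V x) + pd i c x * V x ^ (p + 1)) -
      ∑ j, (pd j U x * pd i (pd j V) x + pd i (pd j U) x * pd j V x)) +
    ((q + 1)⁻¹ * (d x * U x ^ (q + 1)) + (p + 1)⁻¹ * (c x * V x ^ (p + 1)) - gip U V x) +
    ((rd U x + a2 * U x) * pd i (pd i V) x +
      (pd i U x + ∑ j, x j * pd i (pd j U) x + a2 * pd i U x) * pd i V x) +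
    ((rd V x + a1 * V x) * pd i (pd i U) x +
      (pd i V x + ∑ j, x j * pd i (pd j V) x + a1 * pd i V x) * pd i U x) := by
  have hU1 : ContDiff ℝ 1 U := hU.of_le (by norm_num)
  have hV1 : ContDiff ℝ 1 V := hV.of_le (by norm_num)
  have D : ∀ {f : Euc N → ℝ}, ContDiff ℝ 1 f → DifferentiableAt ℝ f x :=
    fun hf => hf.differentiable (by norm_num) x
  have c1 := hd.mul (contDiff_rpow_add_one hU1 hq)
  have c2 := hc.mul (contDiff_rpow_add_one hV1 hp)
  have c1' : ContDiff ℝ 1 fun y => (q + 1)⁻¹ * (d y * U y ^ (q + 1)) := contDiff_const.mul c1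
  have c2' : ContDiff ℝ 1 fun y => (p + 1)⁻¹ * (c y * V y ^ (p + 1)) := contDiff_const.mul c2
  have c3 := contDiff_gip hU hV
  have c4 : ContDiff ℝ 1 fun y => a2 * U y := contDiff_const.mul hU1
  have c5 : ContDiff ℝ 1 fun y => a1 * V y := contDiff_const.mul hV1
  have c6 := contDiff_rd hU
  have c7 := contDiff_rd hV
  have c8 := contDiff_pd_one hU i
  have c9 := contDiff_pd_one hV i
  have c0 : ContDiff ℝ 1 (fun y : Euc N => y i) := contDiff_coord i
  unfold poh
  rw [pd_add (D ((c0.mul ((c1'.add c2').sub c3)).add ((c6.add c4).mul c9)))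
      (D ((c7.add c5).mul c8)),
    pd_add (D (c0.mul ((c1'.add c2').sub c3))) (D ((c6.add c4).mul c9)),
    pd_mul (D c0) (D ((c1'.add c2').sub c3)), pd_mul (D (c6.add c4)) (D c9),
    pd_mul (D (c7.add c5)) (D c8), pd_sub (D (c1'.add c2')) (D c3), pd_add (D c1') (D c2'),
    pd_add (D c6) (D c4), pd_add (D c7) (D c5), pd_const_mul _ (D c1), pd_const_mul _ (D c2),
    pd_const_mul _ (D hU1), pd_const_mul _ (D hV1), pd_mul_rpow hU hd hq, pd_mul_rpow hV hc hp,
    pd_rd hU, pd_rd hV, pd_gip hU hV, pd_coord, if_pos rfl, one_mul]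

lemma div_poh {p q a1 a2 : ℝ} (hp : 0 < p) (hq : 0 < q) {U V c d : Euc N → ℝ}
    (hU : ContDiff ℝ 2 U) (hV : ContDiff ℝ 2 V) (hc : ContDiff ℝ 1 c) (hd : ContDiff ℝ 1 d)
    (ha : a1 + a2 = N - 2) {x : Euc N} (hUx : 0 < U x) (hVx : 0 < V x)
    (eU : -lap U x = c x * V x ^ p) (eV : -lap V x = d x * U x ^ q) :
    ∑ i, pd i (poh p q a1 a2 U V c d i) x =
      (N / (q + 1) - a2) * (d x * U x ^ (q + 1)) + (N / (p + 1) - a1) * (c x * V x ^ (p + 1)) +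
      (q + 1)⁻¹ * (∑ i, x i * pd i d x) * U x ^ (q + 1) +
      (p + 1)⁻¹ * (∑ i, x i * pd i c x) * V x ^ (p + 1) := by
  have hq1 : q + 1 ≠ 0 := by positivity
  have hp1 : p + 1 ≠ 0 := by positivity
  simp only [pd_poh hp hq hU hV hc hd]
  set g := (q + 1)⁻¹ * (d x * U x ^ (q + 1)) + (p + 1)⁻¹ * (c x * V x ^ (p + 1)) with hg
  have hess : ∀ {W W' : Euc N → ℝ}, ContDiff ℝ 2 W →
      ∑ i, (∑ j, x j * pd i (pd j W) x) * pd i W' x =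
        ∑ i, x i * ∑ j, pd i (pd j W) x * pd j W' x := by
    intro W W' hW
    simp_rw [Finset.sum_mul, Finset.mul_sum]
    rw [Finset.sum_comm]
    refine Finset.sum_congr rfl fun i _ => Finset.sum_congr rfl fun j _ => ?_
    rw [pd_comm hW.contDiffAt j i]; ring
  have hUH := hess (W' := V) hU
  have hVH := hess (W' := U) hV
  have e1 : ∀ i, x i * ((q + 1)⁻¹ * (d x * ((q + 1) * U x ^ q * pd i U x) +
      pd i d x * U x ^ (q + 1)) +
      (p + 1)⁻¹ * (c x * ((p + 1) * V x ^ p * pd i V x) + pd i c x * V x ^ (p + 1)) -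
      ∑ j, (pd j U x * pd i (pd j V) x + pd i (pd j U) x * pd j V x)) + (g - gip U V x) +
    ((rd U x + a2 * U x) * pd i (pd i V) x +
      (pd i U x + ∑ j, x j * pd i (pd j U) x + a2 * pd i U x) * pd i V x) +
    ((rd V x + a1 * V x) * pd i (pd i U) x +
      (pd i V x + ∑ j, x j * pd i (pd j V) x + a1 * pd i V x) * pd i U x) =
      d x * U x ^ q * (x i * pd i U x) + c x * V x ^ p * (x i * pd i V x) +
      (q + 1)⁻¹ * U x ^ (q + 1) * (x i * pd i d x) + (p + 1)⁻¹ * V x ^ (p + 1) * (x i * pd i c x) -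
      x i * (∑ j, pd i (pd j V) x * pd j U x) - x i * (∑ j, pd i (pd j U) x * pd j V x) +
      (g - gip U V x) + (rd U x + a2 * U x) * pd i (pd i V) x +
      (rd V x + a1 * V x) * pd i (pd i U) x + (2 + a1 + a2) * (pd i U x * pd i V x) +
      (∑ j, x j * pd i (pd j U) x) * pd i V x + (∑ j, x j * pd i (pd j V) x) * pd i U x := by
    intro i
    have h1 : ∑ j, (pd j U x * pd i (pd j V) x + pd i (pd j U) x * pd j V x) =
        ∑ j, pd i (pd j V) x * pd j U x + ∑ j, pd i (pd j U) x * pd j V x := by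
      rw [← Finset.sum_add_distrib]
      exact Finset.sum_congr rfl fun j _ => by ring
    rw [h1]
    field_simp
    ring
  rw [Finset.sum_congr rfl fun i _ => e1 i]
  simp only [Finset.sum_add_distrib, Finset.sum_sub_distrib, ← Finset.mul_sum]
  rw [hUH, hVH, ← lap_eq_sum_pd hU.contDiffAt, ← lap_eq_sum_pd hV.contDiffAt]
  have f1 : ∑ i, x i * pd i U x = rd U x := rfl
  have f2 : ∑ i, x i * pd i V x = rd V x := rfl
  have f3 : ∑ i, pd i U x * pd i V x = gip U V x := rfl
  rw [f1, f2, f3]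
  simp only [Finset.sum_const, Finset.card_univ, Fintype.card_fin, nsmul_eq_mul]
  have p1 : U x ^ (q + 1) = U x ^ q * U x := Real.rpow_add_one hUx.ne' q
  have p2 : V x ^ (p + 1) = V x ^ p * V x := Real.rpow_add_one hVx.ne' p
  have eU' : lap U x = -(c x * V x ^ p) := by linarith
  have eV' : lap V x = -(d x * U x ^ q) := by linarith
  have ha' : a1 = N - 2 - a2 := by linarith
  rw [eU', eV', hg, p1, p2, ha']
  field_simp
  ring

/-- The boundary energy density. -/
noncomputable def en (p q : ℝ) (U V : Euc N → ℝ) (x : Euc N) : ℝ :=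
  pot p q U V x + (gn U x + U x) * (gn V x + V x)

lemma abs_coord_le (x : Euc N) (i : Fin N) : |x i| ≤ ‖x‖ := by
  simpa using PiLp.norm_apply_le x i

lemma abs_rd_le (U : Euc N → ℝ) (x : Euc N) : |rd U x| ≤ ‖x‖ * gn U x := by
  refine (Finset.abs_sum_le_sum_abs _ _).trans ?_
  rw [gn, Finset.mul_sum]
  refine Finset.sum_le_sum fun i _ => ?_
  rw [abs_mul]
  exact mul_le_mul_of_nonneg_right (abs_coord_le x i) (abs_nonneg _)

lemma abs_gip_le (U V : Euc N → ℝ) (x : Euc N) : |gip U V x| ≤ gn U x * gn V x := by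
  refine (Finset.abs_sum_le_sum_abs _ _).trans ?_
  rw [gn, Finset.sum_mul]
  refine Finset.sum_le_sum fun i _ => ?_
  rw [abs_mul]
  refine mul_le_mul_of_nonneg_left ?_ (abs_nonneg _)
  exact Finset.single_le_sum (f := fun i => |pd i V x|) (fun _ _ => abs_nonneg _)
    (Finset.mem_univ i)

lemma abs_flux_le {p q a1 a2 M : ℝ} (hp : 0 < p) (hq : 0 < q) {U V c d : Euc N → ℝ} {x : Euc N}
    (hx : ‖x‖ ≤ 3) (hU : 0 ≤ U x) (hV : 0 ≤ V x) (hc0 : 0 ≤ c x) (hd0 : 0 ≤ d x) (hc : c x ≤ M)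
    (hd : d x ≤ M) : |∑ i, x i * poh p q a1 a2 U V c d i x| ≤
      (9 * M + 27 + 3 * |a1| + 3 * |a2|) * en p q U V x := by
  have e : ∑ i, x i * poh p q a1 a2 U V c d i x =
      ‖x‖ ^ 2 * ((q + 1)⁻¹ * (d x * U x ^ (q + 1)) + (p + 1)⁻¹ * (c x * V x ^ (p + 1))) -
      ‖x‖ ^ 2 * gip U V x + (rd U x + a2 * U x) * rd V x + (rd V x + a1 * V x) * rd U x := by
    have h1 : ‖x‖ ^ 2 = ∑ i, x i ^ 2 := EuclideanSpace.real_norm_sq_eq x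
    rw [h1, ← mul_sub, Finset.sum_mul]
    conv_rhs => rw [rd, rd, Finset.mul_sum, Finset.mul_sum]
    rw [← Finset.sum_add_distrib, ← Finset.sum_add_distrib]
    refine Finset.sum_congr rfl fun i _ => ?_
    rw [poh, rd, rd]; ring
  have hx2 : ‖x‖ ^ 2 ≤ 9 := by nlinarith [norm_nonneg x]
  have hgU := gn_nonneg U x
  have hgV := gn_nonneg V x
  have hrU : |rd U x| ≤ 3 * gn U x := (abs_rd_le U x).trans (by gcongr)
  have hrV : |rd V x| ≤ 3 * gn V x := (abs_rd_le V x).trans (by gcongr)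
  have hgi := abs_gip_le U V x
  have hUq : 0 ≤ U x ^ (q + 1) := by positivity
  have hVp : 0 ≤ V x ^ (p + 1) := by positivity
  have hM : 0 ≤ M := hc0.trans hc
  have hq1 : (q + 1)⁻¹ ≤ 1 := inv_le_one_of_one_le₀ (by linarith)
  have hp1 : (p + 1)⁻¹ ≤ 1 := inv_le_one_of_one_le₀ (by linarith)
  have b1 : |‖x‖ ^ 2 * ((q + 1)⁻¹ * (d x * U x ^ (q + 1)) + (p + 1)⁻¹ * (c x * V x ^ (p + 1)))| ≤
      9 * (M * pot p q U V x) := by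
    rw [abs_of_nonneg (by positivity), pot, mul_add M]
    have i1 : (q + 1)⁻¹ * (d x * U x ^ (q + 1)) ≤ M * U x ^ (q + 1) := by
      calc (q + 1)⁻¹ * (d x * U x ^ (q + 1)) ≤ 1 * (M * U x ^ (q + 1)) := by gcongr
        _ = _ := one_mul _
    have i2 : (p + 1)⁻¹ * (c x * V x ^ (p + 1)) ≤ M * V x ^ (p + 1) := by
      calc (p + 1)⁻¹ * (c x * V x ^ (p + 1)) ≤ 1 * (M * V x ^ (p + 1)) := by gcongr
        _ = _ := one_mul _
    exact mul_le_mul hx2 (add_le_add i1 i2) (by positivity) (by norm_num)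
  have b2 : |‖x‖ ^ 2 * gip U V x| ≤ 9 * (gn U x * gn V x) := by
    rw [abs_mul, abs_of_nonneg (by positivity : 0 ≤ ‖x‖ ^ 2)]
    gcongr
  have b3 : |(rd U x + a2 * U x) * rd V x| ≤ (3 * gn U x + |a2| * U x) * (3 * gn V x) := by
    rw [abs_mul]
    gcongr
    refine (abs_add_le _ _).trans ?_
    rw [abs_mul, abs_of_nonneg hU]
    gcongr
  have b4 : |(rd V x + a1 * V x) * rd U x| ≤ (3 * gn V x + |a1| * V x) * (3 * gn U x) := by
    rw [abs_mul]
    gcongr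
    refine (abs_add_le _ _).trans ?_
    rw [abs_mul, abs_of_nonneg hV]
    gcongr
  rw [e]
  refine (abs_add_le _ _).trans ((add_le_add ((abs_add_le _ _).trans
    (add_le_add ((abs_sub _ _).trans (add_le_add b1 b2)) b3)) b4).trans ?_)
  have hpot : 0 ≤ pot p q U V x := add_nonneg hUq hVp
  have h1 := abs_nonneg a1
  have h2 := abs_nonneg a2
  have P1 : 0 ≤ gn U x * gn V x := by positivity
  have P2 : 0 ≤ gn U x * V x := by positivity
  have P3 : 0 ≤ U x * gn V x := by positivity
  have P4 : 0 ≤ U x * V x := by positivity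
  have hK : 0 ≤ 27 + 3 * |a1| + 3 * |a2| := by positivity
  have hs : 0 ≤ (27 + 3 * |a1| + 3 * |a2|) * pot p q U V x +
      (9 * M + 3 * |a1| + 3 * |a2|) * (gn U x * gn V x) +
      (9 * M + 27 + 3 * |a2|) * (gn U x * V x) + (9 * M + 27 + 3 * |a1|) * (U x * gn V x) +
      (9 * M + 27 + 3 * |a1| + 3 * |a2|) * (U x * V x) := by positivity
  rw [en]
  linarith

/-- A Pohozaev type inequality: the energy in the unit ball is controlled by the boundary energy
on any sphere of radius in `[1, 2]`. -/
lemma pohozaev (hN : 3 ≤ N) {p q m M : ℝ} (hp : 0 < p) (hq : 0 < q) (hm : 0 < m)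
    (hyp : (N : ℝ) / (p + 1) + (N : ℝ) / (q + 1) > (N : ℝ) - 2) :
    ∃ ε > 0, ∃ C : ENNReal, C ≠ ⊤ ∧ ∀ U V c d : Euc N → ℝ, Sys p q m M ε 20 U V c d →
      ∀ r ∈ Icc (1 : ℝ) 2, ∫⁻ x in closedBall 0 1, ENNReal.ofReal (pot p q U V x) ≤
        C * ∫⁻ θ, ENNReal.ofReal (en p q U V (r • (θ : Euc N))) ∂(sig N) := by
  obtain ⟨C, hC, h⟩ := flux_le hN
  set k := ((N : ℝ) / (p + 1) + (N : ℝ) / (q + 1) - (N - 2)) / 2 with hk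
  have hk0 : 0 < k := by rw [hk]; linarith
  set a1 := (N : ℝ) / (p + 1) - k with ha1
  set a2 := (N : ℝ) / (q + 1) - k with ha2
  have ha : a1 + a2 = N - 2 := by rw [ha1, ha2, hk]; ring
  set K := 9 * M + 27 + 3 * |a1| + 3 * |a2|
  refine ⟨k * m / 2, by positivity, ENNReal.ofReal (k * m / 2)⁻¹ * (C * ENNReal.ofReal K),
    by finiteness, fun U V c d hS r hr => ?_⟩
  have hb : ∀ x ∈ closedBall (0 : Euc N) 3, x ∈ ball (0 : Euc N) 20 :=
    fun x hx => closedBall_subset_ball (by norm_num) hx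
  have hU1 : ContDiff ℝ 1 U := hS.contU.of_le (by norm_num)
  have hV1 : ContDiff ℝ 1 V := hS.contV.of_le (by norm_num)
  have hpotc : Continuous (pot p q U V) :=
    (contDiff_rpow_add_one hU1 hq).continuous.add (contDiff_rpow_add_one hV1 hp).continuous
  have hpot0 : ∀ x, 0 ≤ pot p q U V x := fun x =>
    add_nonneg (Real.rpow_nonneg (hS.U_nonneg x) _) (Real.rpow_nonneg (hS.V_nonneg x) _)
  have henc : Continuous (en p q U V) := hpotc.add
    (((continuous_gn hU1).add hU1.continuous).mul ((continuous_gn hV1).add hV1.continuous))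
  have hM : 0 ≤ M := hm.le.trans ((hS.c_ge 0 (by simp)).trans (hS.c_le 0 (by simp)))
  have hK : 0 ≤ K := by simp only [K]; positivity
  have key := h (poh p q a1 a2 U V c d) (fun x => k * m / 2 * pot p q U V x)
    (fun x => K * en p q U V x)
    (fun i => contDiff_poh hp hq hS.contU hS.contV hS.contc hS.contd i)
    (continuous_const.mul hpotc) (fun x => mul_nonneg (by positivity) (hpot0 x))
    (continuous_const.mul henc) (fun x hx => ?_) (fun x hx => ?_) r hr
  · have e1 : ∀ x, ENNReal.ofReal (k * m / 2 * pot p q U V x) =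
        ENNReal.ofReal (k * m / 2) * ENNReal.ofReal (pot p q U V x) :=
      fun x => ENNReal.ofReal_mul (by positivity)
    have e2 : ∀ x, ENNReal.ofReal (K * en p q U V x) =
        ENNReal.ofReal K * ENNReal.ofReal (en p q U V x) := fun x => ENNReal.ofReal_mul hK
    simp only [e1, e2] at key
    rw [lintegral_const_mul' _ _ ENNReal.ofReal_ne_top,
      lintegral_const_mul' _ _ ENNReal.ofReal_ne_top] at key
    have := mul_le_mul_right key (ENNReal.ofReal (k * m / 2)⁻¹)
    rw [← mul_assoc, ← ENNReal.ofReal_mul (by positivity), inv_mul_cancel₀ (by positivity),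
      ENNReal.ofReal_one, one_mul] at this
    rwa [mul_assoc, mul_assoc]
  · have hx' := hb x hx
    rw [mem_closedBall_zero_iff] at hx
    exact abs_flux_le hp hq hx (hS.U_nonneg x) (hS.V_nonneg x) (hm.le.trans (hS.c_ge x hx'))
      (hm.le.trans (hS.d_ge x hx')) (hS.c_le x hx') (hS.d_le x hx')
  · have hx' := hb x hx
    rw [div_poh hp hq hS.contU hS.contV hS.contc hS.contd ha (hS.U_pos x hx') (hS.V_pos x hx')
      (hS.eqU x hx') (hS.eqV x hx')]
    have hUq : 0 ≤ U x ^ (q + 1) := Real.rpow_nonneg (hS.U_nonneg x) _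
    have hVp : 0 ≤ V x ^ (p + 1) := Real.rpow_nonneg (hS.V_nonneg x) _
    have aux : ∀ {s D t X : ℝ}, 0 < s → |D| ≤ k * m / 2 → m ≤ t → 0 ≤ X →
        k * m / 2 * X ≤ k * (t * X) + (s + 1)⁻¹ * D * X := by
      intro s D t X hs hD ht hX
      have h1 : (s + 1)⁻¹ ≤ 1 := inv_le_one_of_one_le₀ (by linarith)
      have h0 : 0 ≤ (s + 1)⁻¹ := by positivity
      have h2 : -(k * m / 2) ≤ (s + 1)⁻¹ * D := by
        have := abs_le.1 hD
        nlinarith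
      have h3 : k * m * X ≤ k * (t * X) := by rw [mul_assoc]; gcongr
      have h4 := mul_le_mul_of_nonneg_right h2 hX
      linarith
    have f1 := aux hq (hS.d_drift x hx') (hS.d_ge x hx') hUq
    have f2 := aux hp (hS.c_drift x hx') (hS.c_ge x hx') hVp
    have g1 : (N : ℝ) / (q + 1) - a2 = k := by rw [ha2]; ring
    have g2 : (N : ℝ) / (p + 1) - a1 = k := by rw [ha1]; ring
    rw [g1, g2, pot, mul_add]
    linarith

lemma lintegral_interp {X : Type*} [MeasurableSpace X] {μ : Measure X} {F : X → ENNReal}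
    (hF : Measurable F) {a b c w : ℝ} (ha : 0 ≤ a) (hb : 0 ≤ b) (h0 : 0 ≤ w) (h1 : w ≤ 1)
    (hc : c = (1 - w) * a + w * b) :
    ∫⁻ x, F x ^ c ∂μ ≤ (∫⁻ x, F x ^ a ∂μ) ^ (1 - w) * (∫⁻ x, F x ^ b ∂μ) ^ w := by
  refine le_trans (lintegral_mono fun x => ?_) (ENNReal.lintegral_mul_norm_pow_le
    (hF.pow_const a).aemeasurable (hF.pow_const b).aemeasurable (sub_nonneg.2 h1) h0 (by ring))
  rw [← ENNReal.rpow_mul, ← ENNReal.rpow_mul, ← ENNReal.rpow_add_of_nonneg _ _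
    (mul_nonneg ha (sub_nonneg.2 h1)) (mul_nonneg hb h0), hc, mul_comm a, mul_comm b]

lemma exists_good_radius {ι : Type*} [Fintype ι] {A : ι → ℝ → ENNReal} (hA : ∀ i, Measurable (A i))
    {X : ι → ENNReal} (h0 : ∀ i, X i ≠ 0) (ht : ∀ i, X i ≠ ⊤)
    (hX : ∀ i, ∫⁻ r in Icc (1 : ℝ) 2, A i r ≤ X i) :
    ∃ r ∈ Icc (1 : ℝ) 2, ∀ i, A i r ≤ Fintype.card ι * X i := by
  have hv : volume (Icc (1 : ℝ) 2) = 1 := by rw [Real.volume_Icc]; norm_num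
  have hm : Measurable fun r => ∑ i, (X i)⁻¹ * A i r :=
    Finset.measurable_fun_sum _ fun i _ => (hA i).const_mul _
  obtain ⟨r, hr, h⟩ := exists_le_setLAverage (μ := volume) (s := Icc (1 : ℝ) 2)
    (by rw [hv]; exact one_ne_zero) (by rw [hv]; exact ENNReal.one_ne_top) hm.aemeasurable
  refine ⟨r, hr, fun i => ?_⟩
  rw [setLAverage_eq, hv, div_one, lintegral_finsetSum _ fun i _ => (hA i).const_mul _] at h
  have h2 : ∑ i, ∫⁻ r in Icc (1 : ℝ) 2, (X i)⁻¹ * A i r ≤ Fintype.card ι := by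
    refine (Finset.sum_le_sum (g := fun _ => (1 : ENNReal)) fun i _ => ?_).trans (by simp)
    rw [lintegral_const_mul _ (hA i)]
    calc _ ≤ (X i)⁻¹ * X i := mul_le_mul_right (hX i) _
      _ = 1 := ENNReal.inv_mul_cancel (h0 i) (ht i)
  have h3 : (X i)⁻¹ * A i r ≤ Fintype.card ι :=
    (Finset.single_le_sum (f := fun i => (X i)⁻¹ * A i r) (fun _ _ => zero_le)
      (Finset.mem_univ i)).trans (h.trans h2)
  calc A i r = X i * ((X i)⁻¹ * A i r) := by
        rw [← mul_assoc, ENNReal.mul_inv_cancel (h0 i) (ht i), one_mul]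
    _ ≤ X i * Fintype.card ι := mul_le_mul_right h3 _
    _ = _ := mul_comm _ _

lemma measurable_ww_integral {F : Euc N → ENNReal} (hF : Measurable F) (e : ℝ) :
    Measurable fun r => ∫⁻ y in closedBall 0 6, F y * ww e r y := by
  have : Measurable fun x : ℝ × Euc N => F x.2 * ww e x.1 x.2 :=
    (hF.comp measurable_snd).mul (measurable_ww_uncurry e)
  exact this.lintegral_prod_right'

lemma ww_average {e : ℝ} (he : 0 < e) : ∃ C : ENNReal, C ≠ ⊤ ∧ ∀ F : Euc N → ENNReal,
    Measurable F → ∫⁻ r in Icc (1 : ℝ) 2, (∫⁻ y in closedBall 0 6, F y * ww e r y) ≤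
      C * ∫⁻ y in closedBall 0 6, F y := by
  obtain ⟨C, hC, h⟩ := ww_bound (N := N) he
  refine ⟨C, hC, fun F hF => ?_⟩
  have hm : Measurable fun x : ℝ × Euc N => F x.2 * ww e x.1 x.2 :=
    (hF.comp measurable_snd).mul (measurable_ww_uncurry e)
  rw [lintegral_lintegral_swap hm.aemeasurable, ← lintegral_const_mul _ hF]
  refine setLIntegral_mono' measurableSet_closedBall fun y hy => ?_
  have : Measurable fun r => ww e r y := by unfold ww; fun_prop
  rw [lintegral_const_mul _ this, mul_comm]
  exact mul_le_mul_left (h y hy) _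

lemma measurable_sphere_integral {F : Euc N → ENNReal} (hF : Measurable F) :
    Measurable fun r : ℝ => ∫⁻ θ, F (r • (θ : Euc N)) ∂(sig N) := by
  have : Measurable fun x : ℝ × sphere (0 : Euc N) 1 => F (x.1 • (x.2 : Euc N)) :=
    hF.comp (by fun_prop)
  exact this.lintegral_prod_right'

lemma sphere_average (hN : 3 ≤ N) {F : Euc N → ENNReal} (hF : Measurable F) :
    ∫⁻ r in Icc (1 : ℝ) 2, (∫⁻ θ, F (r • (θ : Euc N)) ∂(sig N)) ≤
      ∫⁻ y in closedBall 0 6, F y := by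
  rw [← lintegral_indicator measurableSet_closedBall,
    lintegral_polar_swap hN (hF.indicator measurableSet_closedBall)]
  refine le_trans ?_ (lintegral_mono_set (s := Icc (1 : ℝ) 2)
    (fun r hr => (zero_lt_one.trans_le hr.1 : (0 : ℝ) < r)))
  refine setLIntegral_mono' measurableSet_Icc fun r hr => ?_
  have h1 : (1 : ENNReal) ≤ ENNReal.ofReal (r ^ (N - 1)) := by
    rw [ENNReal.one_le_ofReal]; exact one_le_pow₀ hr.1
  refine le_trans (le_of_eq ?_) (mul_le_mul_left h1 _)
  rw [one_mul]
  refine lintegral_congr fun θ => ?_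
  rw [indicator_of_mem]
  rw [mem_closedBall_zero_iff, norm_smul, Real.norm_eq_abs, abs_of_pos (by linarith [hr.1])]
  simp; linarith [hr.2]

lemma sphere_estimate (hN : 3 ≤ N) {k s j : ℝ} (hk : 1 < k) (hks : k ≤ s)
    (hj : (N - 1) * (k⁻¹ - s⁻¹) < j) {C0 : ENNReal} (hC0 : C0 ≠ ⊤) :
    ∃ e : ℝ, 0 < e ∧ ∃ C : ENNReal, C ≠ ⊤ ∧ ∀ f g : Euc N → ENNReal, Measurable f →
      (∀ z, ‖z‖ ≤ 2 → g z ≤ C0 * ((∫⁻ y in closedBall 0 6, f y * kk (N - j) z y) + 1)) →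
      ∀ r ∈ Icc (1 : ℝ) 2, ∀ X : ENNReal, 1 ≤ X →
      ∫⁻ y in closedBall 0 6, f y ^ k * ww e r y ≤ X →
      ∫⁻ θ, g (r • (θ : Euc N)) ^ s ∂(sig N) ≤ C * X ^ (s / k) := by
  obtain ⟨e, he, C, hC, h⟩ := sphere_potential hN hk hks hj
  have hs : 1 ≤ s := hk.le.trans hks
  have hsk : 0 ≤ s / k := by positivity
  refine ⟨e, he, C0 ^ s * 2 ^ (s - 1) * (C + sig N univ), ?_, fun f g hf hg r hr X hX hfX => ?_⟩
  · have : C0 ^ s ≠ ⊤ := ENNReal.rpow_ne_top_of_nonneg (by linarith) hC0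
    have h2 : (2 : ENNReal) ^ (s - 1) ≠ ⊤ := ENNReal.rpow_ne_top_of_nonneg (by linarith) (by simp)
    finiteness
  have hpt : ∀ θ : sphere (0 : Euc N) 1, g (r • (θ : Euc N)) ^ s ≤ C0 ^ s * 2 ^ (s - 1) *
      ((∫⁻ y in closedBall 0 6, f y * kk (N - j) (r • (θ : Euc N)) y) ^ s + 1) := by
    intro θ
    refine (ENNReal.rpow_le_rpow (hg (r • (θ : Euc N)) ?_) (by linarith)).trans ?_
    · rw [norm_smul, Real.norm_eq_abs, abs_of_pos (by linarith [hr.1])]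
      simp; linarith [hr.2]
    rw [ENNReal.mul_rpow_of_nonneg _ _ (by linarith), mul_assoc]
    refine mul_le_mul_right ?_ _
    simpa using ENNReal.rpow_add_le_mul_rpow_add_rpow
      (∫⁻ y in closedBall 0 6, f y * kk (N - j) (r • (θ : Euc N)) y) 1 hs
  have hX1 : 1 ≤ X ^ (s / k) := by simpa using ENNReal.rpow_le_rpow hX hsk
  refine (lintegral_mono hpt).trans ?_
  rw [lintegral_const_mul' _ _ (by
    have : C0 ^ s ≠ ⊤ := ENNReal.rpow_ne_top_of_nonneg (by linarith) hC0
    have h2 : (2 : ENNReal) ^ (s - 1) ≠ ⊤ := ENNReal.rpow_ne_top_of_nonneg (by linarith) (by simp)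
    finiteness), lintegral_add_right _ measurable_const, lintegral_const, one_mul,
    mul_assoc (C0 ^ s * 2 ^ (s - 1)) (C + _), add_mul]
  refine mul_le_mul_right (add_le_add ((h f hf r hr).trans
    (mul_le_mul_right (ENNReal.rpow_le_rpow hfX hsk) _)) ?_) _
  calc sig N univ = sig N univ * 1 := (mul_one _).symm
    _ ≤ _ := mul_le_mul_right hX1 _

lemma kk_le_mul_kk {l : ℝ} (hl : 0 < l) {z y : Euc N} (hz : ‖z‖ ≤ 2) (hy : ‖y‖ ≤ 6) :
    kk l z y ≤ 8 * kk (l + 1) z y := by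
  rcases eq_or_ne y z with rfl | h
  · simp only [kk, edist_self]
    rw [ENNReal.zero_rpow_of_neg (by linarith : -(l + 1) < 0), ENNReal.mul_top (by norm_num)]
    exact le_top
  rw [kk_of_ne _ h, kk_of_ne _ h, show (8 : ENNReal) = ENNReal.ofReal 8 by norm_num,
    ← ENNReal.ofReal_mul (by norm_num)]
  refine ENNReal.ofReal_le_ofReal ?_
  have h0 : 0 < ‖y - z‖ := norm_pos_iff.2 (sub_ne_zero.2 h)
  have h8 : ‖y - z‖ ≤ 8 := (norm_sub_le _ _).trans (by linarith)
  have : ‖y - z‖ ^ (-l) = ‖y - z‖ * ‖y - z‖ ^ (-(l + 1)) := by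
    rw [mul_comm, ← Real.rpow_add_one h0.ne']; ring_nf
  rw [this]
  gcongr

lemma potential_bounds (hN : 3 ≤ N) {p q m : ℝ} (hp : 0 < p) (hq : 0 < q) (hpq : 1 < p * q)
    (hm : 0 < m) : ∃ C : ENNReal, C ≠ ⊤ ∧ ∀ (M ε : ℝ) (U V c d : Euc N → ℝ),
      Sys p q m M ε 20 U V c d → ∀ z : Euc N, ‖z‖ ≤ 2 →
      (ENNReal.ofReal (U z) ≤
        C * ((∫⁻ y in closedBall 0 6, ENNReal.ofReal (-lap U y) * kk (N - 2) z y) + 1)) ∧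
      ENNReal.ofReal (gn U z + U z) ≤
        C * ((∫⁻ y in closedBall 0 6, ENNReal.ofReal (-lap U y) * kk (N - 1) z y) + 1) := by
  obtain ⟨A, hA, hval⟩ := value_le hN
  obtain ⟨B, hB, hpd⟩ := pd_le hN
  obtain ⟨K, hK, hmass⟩ := mass_bound hN hp hq hpq hm
  have hN' : (3 : ℝ) ≤ N := by exact_mod_cast hN
  set a := ENNReal.ofReal A
  set b := ENNReal.ofReal B
  set κ := ENNReal.ofReal K
  have ha : a ≠ ⊤ := ENNReal.ofReal_ne_top
  have hb : b ≠ ⊤ := ENNReal.ofReal_ne_top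
  have hκ : κ ≠ ⊤ := ENNReal.ofReal_ne_top
  refine ⟨a * (1 + κ) * 8 + N * (b * (1 + κ)), by finiteness, fun M ε U V c d h z hz => ?_⟩
  have hU6 : ∀ x ∈ closedBall (0 : Euc N) 6, lap U x ≤ 0 := fun x hx =>
    h.lapU_nonpos hm.le (closedBall_subset_ball (by norm_num) hx)
  have hann : ENNReal.ofReal (∫ y in ann N, U y) ≤ κ :=
    ENNReal.ofReal_le_ofReal (hmass M ε U V c d h).2.2.1
  have hsum : ∀ I : ENNReal, I + ENNReal.ofReal (∫ y in ann N, U y) ≤ (1 + κ) * (I + 1) := by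
    intro I
    calc I + ENNReal.ofReal (∫ y in ann N, U y) ≤ I + κ := by gcongr
      _ ≤ (I + κ) + (1 + κ * I) := le_self_add
      _ = _ := by ring
  have hUz : ENNReal.ofReal (U z) ≤ a * (1 + κ) *
      ((∫⁻ y in closedBall 0 6, ENNReal.ofReal (-lap U y) * kk (N - 2) z y) + 1) := by
    refine (Real.ofReal_le_enorm _).trans ((hval U h.contU h.U_nonneg hU6 z hz).trans ?_)
    rw [mul_assoc]
    exact mul_le_mul_right (hsum _) _
  have hpz : ∀ i, ENNReal.ofReal |pd i U z| ≤ b * (1 + κ) *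
      ((∫⁻ y in closedBall 0 6, ENNReal.ofReal (-lap U y) * kk (N - 1) z y) + 1) := by
    intro i
    rw [← Real.enorm_eq_ofReal_abs]
    refine (hpd U h.contU h.U_nonneg hU6 z hz i).trans ?_
    rw [mul_assoc]
    exact mul_le_mul_right (hsum _) _
  have h21 : (∫⁻ y in closedBall 0 6, ENNReal.ofReal (-lap U y) * kk (N - 2) z y) ≤
      8 * ∫⁻ y in closedBall 0 6, ENNReal.ofReal (-lap U y) * kk (N - 1) z y := by
    rw [← lintegral_const_mul' _ _ (by norm_num)]
    refine setLIntegral_mono' measurableSet_closedBall fun y hy => ?_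
    rw [mem_closedBall_zero_iff] at hy
    have := kk_le_mul_kk (l := N - 2) (by linarith) hz hy
    rw [show (N : ℝ) - 2 + 1 = N - 1 by ring] at this
    calc _ ≤ ENNReal.ofReal (-lap U y) * (8 * kk (N - 1) z y) := mul_le_mul_right this _
      _ = _ := by ring
  constructor
  · refine hUz.trans (mul_le_mul_left ?_ _)
    calc a * (1 + κ) = a * (1 + κ) * 1 := (mul_one _).symm
      _ ≤ a * (1 + κ) * 8 := by gcongr; norm_num
      _ ≤ _ := le_self_add
  · rw [ENNReal.ofReal_add (gn_nonneg U z) (h.U_nonneg z), gn,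
      ENNReal.ofReal_sum_of_nonneg fun _ _ => abs_nonneg _, add_mul, add_comm]
    refine add_le_add (hUz.trans ?_) ((Finset.sum_le_sum fun i _ => hpz i).trans (le_of_eq ?_))
    · rw [mul_assoc _ 8]
      refine mul_le_mul_right ?_ _
      rw [mul_add]
      exact add_le_add h21 (by norm_num)
    · rw [Finset.sum_const, Finset.card_univ, Fintype.card_fin, nsmul_eq_mul, mul_assoc (N : ENNReal)]

lemma energy_combine {X : Type*} [MeasurableSpace X] {μ : Measure X} {P Q u v : X → ENNReal}
    (hP : Measurable P) (hQ : Measurable Q) (hv : Measurable v)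
    {p q t s s' b : ℝ} (hp : 0 < p) (hq : 0 < q) (ht : 0 < t) (htp : t * (p + 1) ≤ 1)
    (hs : s.HolderConjugate s') {Y D1 D2 D3 D4 D5 : ENNReal} (hY : 1 ≤ Y)
    (h1 : ∫⁻ x, P x ^ s ∂μ ≤ D1 * Y ^ (p * t * s))
    (h2 : ∫⁻ x, Q x ^ s' ∂μ ≤ D2 * Y ^ (q / (q + 1) * s'))
    (h3 : ∫⁻ x, u x ^ (q + 1) ∂μ ≤ D3 * Y ^ (p * t * (q + 1)))
    (h4 : ∫⁻ x, v x ^ t⁻¹ ∂μ ≤ D4 * Y ^ (q / (q + 1) * t⁻¹))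
    (h5 : ∫⁻ x, v x ^ p ∂μ ≤ D5)
    (hb1 : p * t + q / (q + 1) ≤ b) (hb2 : p * t * (q + 1) ≤ b)
    (hb3 : q / (q + 1) / (1 - p * t) ≤ b) :
    ∫⁻ x, (u x ^ (q + 1) + v x ^ (p + 1) + P x * Q x) ∂μ ≤
      (D3 + D5 ^ (1 - t / (1 - p * t)) * D4 ^ (t / (1 - p * t)) +
        D1 ^ (1 / s) * D2 ^ (1 / s')) * Y ^ b := by
  have hs0 : 0 < s := hs.pos
  have hs'0 : 0 < s' := hs.symm.pos
  have hpt : 0 < 1 - p * t := by nlinarith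
  set w := t / (1 - p * t) with hw
  have hw0 : 0 < w := by positivity
  have hw1 : w ≤ 1 := by rw [hw, div_le_one hpt]; linarith
  have e3 : ∫⁻ x, u x ^ (q + 1) ∂μ ≤ D3 * Y ^ b :=
    h3.trans (mul_le_mul_right (ENNReal.rpow_le_rpow_of_exponent_le hY hb2) _)
  have e4 : ∫⁻ x, v x ^ (p + 1) ∂μ ≤ D5 ^ (1 - w) * D4 ^ w * Y ^ b := by
    refine (lintegral_interp hv hp.le (inv_nonneg.2 ht.le) hw0.le hw1
      (by rw [hw]; field_simp; ring)).trans ?_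
    rw [mul_assoc]
    refine mul_le_mul' (ENNReal.rpow_le_rpow h5 (by linarith)) ?_
    refine (ENNReal.rpow_le_rpow h4 hw0.le).trans ?_
    rw [ENNReal.mul_rpow_of_nonneg _ _ hw0.le, ← ENNReal.rpow_mul]
    refine mul_le_mul_right (ENNReal.rpow_le_rpow_of_exponent_le hY ?_) _
    refine le_trans (le_of_eq ?_) hb3
    rw [hw]; field_simp
  have e1 : ∫⁻ x, P x * Q x ∂μ ≤ D1 ^ (1 / s) * D2 ^ (1 / s') * Y ^ b := by
    refine (ENNReal.lintegral_mul_le_Lp_mul_Lq μ hs hP.aemeasurable hQ.aemeasurable).trans ?_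
    refine (mul_le_mul' (ENNReal.rpow_le_rpow h1 (by positivity))
      (ENNReal.rpow_le_rpow h2 (by positivity))).trans ?_
    rw [ENNReal.mul_rpow_of_nonneg _ _ (by positivity), ENNReal.mul_rpow_of_nonneg _ _
      (by positivity), ← ENNReal.rpow_mul, ← ENNReal.rpow_mul, mul_mul_mul_comm,
      mul_assoc (p * t), mul_one_div_cancel hs0.ne', mul_assoc (q / (q + 1)),
      mul_one_div_cancel hs'0.ne', mul_one, mul_one]
    refine mul_le_mul_right ?_ _
    rw [← ENNReal.rpow_add_of_nonneg _ _ (by positivity) (by positivity)]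
    exact ENNReal.rpow_le_rpow_of_exponent_le hY hb1
  have hPQ : Measurable fun x => P x * Q x := hP.mul hQ
  rw [lintegral_add_right _ hPQ, lintegral_add_right _ (hv.pow_const _), add_mul, add_mul]
  exact add_le_add (add_le_add e3 e4) e1

lemma continuous_pot {p q : ℝ} (hp : 0 < p) (hq : 0 < q) {U V : Euc N → ℝ} (hU : Continuous U)
    (hV : Continuous V) : Continuous (pot p q U V) := by
  unfold pot
  exact (hU.rpow_const fun _ => Or.inr (by linarith)).add
    (hV.rpow_const fun _ => Or.inr (by linarith))

lemma lintegral_ball_lt_top {F : Euc N → ℝ} (hF : Continuous F) (r : ℝ) :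
    ∫⁻ y in closedBall 0 r, ENNReal.ofReal (F y) < ⊤ :=
  (integrableOn_ball hF r).lintegral_lt_top

lemma source_bounds (hN : 3 ≤ N) {p q m M k : ℝ} (hp : 0 < p) (hq : 0 < q) (hpq : 1 < p * q)
    (hm : 0 < m) (hk : 1 < k) (hpk : p * (k - 1) ≤ 1) :
    ∃ A : ENNReal, A ≠ ⊤ ∧ 1 ≤ A ∧ ∀ (ε : ℝ) (U V c d : Euc N → ℝ), Sys p q m M ε 20 U V c d →
      (∫⁻ y in closedBall 0 6, ENNReal.ofReal (-lap U y) ^ k ≤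
        A * (1 + ∫⁻ y in closedBall 0 6, ENNReal.ofReal (pot p q U V y)) ^ (p * (k - 1))) ∧
      (∫⁻ y in closedBall 0 6, ENNReal.ofReal (-lap V y) ^ ((q + 1) / q) ≤
        A * (1 + ∫⁻ y in closedBall 0 6, ENNReal.ofReal (pot p q U V y))) ∧
      ∫⁻ y in closedBall 0 6, ENNReal.ofReal (V y) ^ p ≤ A := by
  obtain ⟨K, hK, hmass⟩ := mass_bound hN hp hq hpq hm
  set A1 : ENNReal := (ENNReal.ofReal m)⁻¹ * ENNReal.ofReal K with hA1
  set μ := ENNReal.ofReal M with hμ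
  have hμt : μ ≠ ⊤ := ENNReal.ofReal_ne_top
  have hmt : (ENNReal.ofReal m)⁻¹ ≠ ⊤ := ENNReal.inv_ne_top.2 (by simpa using hm)
  have hA1t : A1 ≠ ⊤ := by finiteness
  have hl : 0 < (q + 1) / q := by positivity
  have h1t : μ ^ k * A1 ^ (1 - p * (k - 1)) ≠ ⊤ :=
    ENNReal.mul_ne_top (ENNReal.rpow_ne_top_of_nonneg (by linarith) hμt)
      (ENNReal.rpow_ne_top_of_nonneg (by linarith) hA1t)
  have h2t : μ ^ ((q + 1) / q) ≠ ⊤ := ENNReal.rpow_ne_top_of_nonneg hl.le hμt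
  refine ⟨1 + μ ^ k * A1 ^ (1 - p * (k - 1)) + μ ^ ((q + 1) / q) + A1, by finiteness, ?_,
    fun ε U V c d h => ?_⟩
  · rw [add_assoc, add_assoc]; exact le_self_add
  set Y := 1 + ∫⁻ y in closedBall 0 6, ENNReal.ofReal (pot p q U V y) with hY
  have hmem : ∀ y ∈ closedBall (0 : Euc N) 6, y ∈ ball (0 : Euc N) 20 := fun y hy =>
    closedBall_subset_ball (by norm_num) hy
  have hvY : ∫⁻ y in closedBall 0 6, ENNReal.ofReal (V y) ^ (p + 1) ≤ Y := by
    refine le_trans (lintegral_mono fun y => ?_) le_add_self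
    rw [ENNReal.ofReal_rpow_of_nonneg (h.V_nonneg y) (by linarith)]
    exact ENNReal.ofReal_le_ofReal
      (le_add_of_nonneg_left (Real.rpow_nonneg (h.U_nonneg y) _))
  have huY : ∫⁻ y in closedBall 0 6, ENNReal.ofReal (U y) ^ (q + 1) ≤ Y := by
    refine le_trans (lintegral_mono fun y => ?_) le_add_self
    rw [ENNReal.ofReal_rpow_of_nonneg (h.U_nonneg y) (by linarith)]
    exact ENNReal.ofReal_le_ofReal
      (le_add_of_nonneg_right (Real.rpow_nonneg (h.V_nonneg y) _))
  have hvm : Measurable fun y => ENNReal.ofReal (V y) := h.contV.continuous.measurable.ennreal_ofReal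
  have hum : Measurable fun y => ENNReal.ofReal (U y) := h.contU.continuous.measurable.ennreal_ofReal
  have hvp : ∫⁻ y in closedBall 0 6, ENNReal.ofReal (V y) ^ p ≤ A1 := by
    have h1 : ∫⁻ y in closedBall 0 6, ENNReal.ofReal (-lap U y) ≤ ENNReal.ofReal K := by
      have hi := integrableOn_ball (continuous_lap h.contU).neg 6
      simp only [Pi.neg_def] at hi
      rw [← ofReal_integral_eq_lintegral_ofReal hi]
      · exact ENNReal.ofReal_le_ofReal (hmass M ε U V c d h).1
      · refine (ae_restrict_iff' measurableSet_closedBall).2 (ae_of_all _ fun y hy => ?_)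
        exact neg_nonneg.2 (h.lapU_nonpos hm.le (hmem y hy))
    refine le_trans ?_ (mul_le_mul_right h1 _)
    rw [← lintegral_const_mul' _ _ hmt]
    refine setLIntegral_mono' measurableSet_closedBall fun y hy => ?_
    rw [h.eqU y (hmem y hy), ENNReal.ofReal_rpow_of_nonneg (h.V_nonneg y) hp.le,
      ← ENNReal.ofReal_inv_of_pos hm, ← ENNReal.ofReal_mul (by positivity)]
    refine ENNReal.ofReal_le_ofReal ?_
    rw [← div_eq_inv_mul, le_div_iff₀' hm]
    exact mul_le_mul_of_nonneg_right (h.c_ge y (hmem y hy)) (Real.rpow_nonneg (h.V_nonneg y) _)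
  have hfle : ∀ y ∈ closedBall (0 : Euc N) 6,
      ENNReal.ofReal (-lap U y) ≤ μ * ENNReal.ofReal (V y) ^ p := by
    intro y hy
    rw [h.eqU y (hmem y hy), ENNReal.ofReal_rpow_of_nonneg (h.V_nonneg y) hp.le, hμ,
      ← ENNReal.ofReal_mul (hm.le.trans ((h.c_ge y (hmem y hy)).trans (h.c_le y (hmem y hy))))]
    exact ENNReal.ofReal_le_ofReal (mul_le_mul_of_nonneg_right (h.c_le y (hmem y hy))
      (Real.rpow_nonneg (h.V_nonneg y) _))
  have hhle : ∀ y ∈ closedBall (0 : Euc N) 6,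
      ENNReal.ofReal (-lap V y) ≤ μ * ENNReal.ofReal (U y) ^ q := by
    intro y hy
    rw [h.eqV y (hmem y hy), ENNReal.ofReal_rpow_of_nonneg (h.U_nonneg y) hq.le, hμ,
      ← ENNReal.ofReal_mul (hm.le.trans ((h.c_ge y (hmem y hy)).trans (h.c_le y (hmem y hy))))]
    exact ENNReal.ofReal_le_ofReal (mul_le_mul_of_nonneg_right (h.d_le y (hmem y hy))
      (Real.rpow_nonneg (h.U_nonneg y) _))
  refine ⟨?_, ?_, hvp.trans le_add_self⟩
  · calc ∫⁻ y in closedBall 0 6, ENNReal.ofReal (-lap U y) ^ k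
        ≤ ∫⁻ y in closedBall 0 6, μ ^ k * ENNReal.ofReal (V y) ^ (p * k) := by
          refine setLIntegral_mono' measurableSet_closedBall fun y hy => ?_
          refine (ENNReal.rpow_le_rpow (hfle y hy) (by linarith)).trans (le_of_eq ?_)
          rw [ENNReal.mul_rpow_of_nonneg _ _ (by linarith), ← ENNReal.rpow_mul]
      _ = μ ^ k * ∫⁻ y in closedBall 0 6, ENNReal.ofReal (V y) ^ (p * k) :=
          lintegral_const_mul _ (hvm.pow_const _)
      _ ≤ μ ^ k * (A1 ^ (1 - p * (k - 1)) * Y ^ (p * (k - 1))) := by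
          refine mul_le_mul_right ((lintegral_interp hvm hp.le (by linarith)
            (mul_nonneg hp.le (by linarith)) hpk
            (b := p + 1) (by ring)).trans (mul_le_mul' (ENNReal.rpow_le_rpow hvp (by linarith))
              (ENNReal.rpow_le_rpow hvY (mul_nonneg hp.le (by linarith))))) _
      _ = μ ^ k * A1 ^ (1 - p * (k - 1)) * Y ^ (p * (k - 1)) := (mul_assoc _ _ _).symm
      _ ≤ _ := by
          refine mul_le_mul_left ?_ _
          rw [add_assoc]
          exact le_add_self.trans le_self_add
  · calc ∫⁻ y in closedBall 0 6, ENNReal.ofReal (-lap V y) ^ ((q + 1) / q)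
        ≤ ∫⁻ y in closedBall 0 6, μ ^ ((q + 1) / q) * ENNReal.ofReal (U y) ^ (q + 1) := by
          refine setLIntegral_mono' measurableSet_closedBall fun y hy => ?_
          refine (ENNReal.rpow_le_rpow (hhle y hy) hl.le).trans (le_of_eq ?_)
          rw [ENNReal.mul_rpow_of_nonneg _ _ hl.le, ← ENNReal.rpow_mul, mul_div_cancel₀ _ hq.ne']
      _ = μ ^ ((q + 1) / q) * ∫⁻ y in closedBall 0 6, ENNReal.ofReal (U y) ^ (q + 1) :=
          lintegral_const_mul _ (hum.pow_const _)
      _ ≤ μ ^ ((q + 1) / q) * Y := mul_le_mul_right huY _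
      _ ≤ _ := mul_le_mul_left (le_add_self.trans le_self_add) _

lemma measurable_neg_lap {U : Euc N → ℝ} (hU : ContDiff ℝ 2 U) :
    Measurable fun y => ENNReal.ofReal (-lap U y) :=
  (continuous_lap hU).neg.measurable.ennreal_ofReal

lemma boundary_energy (hN : 3 ≤ N) {p q m M t : ℝ} (hp : 0 < p) (hq : 0 < q) (hpq : 1 < p * q)
    (hm : 0 < m) (ht : 0 < t) (ht1 : p * t * (q + 1) < 1)
    (ht2 : ((N : ℝ) - 1) * (q / (q + 1) - t) < 2) :
    ∃ C : ENNReal, C ≠ ⊤ ∧ ∃ b : ℝ, 0 ≤ b ∧ b < 1 ∧ ∀ (ε : ℝ) (U V c d : Euc N → ℝ),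
      Sys p q m M ε 20 U V c d → ∃ r ∈ Icc (1 : ℝ) 2,
      ∫⁻ θ, ENNReal.ofReal (en p q U V (r • (θ : Euc N))) ∂(sig N) ≤
        C * (1 + ∫⁻ y in closedBall 0 6, ENNReal.ofReal (pot p q U V y)) ^ b := by
  have hq1 : 0 < q + 1 := by linarith
  have htq : t < q / (q + 1) := by
    rw [lt_div_iff₀ hq1]
    have : p * t * (q + 1) < p * q := ht1.trans hpq
    have h2 : p * (t * (q + 1)) < p * q := by linarith
    exact lt_of_mul_lt_mul_left h2 hp.le
  have htp : t * (p + 1) ≤ 1 := by nlinarith [mul_pos ht (sub_pos.2 hpq)]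
  have hqlt : q / (q + 1) < 1 := by rw [div_lt_one hq1]; linarith
  have ht01 : 0 < 1 - t := by linarith
  set k := (1 - t)⁻¹ with hk
  have hk1 : 1 < k := by rw [hk]; exact (one_lt_inv₀ ht01).2 (by linarith)
  set σ := (1 - t + (1 - q / (q + 1))) / 2 with hσ
  have hσ0 : 0 < σ := by rw [hσ]; linarith
  have hσ1 : 0 < 1 - σ := by rw [hσ]; linarith
  set l := (q + 1) / q with hl
  have hl1 : 1 < l := by rw [hl, one_lt_div hq]; linarith
  have hlinv : l⁻¹ = q / (q + 1) := inv_div _ _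
  have hl0 : 0 < l := by linarith
  have hqinv : (q + 1)⁻¹ = 1 - q / (q + 1) := by field_simp; ring
  have hk0 : 0 < k := by linarith
  have hkinv : k⁻¹ = 1 - t := inv_inv _
  obtain ⟨P0, hP0, hpotU⟩ := potential_bounds hN hp hq hpq hm
  obtain ⟨P1, hP1, hpotV⟩ := potential_bounds hN hq hp (by rwa [mul_comm]) hm
  have hpk : p * (k - 1) ≤ 1 := by
    have : k - 1 = t / (1 - t) := by rw [hk]; field_simp; ring
    rw [this, ← mul_div_assoc, div_le_one ht01]; linarith
  have hpk0 : 0 ≤ p * (k - 1) := mul_nonneg hp.le (by linarith)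
  have hpkk : p * (k - 1) / k = p * t := by
    rw [mul_div_assoc, sub_div, div_self hk0.ne', one_div, hkinv]; ring
  obtain ⟨A, hA, hA1, hsrc⟩ := source_bounds (M := M) hN hp hq hpq hm hk1 hpk
  obtain ⟨e1, he1, C1, hC1, hS1⟩ := sphere_estimate hN (s := σ⁻¹) (j := 1) hk1
    (by rw [← inv_le_inv₀ (by positivity) hk0, inv_inv, hkinv, hσ]; linarith)
    (by rw [hkinv, inv_inv, hσ]; linarith) hP0
  obtain ⟨e2, he2, C2, hC2, hS2⟩ := sphere_estimate hN (s := (1 - σ)⁻¹) (j := 1) hl1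
    (by rw [← inv_le_inv₀ (by positivity) hl0, inv_inv, hlinv, hσ]; linarith)
    (by rw [inv_inv, hlinv, hσ]; linarith) hP1
  obtain ⟨e3, he3, C3, hC3, hS3⟩ := sphere_estimate hN (s := q + 1) (j := 2) hk1
    (by rw [← inv_le_inv₀ hq1 hk0, hkinv, hqinv]; linarith)
    (by rw [hkinv, hqinv]; linarith) hP0
  obtain ⟨e4, he4, C4, hC4, hS4⟩ := sphere_estimate hN (s := t⁻¹) (j := 2) hl1
    (by rw [← inv_le_inv₀ (by positivity) hl0, inv_inv, hlinv]; linarith)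
    (by rw [inv_inv, hlinv]; linarith) hP1
  obtain ⟨W1, hW1, hav1⟩ := ww_average (N := N) he1
  obtain ⟨W2, hW2, hav2⟩ := ww_average (N := N) he2
  obtain ⟨W3, hW3, hav3⟩ := ww_average (N := N) he3
  obtain ⟨W4, hW4, hav4⟩ := ww_average (N := N) he4
  set B1 := 5 * ((1 + W1) * A) with hB1
  set B2 := 5 * ((1 + W2) * A) with hB2
  set B3 := 5 * ((1 + W3) * A) with hB3
  set B4 := 5 * ((1 + W4) * A) with hB4
  have hpt1 : 0 < 1 - p * t := by nlinarith
  set b := max (max (p * t + q / (q + 1)) (p * t * (q + 1))) (q / (q + 1) / (1 - p * t)) with hb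
  have hpt0 : 0 < p * t := by positivity
  refine ⟨C3 * B3 ^ ((q + 1) / k) + (5 * A) ^ (1 - t / (1 - p * t)) *
    (C4 * B4 ^ (t⁻¹ / l)) ^ (t / (1 - p * t)) + (C1 * B1 ^ (σ⁻¹ / k)) ^ (1 / σ⁻¹) *
    (C2 * B2 ^ ((1 - σ)⁻¹ / l)) ^ (1 / (1 - σ)⁻¹), ?_, b, ?_, ?_, fun ε U V c d h => ?_⟩
  · have hB1t : B1 ≠ ⊤ := by finiteness
    have hB2t : B2 ≠ ⊤ := by finiteness
    have hB3t : B3 ≠ ⊤ := by finiteness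
    have hB4t : B4 ≠ ⊤ := by finiteness
    have hw : t / (1 - p * t) ≤ 1 := by rw [div_le_one hpt1]; linarith
    have fin : ∀ {x : ENNReal} {y : ℝ}, 0 ≤ y → x ≠ ⊤ → x ^ y ≠ ⊤ :=
      fun hy hx => ENNReal.rpow_ne_top_of_nonneg hy hx
    refine ENNReal.add_ne_top.2 ⟨ENNReal.add_ne_top.2 ⟨?_, ?_⟩, ?_⟩
    · exact ENNReal.mul_ne_top hC3 (fin (by positivity) hB3t)
    · exact ENNReal.mul_ne_top (fin (by linarith) (by finiteness)) (fin (by positivity)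
        (ENNReal.mul_ne_top hC4 (fin (by positivity) hB4t)))
    · exact ENNReal.mul_ne_top
        (fin (by positivity) (ENNReal.mul_ne_top hC1 (fin (by positivity) hB1t)))
        (fin (by positivity) (ENNReal.mul_ne_top hC2 (fin (by positivity) hB2t)))
  · exact le_max_of_le_right (by positivity)
  · refine max_lt (max_lt ?_ ht1) ?_
    · have : p * t < 1 - q / (q + 1) := by
        rw [← hqinv, lt_inv_comm₀ hpt0 hq1, ← one_div, lt_div_iff₀ hpt0]; linarith
      linarith
    · rw [div_lt_one hpt1, div_lt_iff₀ hq1]; linarith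
  set Y := 1 + ∫⁻ y in closedBall 0 6, ENNReal.ofReal (pot p q U V y) with hY
  have hY1 : 1 ≤ Y := le_self_add
  have hYt : Y ≠ ⊤ := ENNReal.add_ne_top.2 ⟨ENNReal.one_ne_top, (lintegral_ball_lt_top
    (continuous_pot hp hq h.contU.continuous h.contV.continuous) 6).ne⟩
  obtain ⟨hs1, hs2, hs3⟩ := hsrc ε U V c d h
  have hfm := measurable_neg_lap h.contU
  have hhm := measurable_neg_lap h.contV
  have hvm : Measurable fun y => ENNReal.ofReal (V y) :=
    h.contV.continuous.measurable.ennreal_ofReal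
  have hfk := hfm.pow_const k
  have hhl := hhm.pow_const l
  have hYp : 1 ≤ Y ^ (p * (k - 1)) := by simpa using ENNReal.rpow_le_rpow hY1 hpk0
  have hXge : ∀ W Z : ENNReal, 1 ≤ Z → 1 ≤ (1 + W) * A * Z := fun W Z hZ =>
    one_le_mul (one_le_mul le_self_add hA1) hZ
  have hXle : ∀ W Z I J : ENNReal, I ≤ W * J → J ≤ A * Z → I ≤ (1 + W) * A * Z := by
    intro W Z I J h1 h2
    refine h1.trans ((mul_le_mul_right h2 _).trans ?_)
    rw [mul_assoc]
    exact mul_le_mul_left le_add_self _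
  obtain ⟨r, hr, hgood⟩ := exists_good_radius
    (A := ![fun r => ∫⁻ y in closedBall 0 6, ENNReal.ofReal (-lap U y) ^ k * ww e1 r y,
      fun r => ∫⁻ y in closedBall 0 6, ENNReal.ofReal (-lap V y) ^ l * ww e2 r y,
      fun r => ∫⁻ y in closedBall 0 6, ENNReal.ofReal (-lap U y) ^ k * ww e3 r y,
      fun r => ∫⁻ y in closedBall 0 6, ENNReal.ofReal (-lap V y) ^ l * ww e4 r y,
      fun r => ∫⁻ θ, ENNReal.ofReal (V (r • (θ : Euc N))) ^ p ∂(sig N)])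
    (X := ![(1 + W1) * A * Y ^ (p * (k - 1)), (1 + W2) * A * Y, (1 + W3) * A * Y ^ (p * (k - 1)),
      (1 + W4) * A * Y, A])
    (by
      intro i
      fin_cases i
      · exact measurable_ww_integral hfk e1
      · exact measurable_ww_integral hhl e2
      · exact measurable_ww_integral hfk e3
      · exact measurable_ww_integral hhl e4
      · exact measurable_sphere_integral (hvm.pow_const p))
    (by
      intro i
      fin_cases i
      · exact (zero_lt_one.trans_le (hXge W1 _ hYp)).ne'
      · exact (zero_lt_one.trans_le (hXge W2 _ hY1)).ne'
      · exact (zero_lt_one.trans_le (hXge W3 _ hYp)).ne'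
      · exact (zero_lt_one.trans_le (hXge W4 _ hY1)).ne'
      · exact (zero_lt_one.trans_le hA1).ne')
    (by
      have hYpt : Y ^ (p * (k - 1)) ≠ ⊤ := ENNReal.rpow_ne_top_of_nonneg hpk0 hYt
      intro i
      fin_cases i
      · change (1 + W1) * A * Y ^ (p * (k - 1)) ≠ ⊤; finiteness
      · change (1 + W2) * A * Y ≠ ⊤; finiteness
      · change (1 + W3) * A * Y ^ (p * (k - 1)) ≠ ⊤; finiteness
      · change (1 + W4) * A * Y ≠ ⊤; finiteness
      · exact hA)
    (by
      intro i
      fin_cases i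
      · exact hXle _ _ _ _ (hav1 _ hfk) hs1
      · exact hXle _ _ _ _ (hav2 _ hhl) hs2
      · exact hXle _ _ _ _ (hav3 _ hfk) hs1
      · exact hXle _ _ _ _ (hav4 _ hhl) hs2
      · exact (sphere_average hN (hvm.pow_const p)).trans hs3)
  refine ⟨r, hr, ?_⟩
  have h5 : ((Fintype.card (Fin 5) : ℕ) : ENNReal) = 5 := by simp
  rw [h5] at hgood
  have g1 := hgood 0
  have g2 := hgood 1
  have g3 := hgood 2
  have g4 := hgood 3
  have g5 := hgood 4
  simp only [Matrix.cons_val] at g1 g2 g3 g4 g5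
  rw [← mul_assoc] at g1 g2 g3 g4
  have hone : ∀ W Z : ENNReal, 1 ≤ Z → 1 ≤ 5 * ((1 + W) * A) * Z := fun W Z hZ =>
    one_le_mul (one_le_mul (by norm_num) (one_le_mul le_self_add hA1)) hZ
  have hUpt := hpotU M ε U V c d h
  have hVpt := hpotV M ε V U d c h.symm
  have hpow : ∀ (C B : ENNReal) (x y : ℝ), 0 ≤ y →
      C * (B * Y ^ x) ^ y = C * B ^ y * Y ^ (x * y) := by
    intro C B x y hy
    rw [ENNReal.mul_rpow_of_nonneg _ _ hy, ← ENNReal.rpow_mul, mul_assoc]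
  have r1 := hS1 _ (fun z => ENNReal.ofReal (gn U z + U z)) hfm (fun z hz => (hUpt z hz).2) r hr _
    (hone W1 _ hYp) g1
  have r2 := hS2 _ (fun z => ENNReal.ofReal (gn V z + V z)) hhm (fun z hz => (hVpt z hz).2) r hr _
    (hone W2 _ hY1) g2
  have r3 := hS3 _ (fun z => ENNReal.ofReal (U z)) hfm (fun z hz => (hUpt z hz).1) r hr _
    (hone W3 _ hYp) g3
  have r4 := hS4 _ (fun z => ENNReal.ofReal (V z)) hhm (fun z hz => (hVpt z hz).1) r hr _
    (hone W4 _ hY1) g4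
  rw [hpow _ _ _ _ (by positivity)] at r1 r3
  rw [← ENNReal.rpow_one Y, hpow _ _ _ _ (by positivity)] at r2 r4
  have x1 : p * (k - 1) * (σ⁻¹ / k) = p * t * σ⁻¹ := by rw [← hpkk]; ring
  have x2 : 1 * ((1 - σ)⁻¹ / l) = q / (q + 1) * (1 - σ)⁻¹ := by rw [← hlinv]; ring
  have x3 : p * (k - 1) * ((q + 1) / k) = p * t * (q + 1) := by rw [← hpkk]; ring
  have x4 : 1 * (t⁻¹ / l) = q / (q + 1) * t⁻¹ := by rw [← hlinv]; ring
  rw [x1] at r1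
  rw [x2] at r2
  rw [x3] at r3
  rw [x4] at r4
  have hcs : Continuous fun θ : sphere (0 : Euc N) 1 => r • (θ : Euc N) := by fun_prop
  have hms : ∀ F : Euc N → ℝ, Continuous F →
      Measurable fun θ : sphere (0 : Euc N) 1 => ENNReal.ofReal (F (r • (θ : Euc N))) :=
    fun F hF => (hF.comp hcs).measurable.ennreal_ofReal
  have hU1 : ContDiff ℝ 1 U := h.contU.of_le (by norm_num)
  have hV1 : ContDiff ℝ 1 V := h.contV.of_le (by norm_num)
  refine le_trans (lintegral_mono fun θ => ?_) (energy_combine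
    (hms _ ((continuous_gn hU1).add h.contU.continuous))
    (hms _ ((continuous_gn hV1).add h.contV.continuous)) (hms _ h.contV.continuous) hp hq ht htp
    (s := σ⁻¹) (s' := (1 - σ)⁻¹) ?_ hY1 r1 r2 r3 r4 g5 (le_max_of_le_left (le_max_left _ _))
    (le_max_of_le_left (le_max_right _ _)) (le_max_right _ _))
  · have hU0 := h.U_nonneg (r • (θ : Euc N))
    have hV0 := h.V_nonneg (r • (θ : Euc N))
    simp only [Pi.add_apply]
    rw [en, pot, ENNReal.ofReal_rpow_of_nonneg hU0 hq1.le,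
      ENNReal.ofReal_rpow_of_nonneg hV0 (by linarith),
      ← ENNReal.ofReal_mul (add_nonneg (gn_nonneg _ _) hU0),
      ← ENNReal.ofReal_add (by positivity) (by positivity),
      ← ENNReal.ofReal_add (by positivity)
        (mul_nonneg (add_nonneg (gn_nonneg _ _) hU0) (add_nonneg (gn_nonneg _ _) hV0))]
  · rw [Real.holderConjugate_iff]
    refine ⟨(one_lt_inv₀ hσ0).2 (by linarith), by rw [inv_inv, inv_inv]; ring⟩

lemma exists_exponent (hN : 3 ≤ N) {p q : ℝ} (hp : 0 < p) (hq : 0 < q)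
    (hα : ((N : ℝ) - 3) * (p * q - 1) < 2 * (p + 1)) : ∃ t : ℝ, 0 < t ∧ p * t * (q + 1) < 1 ∧
      ((N : ℝ) - 1) * (q / (q + 1) - t) < 2 := by
  have hN' : (3 : ℝ) ≤ N := by exact_mod_cast hN
  have hn : (0 : ℝ) < N - 1 := by linarith
  have hlt : max 0 (q / (q + 1) - 2 / ((N : ℝ) - 1)) < 1 / (p * (q + 1)) := by
    refine max_lt (by positivity) ?_
    rw [div_sub_div _ _ (by positivity) hn.ne', div_lt_div_iff₀ (by positivity) (by positivity)]
    nlinarith [mul_pos hp (by linarith : 0 < q + 1)]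
  obtain ⟨t, h1, h2⟩ := exists_between hlt
  have h0 := (le_max_left _ _).trans_lt h1
  have h3 := (le_max_right _ _).trans_lt h1
  refine ⟨t, h0, ?_, ?_⟩
  · rw [lt_div_iff₀ (by positivity)] at h2; linarith
  · have : q / (q + 1) - t < 2 / ((N : ℝ) - 1) := by linarith
    rw [lt_div_iff₀ hn] at this; linarith

/-- The feedback inequality: the energy in a small ball is controlled by a sublinear power of the
energy in a larger one. -/
lemma feedback (hN : 3 ≤ N) {p q m M : ℝ} (hp : 0 < p) (hq : 0 < q) (hpq : 1 < p * q)
    (hm : 0 < m) (hyp : (N : ℝ) - 2 < N / (p + 1) + N / (q + 1))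
    (hα : ((N : ℝ) - 3) * (p * q - 1) < 2 * (p + 1)) :
    ∃ ε > 0, ∃ C : ENNReal, C ≠ ⊤ ∧ ∃ b : ℝ, 0 ≤ b ∧ b < 1 ∧ ∀ U V c d : Euc N → ℝ,
      Sys p q m M ε 20 U V c d →
      ∫⁻ x in closedBall 0 1, ENNReal.ofReal (pot p q U V x) ≤
        C * (1 + ∫⁻ y in closedBall 0 6, ENNReal.ofReal (pot p q U V y)) ^ b := by
  obtain ⟨t, ht, ht1, ht2⟩ := exists_exponent hN hp hq hα
  obtain ⟨ε, hε, C1, hC1, h1⟩ := pohozaev (M := M) hN hp hq hm hyp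
  obtain ⟨C2, hC2, b, hb0, hb1, h2⟩ := boundary_energy (M := M) hN hp hq hpq hm ht ht1 ht2
  refine ⟨ε, hε, C1 * C2, by finiteness, b, hb0, hb1, fun U V c d h => ?_⟩
  obtain ⟨r, hr, h3⟩ := h2 ε U V c d h
  rw [mul_assoc]
  exact (h1 U V c d h r hr).trans (mul_le_mul_right h3 _)

lemma growth_contradiction {b δ A B A' B' : ℝ} (hb0 : 0 ≤ b) (hb1 : b < 1) (hB : 0 < B) :
    ∃ n : ℕ, ∀ τ : ℕ → ℝ, (∀ i, i < n → τ i ≤ δ + b * τ (i + 1)) →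
      (∀ i, 1 ≤ i → i ≤ n → A + B * i ≤ τ i) → (τ n ≤ A' + B' * n) → False := by
  have hstep : ∀ (n : ℕ) (τ : ℕ → ℝ), (∀ i, i < n → τ i ≤ δ + b * τ (i + 1)) →
      ∀ k i : ℕ, i + k ≤ n → τ i ≤ |δ| / (1 - b) + b ^ k * τ (i + k) := by
    intro n τ h k
    have h1b : 0 < 1 - b := by linarith
    induction k with
    | zero => intro i _; simp; positivity
    | succ k ih =>
      intro i hi
      have h1 := ih (i + 1) (by omega)
      have h2 := h i (by omega)
      have e : δ + b * (|δ| / (1 - b) + b ^ k * τ (i + 1 + k)) ≤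
          |δ| / (1 - b) + b ^ (k + 1) * τ (i + (k + 1)) := by
        have : |δ| + b * (|δ| / (1 - b)) = |δ| / (1 - b) := by field_simp; ring
        rw [show i + 1 + k = i + (k + 1) by ring, pow_succ]
        nlinarith [le_abs_self δ]
      exact h2.trans ((add_le_add_right (mul_le_mul_of_nonneg_left h1 hb0) _).trans e)
  have h1 : Tendsto (fun i : ℕ => b ^ i * (A' + B' * (2 * i))) atTop (nhds 0) := by
    have e1 := (tendsto_pow_atTop_nhds_zero_of_lt_one hb0 hb1).mul_const A'
    have e2 := (tendsto_self_mul_const_pow_of_lt_one hb0 hb1).const_mul (2 * B')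
    have := e1.add e2
    simp only [zero_mul, mul_zero, add_zero] at this
    refine this.congr fun i => ?_
    ring
  have h2 : Tendsto (fun i : ℕ => A + B * (i : ℝ)) atTop atTop :=
    tendsto_atTop_add_const_left _ _ (tendsto_natCast_atTop_atTop.const_mul_atTop hB)
  obtain ⟨i, hi1, hi2, hi3⟩ := ((h1.eventually (gt_mem_nhds (zero_lt_one))).and
    ((h2.eventually (eventually_gt_atTop (|δ| / (1 - b) + 1))).and
      (eventually_ge_atTop 1))).exists
  refine ⟨2 * i, fun τ ha hl hu => ?_⟩
  have h3 := hstep _ τ ha i i (by omega)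
  have h4 := hl i hi3 (by omega)
  rw [show i + i = 2 * i by ring] at h3
  have h5 : b ^ i * τ (2 * i) ≤ b ^ i * (A' + B' * (2 * i)) := by
    have := mul_le_mul_of_nonneg_left hu (pow_nonneg hb0 i)
    push_cast at this
    exact this
  linarith

lemma lintegral_closedBall_comp_smul {F : Euc N → ENNReal} (hF : Measurable F) {r : ℝ} (hr : 0 < r)
    (a : ℝ) : ∫⁻ y in closedBall 0 (a * r), F y =
      ENNReal.ofReal (r ^ N) * ∫⁻ y in closedBall 0 a, F (r • y) := by
  have h := Measure.map_addHaar_smul (volume : Measure (Euc N)) hr.ne'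
  have hm : Measurable fun y : Euc N => r • y := by fun_prop
  have e : ∫⁻ y in closedBall 0 a, F (r • y) =
      ENNReal.ofReal ((r ^ N)⁻¹) * ∫⁻ y in closedBall 0 (a * r), F y := by
    rw [← lintegral_indicator measurableSet_closedBall, ← lintegral_indicator
      measurableSet_closedBall]
    have h2 := lintegral_map (μ := volume) (hF.indicator
      (measurableSet_closedBall (x := (0 : Euc N)) (ε := a * r))) hm
    rw [h, lintegral_smul_measure, finrank_euclideanSpace_fin, abs_of_pos (by positivity)] at h2
    rw [← smul_eq_mul, h2]
    refine lintegral_congr fun y => ?_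
    simp only [indicator, mem_closedBall_zero_iff, norm_smul, Real.norm_of_nonneg hr.le]
    have : ‖y‖ ≤ a ↔ r * ‖y‖ ≤ a * r := by
      rw [mul_comm a, mul_le_mul_iff_right₀ hr]
    simp only [this]
  rw [e, ← mul_assoc, ← ENNReal.ofReal_mul (by positivity), mul_inv_cancel₀ (by positivity),
    ENNReal.ofReal_one, one_mul]

lemma lintegral_pot_rescale {p q α β r : ℝ} (hp : 0 < p) (hq : 0 < q) (hr : 0 < r)
    (h1 : α + 2 = β * p) (h2 : β + 2 = α * q) {U V : Euc N → ℝ} (hU : Continuous U)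
    (hV : Continuous V) (hU0 : ∀ x, 0 ≤ U x) (hV0 : ∀ x, 0 ≤ V x) (a : ℝ) :
    ∫⁻ y in closedBall 0 a, ENNReal.ofReal
      (pot p q (fun y => r ^ α * U (r • y)) (fun y => r ^ β * V (r • y)) y) =
    ENNReal.ofReal (r ^ (α + β + 2 - N)) *
      ∫⁻ y in closedBall 0 (a * r), ENNReal.ofReal (pot p q U V y) := by
  rw [lintegral_closedBall_comp_smul (continuous_pot hp hq hU hV).measurable.ennreal_ofReal hr,
    ← mul_assoc, ← ENNReal.ofReal_mul (by positivity), ← Real.rpow_natCast r N,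
    ← Real.rpow_add hr, sub_add_cancel,
    ← lintegral_const_mul' _ _ ENNReal.ofReal_ne_top]
  refine lintegral_congr fun y => ?_
  rw [← ENNReal.ofReal_mul (by positivity), pot, pot, Real.mul_rpow (by positivity) (hU0 _),
    Real.mul_rpow (by positivity) (hV0 _), ← Real.rpow_mul hr.le, ← Real.rpow_mul hr.le,
    show α * (q + 1) = α + β + 2 by linarith, show β * (p + 1) = α + β + 2 by linarith, mul_add]

lemma value_le_energy (hN : 3 ≤ N) {p q m M K : ℝ} (hp : 0 < p) (hq : 0 < q) (hm : 0 < m)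
    (hK : 0 ≤ K) : ∃ C : ENNReal, C ≠ ⊤ ∧ ∃ s : ℝ, 0 < s ∧ ∀ (ε : ℝ) (U V c d : Euc N → ℝ),
      Sys p q m M ε 20 U V c d → (∀ x ∈ closedBall (0 : Euc N) 6, U x ≤ K) →
      (∀ x ∈ closedBall (0 : Euc N) 6, V x ≤ K) →
      ENNReal.ofReal (U 0) ≤
        C * (∫⁻ y in closedBall 0 6, ENNReal.ofReal (pot p q U V y)) ^ (1 / s) := by
  have hN' : (3 : ℝ) ≤ N := by exact_mod_cast hN
  obtain ⟨A, hA, hval⟩ := value_le hN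
  set s := (N : ℝ) + (q + 1) + (p + 1) / p with hs
  have hpp : 0 < (p + 1) / p := by positivity
  have hsN : (N : ℝ) < s := by rw [hs]; linarith
  have hs1 : 1 < s := by linarith
  have hconj := Real.HolderConjugate.conjExponent hs1
  set s' := s.conjExponent with hs'
  have hs'0 : 0 < s' := hconj.symm.pos
  have hs'e : s' = s / (s - 1) := rfl
  have hsq : 0 ≤ s - (q + 1) := by rw [hs]; linarith
  have hsp : 0 ≤ p * s - (p + 1) := by
    have : p * ((p + 1) / p) = p + 1 := by field_simp
    rw [hs, mul_add, this]
    nlinarith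
  have hl : ((N : ℝ) - 2) * s' < N := by
    rw [hs'e, mul_div_assoc', div_lt_iff₀ (by linarith)]; nlinarith
  obtain ⟨D, hD, hkk⟩ := kk_bound hN hl
  set W := volume (closedBall (0 : Euc N) 6)
  have hW : W ≠ ⊤ := measure_closedBall_lt_top.ne
  set κ := ENNReal.ofReal (M ^ s * K ^ (p * s - (p + 1))) with hκ
  set η := ENNReal.ofReal (K ^ (s - (q + 1))) with hη
  have fin : ∀ {x : ENNReal} {y : ℝ}, 0 ≤ y → x ≠ ⊤ → x ^ y ≠ ⊤ :=
    fun hy hx => ENNReal.rpow_ne_top_of_nonneg hy hx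
  have hs0 : 0 ≤ 1 / s := by positivity
  have hs'1 : 0 ≤ 1 / s' := by positivity
  refine ⟨ENNReal.ofReal A * (κ ^ (1 / s) * D ^ (1 / s') + η ^ (1 / s) * W ^ (1 / s')), ?_, s,
    by linarith, fun ε U V c d h hUK hVK => ?_⟩
  · have a1 := fin hs0 (ENNReal.ofReal_ne_top : κ ≠ ⊤)
    have a2 := fin hs'1 hD
    have a3 := fin hs0 (ENNReal.ofReal_ne_top : η ≠ ⊤)
    have a4 := fin hs'1 hW
    finiteness
  set X := ∫⁻ y in closedBall 0 6, ENNReal.ofReal (pot p q U V y) with hX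
  have hmem : ∀ y ∈ closedBall (0 : Euc N) 6, y ∈ ball (0 : Euc N) 20 := fun y hy =>
    closedBall_subset_ball (by norm_num) hy
  have hM : 0 ≤ M := by
    have h0 : (0 : Euc N) ∈ ball (0 : Euc N) 20 := by simp
    linarith [h.c_ge 0 h0, h.c_le 0 h0]
  have hsplit : ∀ {x y z : ℝ}, 0 < y → y ≤ K → 0 ≤ z → y ^ (x + z) ≤ K ^ z * y ^ x := by
    intro x y z hy hyK hz
    rw [Real.rpow_add hy, mul_comm]
    exact mul_le_mul_of_nonneg_right (Real.rpow_le_rpow hy.le hyK hz) (by positivity)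
  have i1 : ∫⁻ y in closedBall 0 6, ENNReal.ofReal (-lap U y) ^ s ≤ κ * X := by
    rw [hX, ← lintegral_const_mul' _ _ ENNReal.ofReal_ne_top]
    refine setLIntegral_mono' measurableSet_closedBall fun y hy => ?_
    have hU0 := h.U_nonneg y
    have hV0 := h.V_pos y (hmem y hy)
    have hc0 : 0 ≤ c y := hm.le.trans (h.c_ge y (hmem y hy))
    rw [h.eqU y (hmem y hy), ENNReal.ofReal_rpow_of_nonneg (by positivity) (by linarith),
      ← ENNReal.ofReal_mul (by positivity), Real.mul_rpow hc0 (by positivity), mul_assoc,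
      ← Real.rpow_mul hV0.le]
    refine ENNReal.ofReal_le_ofReal (mul_le_mul (Real.rpow_le_rpow hc0 (h.c_le y (hmem y hy))
      (by linarith)) ?_ (by positivity) (by positivity))
    have := hsplit (x := p + 1) hV0 (hVK y hy) hsp
    rw [add_sub_cancel] at this
    refine this.trans (mul_le_mul_of_nonneg_left ?_ (by positivity))
    rw [pot]
    exact le_add_of_nonneg_left (by positivity)
  have i2 : ∫⁻ y in closedBall 0 6, ENNReal.ofReal (U y) ^ s ≤ η * X := by
    rw [hX, ← lintegral_const_mul' _ _ ENNReal.ofReal_ne_top]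
    refine setLIntegral_mono' measurableSet_closedBall fun y hy => ?_
    have hU0 := h.U_pos y (hmem y hy)
    have hV0 := h.V_nonneg y
    rw [ENNReal.ofReal_rpow_of_nonneg hU0.le (by linarith), ← ENNReal.ofReal_mul (by positivity)]
    refine ENNReal.ofReal_le_ofReal ?_
    have := hsplit (x := q + 1) hU0 (hUK y hy) hsq
    rw [add_sub_cancel] at this
    refine this.trans (mul_le_mul_of_nonneg_left ?_ (by positivity))
    rw [pot]
    exact le_add_of_nonneg_right (by positivity)
  have hfm := measurable_neg_lap h.contU
  have hum : Measurable fun y => ENNReal.ofReal (U y) :=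
    h.contU.continuous.measurable.ennreal_ofReal
  have j1 : ∫⁻ y in closedBall 0 6, ENNReal.ofReal (-lap U y) * kk (N - 2) 0 y ≤
      κ ^ (1 / s) * D ^ (1 / s') * X ^ (1 / s) := by
    refine (ENNReal.lintegral_mul_le_Lp_mul_Lq _ hconj hfm.aemeasurable
      (measurable_kk _ 0).aemeasurable).trans ?_
    rw [mul_right_comm, ← ENNReal.mul_rpow_of_nonneg _ _ hs0]
    refine mul_le_mul' (ENNReal.rpow_le_rpow i1 hs0) (ENNReal.rpow_le_rpow ?_ hs'1)
    refine le_trans ?_ (hkk 0 (by simp))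
    refine le_trans (lintegral_mono_set (closedBall_subset_closedBall (by norm_num :
      (6 : ℝ) ≤ 10))) (lintegral_mono fun y => le_of_eq ?_)
    rw [kk, kk, ← ENNReal.rpow_mul, neg_mul]
  have j2 : ENNReal.ofReal (∫ y in ann N, U y) ≤ η ^ (1 / s) * W ^ (1 / s') * X ^ (1 / s) := by
    rw [ofReal_integral_eq_lintegral_ofReal (integrableOn_ann h.contU.continuous)
      (ae_of_all _ h.U_nonneg)]
    refine (lintegral_mono_set (t := closedBall 0 6) sdiff_subset).trans ?_
    have := ENNReal.lintegral_mul_le_Lp_mul_Lq (volume.restrict (closedBall (0 : Euc N) 6)) hconj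
      hum.aemeasurable (g := fun _ => 1) aemeasurable_const
    simp only [Pi.mul_apply, mul_one, ENNReal.one_rpow, lintegral_const, one_mul,
      Measure.restrict_apply_univ] at this
    refine this.trans ?_
    rw [mul_right_comm, ← ENNReal.mul_rpow_of_nonneg _ _ hs0]
    exact mul_le_mul_left (ENNReal.rpow_le_rpow i2 hs0) _
  refine (Real.ofReal_le_enorm _).trans ((hval U h.contU h.U_nonneg (fun x hx =>
    h.lapU_nonpos hm.le (hmem x hx)) 0 (by simp)).trans ?_)
  rw [mul_assoc, add_mul]
  exact mul_le_mul_right (add_le_add j1 j2) _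

lemma pot_symm (p q : ℝ) (U V : Euc N → ℝ) : pot q p V U = pot p q U V := by
  funext x; rw [pot, pot, add_comm]

lemma le_of_rpow_bound {C X : ENNReal} {δ s : ℝ} (hs : 0 < s) (h : ENNReal.ofReal δ ≤
    C * X ^ (1 / s)) : (ENNReal.ofReal δ / (C + 1)) ^ s ≤ X := by
  have h1 : ENNReal.ofReal δ / (C + 1) ≤ X ^ (1 / s) := by
    refine ENNReal.div_le_of_le_mul' (h.trans (mul_le_mul_left le_self_add _))
  calc _ ≤ (X ^ (1 / s)) ^ s := ENNReal.rpow_le_rpow h1 hs.le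
    _ = X := by rw [← ENNReal.rpow_mul, one_div_mul_cancel hs.ne', ENNReal.rpow_one]

lemma energy_lower (hN : 3 ≤ N) {p q m M α β : ℝ} (hp : 0 < p) (hq : 0 < q) (hm : 0 < m)
    (hα : 0 < α) (hβ : 0 < β) : ∃ c1 > 0, ∀ (ε : ℝ) (U V c d : Euc N → ℝ),
      Sys p q m M ε 20 U V c d → (∀ x ∈ closedBall (0 : Euc N) 6, U x ≤ 2 ^ α) →
      (∀ x ∈ closedBall (0 : Euc N) 6, V x ≤ 2 ^ β) → U 0 ^ (1 / α) + V 0 ^ (1 / β) = 1 →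
      ENNReal.ofReal c1 ≤ ∫⁻ y in closedBall 0 6, ENNReal.ofReal (pot p q U V y) := by
  set K := max ((2 : ℝ) ^ α) (2 ^ β)
  have hK : 0 ≤ K := le_max_of_le_left (by positivity)
  obtain ⟨C, hC, s, hs, h1⟩ := value_le_energy (M := M) hN hp hq hm hK
  obtain ⟨C', hC', s', hs', h2⟩ := value_le_energy (M := M) hN hq hp hm hK
  set w := min 1 (min ((ENNReal.ofReal (2⁻¹ ^ α) / (C + 1)) ^ s)
    ((ENNReal.ofReal (2⁻¹ ^ β) / (C' + 1)) ^ s')) with hw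
  have pos : ∀ {C : ENNReal} {a s : ℝ}, C ≠ ⊤ → 0 < s →
      0 < (ENNReal.ofReal (2⁻¹ ^ a) / (C + 1)) ^ s := by
    intro C a s hC hs
    refine ENNReal.rpow_pos_of_nonneg (ENNReal.div_pos ?_ (by finiteness)) hs.le
    rw [ENNReal.ofReal_ne_zero_iff]; positivity
  have hw0 : 0 < w := lt_min one_pos (lt_min (pos hC hs) (pos hC' hs'))
  have hwt : w ≠ ⊤ := ((min_le_left _ _).trans_lt ENNReal.one_lt_top).ne
  refine ⟨w.toReal, ENNReal.toReal_pos hw0.ne' hwt, fun ε U V c d h hU hV h0 => ?_⟩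
  rw [ENNReal.ofReal_toReal hwt]
  have hroot : ∀ {x a : ℝ}, 0 ≤ x → 0 < a → 2⁻¹ ≤ x ^ (1 / a) → 2⁻¹ ^ a ≤ x := by
    intro x a hx ha h
    calc (2⁻¹ : ℝ) ^ a ≤ (x ^ (1 / a)) ^ a := Real.rpow_le_rpow (by norm_num) h ha.le
      _ = x := by rw [← Real.rpow_mul hx, one_div_mul_cancel ha.ne', Real.rpow_one]
  rcases le_total (U 0 ^ (1 / α)) 2⁻¹ with h3 | h3
  · have h4 : 2⁻¹ ≤ V 0 ^ (1 / β) := by linarith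
    refine (min_le_right _ _).trans ((min_le_right _ _).trans (le_of_rpow_bound hs' ?_))
    have := h2 ε V U d c h.symm (fun x hx => (hV x hx).trans (le_max_right _ _))
      (fun x hx => (hU x hx).trans (le_max_left _ _))
    rw [pot_symm] at this
    exact (ENNReal.ofReal_le_ofReal (hroot (h.V_nonneg 0) hβ h4)).trans this
  · refine (min_le_right _ _).trans ((min_le_left _ _).trans (le_of_rpow_bound hs ?_))
    have := h1 ε U V c d h (fun x hx => (hU x hx).trans (le_max_left _ _))
      (fun x hx => (hV x hx).trans (le_max_right _ _))
    exact (ENNReal.ofReal_le_ofReal (hroot (h.U_nonneg 0) hα h3)).trans this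

/-- There is no normalised bounded solution on a ball of large radius. -/
lemma liouville (hN : 3 ≤ N) {p q m M α β : ℝ} (hp : 0 < p) (hq : 0 < q) (hpq : 1 < p * q)
    (hm : 0 < m) (hyp : (N : ℝ) / (p + 1) + (N : ℝ) / (q + 1) > (N : ℝ) - 2)
    (hα3 : ((N : ℝ) - 3) * (p * q - 1) < 2 * (p + 1)) (hα : 0 < α) (hβ : 0 < β)
    (h1 : α + 2 = β * p) (h2 : β + 2 = α * q) :
    ∃ ε > 0, ∃ R > 0, ∀ U V c d : Euc N → ℝ, Sys p q m M ε R U V c d →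
      (∀ x ∈ ball (0 : Euc N) R, U x ≤ 2 ^ α) → (∀ x ∈ ball (0 : Euc N) R, V x ≤ 2 ^ β) →
      U 0 ^ (1 / α) + V 0 ^ (1 / β) ≠ 1 := by
  obtain ⟨ε, hε, C, hC, b, hb0, hb1, hfeed⟩ := feedback (M := M) hN hp hq hpq hm hyp hα3
  obtain ⟨c1, hc1, hlow⟩ := energy_lower (M := M) hN hp hq hm hα hβ
  have hN' : (3 : ℝ) ≤ N := by exact_mod_cast hN
  set γ := α + β + 2 - N with hγ
  have hγ0 : 0 < γ := by
    have e1 : (N : ℝ) / (p + 1) = N * β / (α + β + 2) := by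
      rw [div_eq_div_iff (by positivity) (by positivity)]; linear_combination (N : ℝ) * h1
    have e2 : (N : ℝ) / (q + 1) = N * α / (α + β + 2) := by
      rw [div_eq_div_iff (by positivity) (by positivity)]; linear_combination (N : ℝ) * h2
    rw [e1, e2, ← add_div, gt_iff_lt, lt_div_iff₀ (by positivity)] at hyp
    rw [hγ]; nlinarith
  set g : ℝ := 6 ^ γ with hg
  have hg1 : 1 < g := Real.one_lt_rpow (by norm_num) hγ0
  have hg0 : 0 < g := by linarith
  set W := (volume (closedBall (0 : Euc N) 1)).toReal with hW
  set K := (2 : ℝ) ^ (α * (q + 1)) + 2 ^ (β * (p + 1)) with hK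
  have hK0 : 0 < K := by positivity
  obtain ⟨n, hn⟩ := growth_contradiction (δ := Real.log (1 + C.toReal)) (A := Real.log c1)
    (B := Real.log g) (A' := Real.log (1 + K * W)) (B' := Real.log (g * 6 ^ N)) hb0 hb1
    (Real.log_pos hg1)
  refine ⟨ε, hε, 20 * 6 ^ n, by positivity, fun U V c d h hU hV h0 => ?_⟩
  set X : ℕ → ENNReal := fun i => ∫⁻ y in closedBall 0 (6 ^ i), ENNReal.ofReal (pot p q U V y)
    with hX
  have hXt : ∀ i, X i ≠ ⊤ := fun i => (lintegral_ball_lt_top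
    (continuous_pot hp hq h.contU.continuous h.contV.continuous) _).ne
  have h6n : (1 : ℝ) ≤ 6 ^ n := one_le_pow₀ (by norm_num)
  have hmono : ∀ i j, i ≤ j → X i ≤ X j := fun i j hij => lintegral_mono_set
    (closedBall_subset_closedBall (pow_le_pow_right₀ (by norm_num) hij))
  have hx0 : ∀ i, 0 ≤ (X i).toReal := fun i => ENNReal.toReal_nonneg
  have hgi : ∀ i : ℕ, 0 < g ^ i := fun i => by positivity
  have hT : ∀ i, 1 ≤ 1 + g ^ i * (X i).toReal := fun i =>
    le_add_of_nonneg_right (mul_nonneg (hgi i).le (hx0 i))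
  refine hn (fun i => Real.log (1 + g ^ i * (X i).toReal)) ?_ ?_ ?_
  · intro i hi
    have hr : (0 : ℝ) < 6 ^ i := by positivity
    have hS := (h.rescale hr h1 h2).mono (R' := 20) (by
      rw [le_div_iff₀ hr]
      exact mul_le_mul_of_nonneg_left (pow_le_pow_right₀ (by norm_num) hi.le) (by norm_num))
    have h3 := hfeed _ _ _ _ hS
    rw [lintegral_pot_rescale hp hq hr h1 h2 h.contU.continuous h.contV.continuous h.U_nonneg
      h.V_nonneg, lintegral_pot_rescale hp hq hr h1 h2 h.contU.continuous h.contV.continuous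
      h.U_nonneg h.V_nonneg, one_mul, ← pow_succ'] at h3
    have e : ((6 : ℝ) ^ i) ^ (α + β + 2 - N) = g ^ i := by
      rw [hg, hγ, ← Real.rpow_natCast, ← Real.rpow_natCast, ← Real.rpow_mul (by norm_num),
        ← Real.rpow_mul (by norm_num), mul_comm]
    rw [e] at h3
    change ENNReal.ofReal (g ^ i) * X i ≤ C * (1 + ENNReal.ofReal (g ^ i) * X (i + 1)) ^ b at h3
    rw [← ENNReal.ofReal_toReal hC, ← ENNReal.ofReal_toReal (hXt i),
      ← ENNReal.ofReal_toReal (hXt (i + 1)), ← ENNReal.ofReal_mul (hgi i).le,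
      ← ENNReal.ofReal_mul (hgi i).le, ← ENNReal.ofReal_one, ← ENNReal.ofReal_add zero_le_one
        (mul_nonneg (hgi i).le (hx0 _)),
      ENNReal.ofReal_rpow_of_nonneg (by have := mul_nonneg (hgi i).le (hx0 (i + 1)); linarith) hb0,
      ← ENNReal.ofReal_mul ENNReal.toReal_nonneg, ENNReal.ofReal_le_ofReal_iff
        (mul_nonneg ENNReal.toReal_nonneg (Real.rpow_nonneg
          (by have := mul_nonneg (hgi i).le (hx0 (i + 1)); linarith) _))] at h3
    have h4 : 1 + g ^ i * (X (i + 1)).toReal ≤ 1 + g ^ (i + 1) * (X (i + 1)).toReal := by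
      have : g ^ i * (X (i + 1)).toReal ≤ g ^ (i + 1) * (X (i + 1)).toReal :=
        mul_le_mul_of_nonneg_right (pow_le_pow_right₀ hg1.le (Nat.le_succ i)) (hx0 (i + 1))
      linarith
    have h5 : (1 + g ^ i * (X (i + 1)).toReal) ^ b ≤
        (1 + g ^ (i + 1) * (X (i + 1)).toReal) ^ b :=
      Real.rpow_le_rpow (by have := mul_nonneg (hgi i).le (hx0 (i + 1)); linarith) h4 hb0
    have h6 : 1 ≤ (1 + g ^ (i + 1) * (X (i + 1)).toReal) ^ b :=
      Real.one_le_rpow (hT (i + 1)) hb0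
    have hC0 : 0 ≤ C.toReal := ENNReal.toReal_nonneg
    rw [← Real.log_rpow (by linarith [hT (i + 1)]), ← Real.log_mul (by positivity) (by positivity)]
    refine Real.log_le_log (by linarith [hT i]) ?_
    nlinarith [mul_le_mul_of_nonneg_left h5 hC0]
  · intro i hi hin
    have hX1 : ENNReal.ofReal c1 ≤ X 1 := by
      have hsub : ∀ x ∈ closedBall (0 : Euc N) 6, x ∈ ball (0 : Euc N) (20 * 6 ^ n) := fun x hx =>
        closedBall_subset_ball (by linarith) hx
      have := hlow ε U V c d (h.mono (by linarith)) (fun x hx => hU x (hsub x hx))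
        (fun x hx => hV x (hsub x hx)) h0
      simpa [hX] using this
    have h3 : c1 ≤ (X i).toReal := (ENNReal.ofReal_le_iff_le_toReal (hXt i)).1
      (hX1.trans (hmono 1 i hi))
    rw [mul_comm (Real.log g), ← Real.log_pow, ← Real.log_mul hc1.ne' (hgi i).ne', mul_comm]
    refine Real.log_le_log (by positivity) ?_
    have := mul_le_mul_of_nonneg_left h3 (hgi i).le
    linarith
  · have h3 : X n ≤ ENNReal.ofReal (K * ((6 ^ n) ^ N * W)) := by
      have : X n ≤ ∫⁻ _ in closedBall (0 : Euc N) (6 ^ n), ENNReal.ofReal K := by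
        refine setLIntegral_mono' measurableSet_closedBall fun x hx => ENNReal.ofReal_le_ofReal ?_
        have hx' : x ∈ ball (0 : Euc N) (20 * 6 ^ n) :=
          closedBall_subset_ball (by linarith) hx
        rw [pot, hK, Real.rpow_mul (by norm_num), Real.rpow_mul (by norm_num)]
        exact add_le_add (Real.rpow_le_rpow (h.U_nonneg x) (hU x hx') (by linarith))
          (Real.rpow_le_rpow (h.V_nonneg x) (hV x hx') (by linarith))
      refine this.trans (le_of_eq ?_)
      rw [setLIntegral_const, ENNReal.ofReal_mul hK0.le, ENNReal.ofReal_mul (by positivity), hW,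
        ENNReal.ofReal_toReal measure_closedBall_lt_top.ne]
      have := Measure.addHaar_closedBall_mul (volume : Measure (Euc N)) 0
        (by positivity : (0 : ℝ) ≤ 6 ^ n) zero_le_one
      rw [mul_one, finrank_euclideanSpace_fin] at this
      rw [this]
    have hW0 : 0 ≤ W := ENNReal.toReal_nonneg
    have h4 := ENNReal.toReal_le_of_le_ofReal (by positivity) h3
    rw [mul_comm (Real.log (g * 6 ^ N)), ← Real.log_pow,
      ← Real.log_mul (by positivity) (by positivity)]
    refine Real.log_le_log (by linarith [hT n]) ?_
    have h5 := mul_le_mul_of_nonneg_left h4 (hgi n).le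
    have h6 : 1 ≤ (g * 6 ^ N) ^ n :=
      one_le_pow₀ (one_le_mul_of_one_le_of_one_le hg1.le (one_le_pow₀ (by norm_num)))
    have h7 : g ^ n * (K * ((6 ^ n) ^ N * W)) = K * W * (g * 6 ^ N) ^ n := by
      rw [mul_pow, ← pow_mul, ← pow_mul, mul_comm n N]; ring
    rw [h7] at h5
    rw [add_mul, one_mul]
    exact add_le_add h6 h5

lemma abs_drift_norm_rpow_le {z x : Euc N} {t : ℝ} (a : ℝ) (h0 : z + t • x ≠ 0) :
    |∑ i, x i * pd i (fun y => ‖z + t • y‖ ^ a) x| ≤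
      |t| * |a| * ‖x‖ * ‖z + t • x‖ ^ a / ‖z + t • x‖ := by
  set w := z + t • x with hw
  have hw0 : 0 < ‖w‖ := norm_pos_iff.2 h0
  have e1 : (fun y : Euc N => ‖y‖ ^ a) = fun y => (‖y - 0‖ ^ 2) ^ (a / 2) := by
    funext y
    rw [sub_zero, ← Real.rpow_natCast, ← Real.rpow_mul (norm_nonneg _)]
    congr 1; push_cast; ring
  have hG : HasDerivAt (fun s : ℝ => s ^ (a / 2)) (a / 2 * (‖w - 0‖ ^ 2) ^ (a / 2 - 1))
      (‖w - 0‖ ^ 2) := Real.hasDerivAt_rpow_const (Or.inl (by rw [sub_zero]; positivity))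
  have hpd : ∀ i, pd i (fun y : Euc N => ‖y‖ ^ a) w = a * ‖w‖ ^ (a - 2) * w i := by
    intro i
    rw [e1, pd_radial hG, sub_zero, ← Real.rpow_natCast, ← Real.rpow_mul (norm_nonneg _)]
    have : ((2 : ℕ) : ℝ) * (a / 2 - 1) = a - 2 := by push_cast; ring
    rw [this]; simp; ring
  have hd : DifferentiableAt ℝ (fun y : Euc N => ‖y‖ ^ a) w :=
    (differentiableAt_id.norm ℝ h0).rpow_const (Or.inl hw0.ne')
  have hsum : ∑ i, x i * pd i (fun y => ‖z + t • y‖ ^ a) x =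
      t * (a * ‖w‖ ^ (a - 2)) * inner ℝ w x := by
    rw [PiLp.inner_apply, Finset.mul_sum]
    refine Finset.sum_congr rfl fun i _ => ?_
    rw [pd_affine (f := fun y : Euc N => ‖y‖ ^ a) hd, hpd]
    simp; ring
  have e2 : ‖w‖ ^ (a - 2) * ‖w‖ = ‖w‖ ^ a / ‖w‖ := by
    rw [eq_div_iff hw0.ne', mul_assoc, ← sq, ← Real.rpow_natCast, ← Real.rpow_add hw0]
    congr 1; push_cast; ring
  rw [hsum, abs_mul, abs_mul, abs_mul, abs_of_nonneg (Real.rpow_nonneg (norm_nonneg w) _)]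
  calc |t| * (|a| * ‖w‖ ^ (a - 2)) * |inner ℝ w x|
      ≤ |t| * (|a| * ‖w‖ ^ (a - 2)) * (‖w‖ * ‖x‖) := by
        gcongr; exact abs_real_inner_le_norm _ _
    _ = |t| * |a| * ‖x‖ * (‖w‖ ^ (a - 2) * ‖w‖) := by ring
    _ = _ := by rw [e2]; ring

lemma rpow_near_one {t a K : ℝ} (h1 : 1 / 2 ≤ t) (h2 : t ≤ 2) (ha : |a| ≤ K) :
    2 ^ (-K) ≤ t ^ a ∧ t ^ a ≤ 2 ^ K := by
  have ht : 0 < t := by linarith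
  have hlog : |Real.log t| ≤ Real.log 2 := by
    rw [abs_le]
    refine ⟨?_, Real.log_le_log ht h2⟩
    have := Real.log_le_log (by norm_num) h1
    rwa [one_div, Real.log_inv] at this
  have h : |Real.log t * a| ≤ Real.log 2 * K := by
    rw [abs_mul]
    exact mul_le_mul hlog ha (abs_nonneg _) ((abs_nonneg _).trans hlog)
  rw [abs_le] at h
  rw [Real.rpow_def_of_pos ht, Real.rpow_def_of_pos two_pos, Real.rpow_def_of_pos two_pos]
  exact ⟨Real.exp_le_exp.2 (by linarith), Real.exp_le_exp.2 (by linarith)⟩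

/-- Cutting off a function which is smooth near a ball gives a globally smooth function. -/
lemma contDiff_bump_mul_affine {n : ℕ∞} {f : Euc N → ℝ} {z : Euc N} {t R : ℝ} (hR : 0 ≤ R)
    (hf : ∀ y : Euc N, ‖y‖ ≤ R + 1 → ContDiffAt ℝ n f (z + t • y)) :
    ContDiff ℝ n (fun y => bump R y * f (z + t • y)) := by
  refine contDiff_iff_contDiffAt.2 fun y => ?_
  rcases lt_or_ge (R + 1) ‖y‖ with hy' | hy'
  · refine contDiffAt_const (c := (0 : ℝ)) |>.congr_of_eventuallyEq ?_
    filter_upwards [(isOpen_lt continuous_const continuous_norm).mem_nhds hy'] with x hx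
    rw [bump_eq_zero hR (le_of_lt hx), zero_mul]
  have ha : ContDiff ℝ n (fun y : Euc N => z + t • y) := by fun_prop
  exact (contDiff_bump R).contDiffAt.mul ((hf y hy').comp y ha.contDiffAt)

lemma bump_mul_eventuallyEq {f : Euc N → ℝ} {R : ℝ} {x : Euc N} (hx : x ∈ ball (0 : Euc N) R) :
    (fun y => bump R y * f y) =ᶠ[nhds x] f := by
  filter_upwards [isOpen_ball.mem_nhds hx] with y hy
  rw [bump_eq_one (mem_ball_zero_iff.1 hy).le, one_mul]

/-- Local form of the rescaled system around a point of the unit shell. -/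
lemma sys_of_solution {a b p q α β K ε R t : ℝ} {u v : Euc N → ℝ} {z : Euc N}
    (hR : 0 < R) (ht : 0 < t) (h1 : α + 2 = β * p) (h2 : β + 2 = α * q)
    (ha : |a| ≤ K) (hb : |b| ≤ K) (hε : 2 * (t * K * R * 2 ^ K) ≤ ε)
    (hn : ∀ y ∈ closedBall z (t * (R + 1)), 1 / 2 ≤ ‖y‖ ∧ ‖y‖ ≤ 2)
    (hu : ∀ y ∈ closedBall z (t * (R + 1)), ContDiffAt ℝ 2 u y)
    (hv : ∀ y ∈ closedBall z (t * (R + 1)), ContDiffAt ℝ 2 v y)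
    (hu0 : ∀ y ∈ closedBall z (t * (R + 1)), 0 < u y)
    (hv0 : ∀ y ∈ closedBall z (t * (R + 1)), 0 < v y)
    (equ : ∀ y ∈ closedBall z (t * (R + 1)), -lap u y = ‖y‖ ^ a * v y ^ p)
    (eqv : ∀ y ∈ closedBall z (t * (R + 1)), -lap v y = ‖y‖ ^ b * u y ^ q) :
    Sys p q (2 ^ (-K)) (2 ^ K) ε R (fun y => bump R y * (t ^ α * u (z + t • y)))
      (fun y => bump R y * (t ^ β * v (z + t • y))) (fun y => bump R y * ‖z + t • y‖ ^ a)
      (fun y => bump R y * ‖z + t • y‖ ^ b) := by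
  have hm : ∀ y : Euc N, ‖y‖ ≤ R + 1 → z + t • y ∈ closedBall z (t * (R + 1)) := fun y hy => by
    rw [mem_closedBall, dist_eq_norm, add_sub_cancel_left, norm_smul, Real.norm_of_nonneg ht.le]
    exact mul_le_mul_of_nonneg_left hy ht.le
  have hmb : ∀ y ∈ ball (0 : Euc N) R, z + t • y ∈ closedBall z (t * (R + 1)) := fun y hy =>
    hm y (by rw [mem_ball_zero_iff] at hy; linarith)
  have h1b : ∀ y ∈ ball (0 : Euc N) R, bump R y = 1 := fun y hy =>
    bump_eq_one (mem_ball_zero_iff.1 hy).le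
  have hne : ∀ y : Euc N, ‖y‖ ≤ R + 1 → z + t • y ≠ 0 := fun y hy h => by
    have := (hn _ (hm y hy)).1
    rw [h, norm_zero] at this; linarith
  have hcd : ∀ s : ℝ, ContDiff ℝ 1 (fun y => bump R y * ‖z + t • y‖ ^ s) := fun s =>
    contDiff_bump_mul_affine (n := 1) (f := fun y => ‖y‖ ^ s) hR.le fun y hy =>
      (contDiffAt_id.norm ℝ (hne y hy)).rpow_const_of_ne (norm_ne_zero_iff.2 (hne y hy))
  have hglob : ∀ {w : Euc N → ℝ} (s : ℝ),
      (∀ y ∈ closedBall z (t * (R + 1)), ContDiffAt ℝ 2 w y) →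
      ContDiff ℝ 2 (fun y => bump R y * (t ^ s * w (z + t • y))) := fun s hw =>
    contDiff_bump_mul_affine (n := 2) (f := fun y => t ^ s * _) hR.le fun y hy =>
      contDiffAt_const.mul (hw _ (hm y hy))
  have hnn : ∀ {w : Euc N → ℝ} (s : ℝ), (∀ y ∈ closedBall z (t * (R + 1)), 0 < w y) →
      ∀ y, 0 ≤ bump R y * (t ^ s * w (z + t • y)) := fun s hw y => by
    by_cases hy : ‖y‖ ≤ R + 1
    · exact mul_nonneg (bump_nonneg _ _) (mul_nonneg (Real.rpow_nonneg ht.le _) (hw _ (hm y hy)).le)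
    · rw [bump_eq_zero hR.le (le_of_not_ge hy), zero_mul]
  have heq : ∀ {w w' : Euc N → ℝ} {s s' r e : ℝ}, s + 2 = s' * r →
      (∀ y ∈ closedBall z (t * (R + 1)), ContDiffAt ℝ 2 w y) →
      (∀ y ∈ closedBall z (t * (R + 1)), 0 < w' y) →
      (∀ y ∈ closedBall z (t * (R + 1)), -lap w y = ‖y‖ ^ e * w' y ^ r) →
      ∀ x ∈ ball (0 : Euc N) R, -lap (fun y => bump R y * (t ^ s * w (z + t • y))) x =
        bump R x * ‖z + t • x‖ ^ e * (bump R x * (t ^ s' * w' (z + t • x))) ^ r := by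
    intro w w' s s' r e hs hw hw' hE x hx
    have ha : ContDiff ℝ 2 (fun y : Euc N => z + t • y) := by fun_prop
    rw [lap_congr (bump_mul_eventuallyEq (f := fun y => t ^ s * w (z + t • y)) hx),
      lap_const_mul (f := fun y => w (z + t • y)) _ ((hw _ (hmb x hx)).comp x ha.contDiffAt), lap_affine (hw _ (hmb x hx)),
      h1b x hx, one_mul, one_mul, Real.mul_rpow (Real.rpow_nonneg ht.le _) (hw' _ (hmb x hx)).le,
      ← Real.rpow_mul ht.le, ← hs, Real.rpow_add ht, Real.rpow_two]
    linear_combination t ^ s * t ^ 2 * hE _ (hmb x hx)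
  have hdrift : ∀ s : ℝ, |s| ≤ K → ∀ x ∈ ball (0 : Euc N) R,
      |∑ i, x i * pd i (fun y => bump R y * ‖z + t • y‖ ^ s) x| ≤ ε := by
    intro s hs x hx
    simp only [pd_congr (bump_mul_eventuallyEq (f := fun y => ‖z + t • y‖ ^ s) hx)]
    have hxR := mem_ball_zero_iff.1 hx
    obtain ⟨hl, hr⟩ := hn _ (hmb x hx)
    refine (abs_drift_norm_rpow_le s (hne x (by linarith))).trans (le_trans ?_ hε)
    rw [div_le_iff₀ (by linarith), abs_of_pos ht]
    have h3 : t * |s| * ‖x‖ * ‖z + t • x‖ ^ s ≤ t * K * R * 2 ^ K := by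
      have := (rpow_near_one hl hr hs).2
      have hK : 0 ≤ K := (abs_nonneg _).trans hs
      gcongr
    have h4 : 0 ≤ t * K * R * 2 ^ K := by
      have hK : 0 ≤ K := (abs_nonneg _).trans hs
      positivity
    nlinarith
  have hbd : ∀ s : ℝ, |s| ≤ K → ∀ x ∈ ball (0 : Euc N) R,
      2 ^ (-K) ≤ bump R x * ‖z + t • x‖ ^ s ∧ bump R x * ‖z + t • x‖ ^ s ≤ 2 ^ K := by
    intro s hs x hx
    rw [h1b x hx, one_mul]
    exact rpow_near_one (hn _ (hmb x hx)).1 (hn _ (hmb x hx)).2 hs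
  exact
    { contU := hglob α hu
      contV := hglob β hv
      contc := hcd a
      contd := hcd b
      U_nonneg := hnn α hu0
      V_nonneg := hnn β hv0
      U_pos := fun x hx => by
        rw [h1b x hx, one_mul]
        exact mul_pos (Real.rpow_pos_of_pos ht _) (hu0 _ (hmb x hx))
      V_pos := fun x hx => by
        rw [h1b x hx, one_mul]
        exact mul_pos (Real.rpow_pos_of_pos ht _) (hv0 _ (hmb x hx))
      eqU := heq h1 hu hv0 equ
      eqV := heq h2 hv hu0 eqv
      c_ge := fun x hx => (hbd a ha x hx).1
      d_ge := fun x hx => (hbd b hb x hx).1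
      c_le := fun x hx => (hbd a ha x hx).2
      d_le := fun x hx => (hbd b hb x hx).2
      c_drift := hdrift a ha
      d_drift := hdrift b hb }

/-- The doubling property: a continuous positive function on a ball has a point at which it is
comparatively large and nearly maximal on a ball of comparable size. -/
lemma exists_doubling_point {f : Euc N → ℝ} {x0 : Euc N} {r : ℝ} (hr : 0 < r)
    (hf : ContinuousOn f (closedBall x0 r)) (h0 : 0 < f x0) :
    ∃ z, ∃ s, 0 < s ∧ s ≤ r ∧ closedBall z (s / 2) ⊆ ball x0 r ∧ r * f x0 ≤ s * f z ∧
      ∀ y ∈ closedBall z (s / 2), f y ≤ 2 * f z := by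
  obtain ⟨z, hz, hmax⟩ := (isCompact_closedBall x0 r).exists_isMaxOn
    ⟨x0, mem_closedBall_self hr.le⟩ (f := fun x => (r - dist x x0) * f x)
    (((continuous_const.sub (continuous_id.dist continuous_const)).continuousOn).mul hf)
  have hz0 : r * f x0 ≤ (r - dist z x0) * f z := by
    simpa using hmax (mem_closedBall_self hr.le)
  have hzr : dist z x0 ≤ r := hz
  have hpos : 0 < (r - dist z x0) * f z := (mul_pos hr h0).trans_le hz0
  have hs : 0 < r - dist z x0 := lt_of_le_of_ne (by linarith) fun h => by
    rw [← h, zero_mul] at hpos; exact lt_irrefl _ hpos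
  have hball : ∀ y ∈ closedBall z ((r - dist z x0) / 2),
      (r - dist z x0) / 2 ≤ r - dist y x0 := fun y hy => by
    have := dist_triangle y z x0
    rw [mem_closedBall] at hy; linarith
  refine ⟨z, r - dist z x0, hs, by linarith [dist_nonneg (x := z) (y := x0)], fun y hy => ?_, hz0,
    fun y hy => ?_⟩
  · rw [mem_ball]; linarith [hball y hy]
  · have hfz : 0 < f z := (pos_iff_pos_of_mul_pos hpos).1 hs
    by_contra! hc
    have h1 : (r - dist y x0) * f y ≤ (r - dist z x0) * f z :=
      hmax (show y ∈ closedBall x0 r by rw [mem_closedBall]; linarith [hball y hy])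
    have h2 := mul_le_mul_of_nonneg_right (hball y hy) (by linarith : 0 ≤ f y)
    nlinarith

lemma le_rpow_of_rpow_le {x y α : ℝ} (hx : 0 ≤ x) (hα : 0 < α) (h : x ^ (1 / α) ≤ y) :
    x ≤ y ^ α := by
  have := Real.rpow_le_rpow (Real.rpow_nonneg hx _) h hα.le
  rwa [← Real.rpow_mul hx, one_div_mul_cancel hα.ne', Real.rpow_one] at this

/-- Universal bound for positive solutions near a point of the unit sphere. -/
lemma unit_bound (hN : 3 ≤ N) {p q α β : ℝ} (a b : ℝ) (hp : 0 < p) (hq : 0 < q)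
    (hpq : 1 < p * q) (hyp : (N : ℝ) / (p + 1) + (N : ℝ) / (q + 1) > (N : ℝ) - 2)
    (hα3 : ((N : ℝ) - 3) * (p * q - 1) < 2 * (p + 1)) (hα : 0 < α) (hβ : 0 < β)
    (h1 : α + 2 = β * p) (h2 : β + 2 = α * q) :
    ∃ C > 0, ∀ (u v : Euc N → ℝ) (x0 : Euc N), ‖x0‖ = 1 →
      (∀ y ∈ ball x0 (1 / 2), ContDiffAt ℝ 2 u y ∧ ContDiffAt ℝ 2 v y ∧ 0 < u y ∧ 0 < v y ∧
        -lap u y = ‖y‖ ^ a * v y ^ p ∧ -lap v y = ‖y‖ ^ b * u y ^ q) → u x0 ≤ C ∧ v x0 ≤ C := by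
  set K := |a| + |b| with hK
  have hK0 : 0 ≤ K := by positivity
  obtain ⟨ε, hε, R, hR, hliou⟩ := liouville (N := N) (m := 2 ^ (-K)) (M := 2 ^ K) hN hp hq hpq
    (by positivity) hyp hα3 hα hβ h1 h2
  set C := 8 * (R + 1) + 2 * (K * R * 2 ^ K) / ε with hC
  have hC0 : 0 < C := by positivity
  refine ⟨C ^ α + C ^ β, by positivity, fun u v x0 hx0 H => ?_⟩
  set f : Euc N → ℝ := fun y => u y ^ (1 / α) + v y ^ (1 / β) with hf
  have hsub : closedBall x0 (1 / 4) ⊆ ball x0 (1 / 2) := closedBall_subset_ball (by norm_num)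
  have hx0m : x0 ∈ ball x0 (1 / 2) := mem_ball_self (by norm_num)
  have hupos : ∀ y ∈ ball x0 (1 / 2), 0 < u y ^ (1 / α) := fun y hy =>
    Real.rpow_pos_of_pos (H y hy).2.2.1 _
  have hvpos : ∀ y ∈ ball x0 (1 / 2), 0 < v y ^ (1 / β) := fun y hy =>
    Real.rpow_pos_of_pos (H y hy).2.2.2.1 _
  have huf : ∀ y ∈ ball x0 (1 / 2), u y ^ (1 / α) ≤ f y := fun y hy => by
    have := hvpos y hy; simp only [hf]; linarith
  have hvf : ∀ y ∈ ball x0 (1 / 2), v y ^ (1 / β) ≤ f y := fun y hy => by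
    have := hupos y hy; simp only [hf]; linarith
  have hfC : f x0 ≤ C := by
    by_contra! hlt
    have hfc : ContinuousOn f (closedBall x0 (1 / 4)) := fun y hy => by
      obtain ⟨hu, hv, hu0, hv0, -⟩ := H y (hsub hy)
      exact ((hu.continuousAt.rpow_const (Or.inl hu0.ne')).add
        (hv.continuousAt.rpow_const (Or.inl hv0.ne'))).continuousWithinAt
    obtain ⟨z, s, hs, hs1, hzs, hbig, hdbl⟩ :=
      exists_doubling_point (by norm_num : (0 : ℝ) < 1 / 4) hfc (hC0.trans hlt)
    have hfz : 0 < f z := (pos_iff_pos_of_mul_pos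
      (lt_of_lt_of_le (by linarith : 0 < 1 / 4 * f x0) hbig)).1 hs
    set t := (f z)⁻¹ with ht
    have ht0 : 0 < t := inv_pos.2 hfz
    have htf : t * f z = 1 := inv_mul_cancel₀ hfz.ne'
    have hts : t * C ≤ 4 * s := by
      have : C ≤ 4 * s * f z := by linarith
      calc t * C ≤ t * (4 * s * f z) := by gcongr
        _ = 4 * s * (t * f z) := by ring
        _ = 4 * s := by rw [htf, mul_one]
    have hQ : 0 ≤ 2 * (K * R * 2 ^ K) / ε := by positivity
    have htR : t * (R + 1) ≤ s / 2 := by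
      have : t * (8 * (R + 1)) ≤ t * C := mul_le_mul_of_nonneg_left (by linarith) ht0.le
      linarith
    have htε : 2 * (t * K * R * 2 ^ K) ≤ ε := by
      have : t * (2 * (K * R * 2 ^ K) / ε) ≤ t * C :=
        mul_le_mul_of_nonneg_left (by linarith) ht0.le
      have h5 : t * (2 * (K * R * 2 ^ K) / ε) ≤ 1 := by linarith
      rw [mul_div_assoc', div_le_iff₀ hε] at h5
      linarith
    have hin : ∀ y ∈ closedBall z (t * (R + 1)), y ∈ ball x0 (1 / 2) := fun y hy =>
      hsub (ball_subset_closedBall (hzs (closedBall_subset_closedBall htR hy)))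
    have hnorm : ∀ y ∈ ball x0 (1 / 2), 1 / 2 ≤ ‖y‖ ∧ ‖y‖ ≤ 2 := fun y hy => by
      rw [mem_ball, dist_eq_norm] at hy
      have h3 := norm_sub_norm_le y x0
      have h4 := norm_sub_norm_le x0 y
      rw [norm_sub_rev] at h4
      constructor <;> linarith
    have hsys := sys_of_solution hR ht0 h1 h2 (le_add_of_nonneg_right (abs_nonneg b))
      (le_add_of_nonneg_left (abs_nonneg a)) htε
      (fun y hy => hnorm y (hin y hy)) (fun y hy => (H y (hin y hy)).1)
      (fun y hy => (H y (hin y hy)).2.1) (fun y hy => (H y (hin y hy)).2.2.1)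
      (fun y hy => (H y (hin y hy)).2.2.2.1) (fun y hy => (H y (hin y hy)).2.2.2.2.1)
      (fun y hy => (H y (hin y hy)).2.2.2.2.2)
    have hmem : ∀ y ∈ ball (0 : Euc N) R, z + t • y ∈ closedBall z (t * (R + 1)) := fun y hy => by
      rw [mem_ball_zero_iff] at hy
      rw [mem_closedBall, dist_eq_norm, add_sub_cancel_left, norm_smul, Real.norm_of_nonneg ht0.le]
      exact mul_le_mul_of_nonneg_left (by linarith) ht0.le
    have hscale : ∀ {w : ℝ} {γ : ℝ}, 0 < γ → 0 ≤ w → ∀ {y}, y ∈ ball (0 : Euc N) R →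
        w ^ (1 / γ) ≤ f (z + t • y) → bump R y * (t ^ γ * w) ≤ 2 ^ γ := by
      intro w γ hγ hw y hy hle
      rw [bump_eq_one (mem_ball_zero_iff.1 hy).le, one_mul]
      have h3 := le_rpow_of_rpow_le hw hγ
        (hle.trans (hdbl _ (closedBall_subset_closedBall htR (hmem y hy))))
      calc t ^ γ * w ≤ t ^ γ * (2 * f z) ^ γ := by gcongr
        _ = (2 * (t * f z)) ^ γ := by
          rw [← Real.mul_rpow ht0.le (by positivity)]; congr 1; ring
        _ = 2 ^ γ := by rw [htf, mul_one]
    refine hliou _ _ _ _ hsys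
      (fun y hy => hscale hα (H _ (hin _ (hmem y hy))).2.2.1.le hy (huf _ (hin _ (hmem y hy))))
      (fun y hy => hscale hβ (H _ (hin _ (hmem y hy))).2.2.2.1.le hy
        (hvf _ (hin _ (hmem y hy)))) ?_
    have hz := H z (hin z (mem_closedBall_self (by positivity)))
    rw [bump_eq_one (by simpa using hR.le), one_mul, one_mul, smul_zero, add_zero,
      Real.mul_rpow (by positivity) hz.2.2.1.le, Real.mul_rpow (by positivity) hz.2.2.2.1.le,
      ← Real.rpow_mul ht0.le, ← Real.rpow_mul ht0.le, mul_one_div_cancel hα.ne',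
      mul_one_div_cancel hβ.ne', Real.rpow_one, ← mul_add]
    exact htf
  have hu := le_rpow_of_rpow_le (H x0 hx0m).2.2.1.le hα ((huf x0 hx0m).trans hfC)
  have hv := le_rpow_of_rpow_le (H x0 hx0m).2.2.2.1.le hβ ((hvf x0 hx0m).trans hfC)
  have hCα : 0 < C ^ α := by positivity
  have hCβ : 0 < C ^ β := by positivity
  constructor <;> linarith

end HardyHenon

/-- Theorem 1.3 (ii): decay estimate for positive solutions of the Hardy–Hénon
system on an exterior domain. -/
theorem decay_estimate
    (N : ℕ) (hN : 3 ≤ N) (a b p q : ℝ) (ha : -2 < a) (hb : -2 < b)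
    (hq : 0 < q) (hqp : q ≤ p) (hpq : 1 < p * q)
    (hhyper : (N : ℝ) / (p + 1) + (N : ℝ) / (q + 1) > (N : ℝ) - 2)
    (halpha : 2 * (p + 1) / (p * q - 1) > (N : ℝ) - 3) :
    ∃ C > 0, ∀ ρ : ℝ, 0 ≤ ρ → ∀ u v : EuclideanSpace ℝ (Fin N) → ℝ,
      IsHHSol a b p q {x : EuclideanSpace ℝ (Fin N) | ρ < ‖x‖} u v →
      ∀ x : EuclideanSpace ℝ (Fin N), 2 * ρ < ‖x‖ →
        u x ≤ C * ‖x‖ ^ (-(2 * (p + 1) / (p * q - 1)) - (a + b * p) / (p * q - 1)) ∧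
        v x ≤ C * ‖x‖ ^ (-(2 * (q + 1) / (p * q - 1)) - (b + a * q) / (p * q - 1)) := by
  have hk : 0 < p * q - 1 := by linarith
  have hk' := hk.ne'
  have hp : 0 < p := hq.trans_le hqp
  obtain ⟨C, hC, hbound⟩ := HardyHenon.unit_bound (N := N) (α := 2 * (p + 1) / (p * q - 1))
    (β := 2 * (q + 1) / (p * q - 1)) hN a b hp hq hpq hhyper
    ((lt_div_iff₀ hk).1 halpha) (by positivity) (by positivity)
    (by rw [div_add' _ _ _ hk', div_mul_eq_mul_div, div_left_inj' hk']; ring)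
    (by rw [div_add' _ _ _ hk', div_mul_eq_mul_div, div_left_inj' hk']; ring)
  refine ⟨C, hC, fun ρ hρ u v ⟨_, _, hu2, hv2, hu0, hv0, equ, eqv⟩ x hx => ?_⟩
  set A := 2 * (p + 1) / (p * q - 1) + (a + b * p) / (p * q - 1) with hA
  set B := 2 * (q + 1) / (p * q - 1) + (b + a * q) / (p * q - 1) with hB
  set D := ‖x‖ with hD
  have hD0 : 0 < D := by linarith
  have hAB : A + 2 + a = B * p := by
    rw [hA, hB, ← add_div, ← add_div, div_add' _ _ _ hk', div_add' _ _ _ hk', div_mul_eq_mul_div,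
      div_left_inj' hk']; ring
  have hBA : B + 2 + b = A * q := by
    rw [hA, hB, ← add_div, ← add_div, div_add' _ _ _ hk', div_add' _ _ _ hk', div_mul_eq_mul_div,
      div_left_inj' hk']; ring
  set Ω : Set (EuclideanSpace ℝ (Fin N)) := {x | ρ < ‖x‖} with hΩ
  have hopen : IsOpen (Ω \ {0}) :=
    (isOpen_lt continuous_const continuous_norm).sdiff isClosed_singleton
  have hmem : ∀ y ∈ ball (D⁻¹ • x) (1 / 2), 0 < ‖y‖ ∧ 0 + D • y ∈ Ω \ {0} := fun y hy => by
    have h1 : ‖D⁻¹ • x‖ = 1 := by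
      rw [norm_smul, norm_inv, Real.norm_of_nonneg hD0.le, ← hD, inv_mul_cancel₀ hD0.ne']
    rw [mem_ball, dist_eq_norm, norm_sub_rev] at hy
    have h2 := norm_sub_norm_le (D⁻¹ • x) y
    have h3 : 1 / 2 < ‖y‖ := by linarith
    refine ⟨by linarith, ?_, ?_⟩
    · change ρ < ‖0 + D • y‖
      rw [zero_add, norm_smul, Real.norm_of_nonneg hD0.le]
      nlinarith
    · have : y ≠ 0 := norm_pos_iff.1 (by linarith)
      simp [hD0.ne', this]
  have heq : ∀ {w w' : EuclideanSpace ℝ (Fin N) → ℝ} {s s' r e : ℝ}, s + 2 + e = s' * r →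
      ContDiffOn ℝ 2 w (Ω \ {0}) → (∀ y ∈ Ω, 0 < w' y) →
      (∀ y ∈ Ω \ {0}, -lap w y = ‖y‖ ^ e * w' y ^ r) → ∀ y ∈ ball (D⁻¹ • x) (1 / 2),
      -lap (fun y => D ^ s * w (0 + D • y)) y = ‖y‖ ^ e * (D ^ s' * w' (0 + D • y)) ^ r := by
    intro w w' s s' r e hs hw hw' hE y hy
    obtain ⟨hy0, hyΩ⟩ := hmem y hy
    have hwy : ContDiffAt ℝ 2 w (0 + D • y) := hw.contDiffAt (hopen.mem_nhds hyΩ)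
    have hc : ContDiff ℝ 2 (fun y : EuclideanSpace ℝ (Fin N) => 0 + D • y) := by fun_prop
    have h5 := hE _ hyΩ
    have h6 : ‖0 + D • y‖ ^ e = D ^ e * ‖y‖ ^ e := by
      rw [zero_add, norm_smul, Real.norm_of_nonneg hD0.le, Real.mul_rpow hD0.le hy0.le]
    rw [h6] at h5
    rw [HardyHenon.lap_const_mul (f := fun y => w (0 + D • y)) _ (hwy.comp y hc.contDiffAt),
      HardyHenon.lap_affine hwy,
      Real.mul_rpow (by positivity) (hw' _ hyΩ.1).le, ← Real.rpow_mul hD0.le, ← hs,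
      Real.rpow_add hD0, Real.rpow_add hD0, Real.rpow_two]
    linear_combination D ^ s * D ^ 2 * h5
  have hreg : ∀ {w : EuclideanSpace ℝ (Fin N) → ℝ} (s : ℝ), ContDiffOn ℝ 2 w (Ω \ {0}) →
      ∀ y ∈ ball (D⁻¹ • x) (1 / 2), ContDiffAt ℝ 2 (fun y => D ^ s * w (0 + D • y)) y := by
    intro w s hw y hy
    have hc : ContDiff ℝ 2 (fun y : EuclideanSpace ℝ (Fin N) => 0 + D • y) := by fun_prop
    exact contDiffAt_const.mul
      ((hw.contDiffAt (hopen.mem_nhds (hmem y hy).2)).comp y hc.contDiffAt)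
  have hfin := hbound (fun y => D ^ A * u (0 + D • y)) (fun y => D ^ B * v (0 + D • y)) (D⁻¹ • x)
    (by rw [norm_smul, norm_inv, Real.norm_of_nonneg hD0.le, ← hD, inv_mul_cancel₀ hD0.ne'])
    fun y hy => ⟨hreg A hu2 y hy, hreg B hv2 y hy,
      mul_pos (Real.rpow_pos_of_pos hD0 _) (hu0 _ (hmem y hy).2.1),
      mul_pos (Real.rpow_pos_of_pos hD0 _) (hv0 _ (hmem y hy).2.1),
      heq hAB hu2 hv0 equ y hy, heq hBA hv2 hu0 eqv y hy⟩
  rw [zero_add, smul_inv_smul₀ hD0.ne'] at hfin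
  rw [← neg_add', ← neg_add', ← hA, ← hB, Real.rpow_neg hD0.le, Real.rpow_neg hD0.le,
    ← div_eq_mul_inv, ← div_eq_mul_inv, le_div_iff₀ (by positivity), le_div_iff₀ (by positivity),
    mul_comm (u x), mul_comm (v x)]
  exact hfin
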